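/- Let G be a simple bipartite graph with n ≥ 3 vertices and m edges. Then the crossing number of G satisfies cr(G) ≥ 3m − (17/2)n + 19. -/

import Mathlib

section
open Set

/-- A topological drawing of a simple graph in the plane: vertices are mapped to distinct
points, each edge to a Jordan arc (parametrized over `[0,1]`) connecting its endpoints;
no arc passes through a vertex other than its endpoints; two adjacent edges meet only at
their shared endpoint (i.e. adjacent edges do not cross); two independent edges meet in at
most one point (so no edge crosses another more than once). -/
structure Drawing {V : Type*} (G : SimpleGraph V) where
  vert : V → ℝ × ℝ
  vert_inj : Function.Injective vert
  arc : G.edgeSet → ℝ → ℝ × ℝ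
  arc_cont : ∀ e, ContinuousOn (arc e) (Set.Icc 0 1)
  arc_inj : ∀ e, Set.InjOn (arc e) (Set.Icc 0 1)
  arc_ends : ∀ (e : G.edgeSet) (u v : V), (e : Sym2 V) = s(u, v) →
      ({arc e 0, arc e 1} : Set (ℝ × ℝ)) = {vert u, vert v}
  arc_vertex : ∀ (e : G.edgeSet), ∀ t ∈ Set.Icc (0:ℝ) 1, ∀ w : V,
      arc e t = vert w → w ∈ (e : Sym2 V)
  adj_meet : ∀ e f : G.edgeSet, e ≠ f →
      (∃ w : V, w ∈ (e : Sym2 V) ∧ w ∈ (f : Sym2 V)) →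
      ∀ p ∈ arc e '' Set.Icc (0:ℝ) 1, p ∈ arc f '' Set.Icc (0:ℝ) 1 →
        ∃ w : V, w ∈ (e : Sym2 V) ∧ w ∈ (f : Sym2 V) ∧ p = vert w
  nonadj_meet : ∀ e f : G.edgeSet,
      (¬ ∃ w : V, w ∈ (e : Sym2 V) ∧ w ∈ (f : Sym2 V)) →
      ((arc e '' Set.Icc (0:ℝ) 1) ∩ (arc f '' Set.Icc (0:ℝ) 1)).Subsingleton

/-- The image (point set) of an edge in a drawing. -/
def Drawing.img {V : Type*} {G : SimpleGraph V} (D : Drawing G) (e : G.edgeSet) :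
    Set (ℝ × ℝ) :=
  D.arc e '' Set.Icc (0:ℝ) 1

/-- Two edges cross in a drawing if they are distinct and meet at a point that is not the
image of any vertex. -/
def Drawing.Crosses {V : Type*} {G : SimpleGraph V} (D : Drawing G) (e f : G.edgeSet) :
    Prop :=
  e ≠ f ∧ ∃ p ∈ D.img e ∩ D.img f, ∀ w : V, D.vert w ≠ p

/-- In the drawing `D`, every edge is crossed at most `k` times (any two edges cross at
most once, so this is the number of edges crossing it). -/
def Drawing.AtMostKCrossings {V : Type*} {G : SimpleGraph V} (D : Drawing G) (k : ℕ) :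
    Prop :=
  ∀ e : G.edgeSet, {f : G.edgeSet | D.Crosses e f}.ncard ≤ k

/-- A graph is bipartite: its vertices can be split in two parts such that every edge
joins the two parts. -/
def IsBipartite {V : Type*} (G : SimpleGraph V) : Prop :=
  ∃ c : V → Bool, ∀ u v : V, G.Adj u v → c u ≠ c v

/-- The number of crossings in a drawing: since any two edges cross at most once, this
is the number of unordered pairs of crossing edges. -/
noncomputable def Drawing.crossingCount {V : Type*} {G : SimpleGraph V}
    (D : Drawing G) : ℕ :=
  {p : G.edgeSet × G.edgeSet | D.Crosses p.1 p.2}.ncard / 2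

/-- The crossing number of a graph: the minimum number of edge crossings over all
drawings of the graph in the plane. -/
noncomputable def crossingNumber {V : Type*} (G : SimpleGraph V) : ℕ :=
  sInf (Set.range fun D : Drawing G => D.crossingCount)

end

namespace BCN
open Equiv Equiv.Perm Finset

theorem orbit_sum {D : Type} [Fintype D] [DecidableEq D] (p : Perm D) (g : D → ℤ) (c : ℤ)
    (h : ∀ d, ∃ s : Finset D, (∀ x ∈ s, p.SameCycle d x) ∧ c ≤ ∑ x ∈ s, g x)
    (h0 : ∀ d, 0 ≤ g d) :
    c * (Nat.card (Quotient (SameCycle.setoid p)) : ℤ) ≤ ∑ x, g x := by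
  classical
  haveI : Fintype (Quotient (SameCycle.setoid p)) := Fintype.ofFinite _
  rw [Nat.card_eq_fintype_card]
  rw [← Finset.sum_fiberwise (s := Finset.univ) (g := fun x => (Quotient.mk (SameCycle.setoid p) x))]
  have : c * (Fintype.card (Quotient (SameCycle.setoid p)) : ℤ) =
      ∑ q : Quotient (SameCycle.setoid p), c := by
    simp [mul_comm, Finset.card_univ]
  rw [this]
  apply Finset.sum_le_sum
  intro q _
  induction q using Quotient.inductionOn with
  | h d =>
    obtain ⟨s, hs, hc⟩ := h d
    refine hc.trans (Finset.sum_le_sum_of_subset_of_nonneg ?_ (fun i _ _ => h0 i))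
    intro x hx
    simp only [Finset.mem_filter, Finset.mem_univ, true_and]
    exact Quotient.sound (show p.SameCycle x d from (hs x hx).symm)

structure PM (V D : Type) where
  α : Perm D
  σ : Perm D
  t : D → V
  kd : D → ℕ
  col : V → Bool
  W : Finset V
  αα : ∀ d, α (α d) = d
  hcol : ∀ d, col (t d) ≠ col (t (α d))
  kd_le : ∀ d, kd d ≤ 2
  kdσ : ∀ d, kd (σ d) = kd d
  tσ : ∀ d, kd d = 0 → t (σ d) = t d
  sc : ∀ d d', kd d = 0 → kd d' = 0 → t d = t d' → σ.SameCycle d d'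
  simple : ∀ d d', kd d = 0 → kd d' = 0 → t d = t d' → t (α d) = t (α d') → d = d'
  X4 : ∀ d, kd d = 1 → σ (σ (σ (σ d))) = d
  X2 : ∀ d, kd d = 1 → t (σ (σ d)) = t (α d)
  X2' : ∀ d, kd d = 1 → t (α (σ (σ d))) = t d
  nadj : ∀ d, kd d = 1 → t d ≠ t (σ d) ∧ t d ≠ t (α (σ d)) ∧ t (α d) ≠ t (σ d) ∧
    t (α d) ≠ t (α (σ d))
  two : ∀ d, kd d = 1 → kd (α d) = 1 → kd (α (σ (σ d))) = 0
  one : ∀ d, kd d = 1 → kd (α d) = 1 →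
    ¬ (t (σ d) = t (σ (α d)) ∧ t (α (σ d)) = t (α (σ (α d)))) ∧
    ¬ (t (σ d) = t (α (σ (α d))) ∧ t (α (σ d)) = t (σ (α d)))
  Yh : ∀ d, kd d = 2 → kd (α d) = 0
  Yn : ∀ d, kd d = 2 → t (α (σ d)) ≠ t (α d)
  tW : ∀ d, kd d = 0 → t d ∈ W
  deg2 : ∀ d, kd d = 0 → σ d ≠ d

namespace PM
variable {V D : Type} (P : PM V D)

def φ : Perm D := P.σ⁻¹ * P.α

theorem σφ (d : D) : P.σ (P.φ d) = P.α d := by simp [φ]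
theorem φ_iff (d e : D) : P.φ d = e ↔ P.σ e = P.α d := by
  rw [← P.σφ]; exact ⟨fun h => by rw [h], fun h => (P.σ.injective h).symm⟩
theorem kdφ (d : D) : P.kd (P.φ d) = P.kd (P.α d) := by
  rw [← P.σφ, P.kdσ]
theorem tφ (d : D) (h : P.kd (P.α d) = 0) : P.t (P.φ d) = P.t (P.α d) := by
  rw [← P.σφ, P.tσ _ (by rw [P.kdφ, h])]
theorem scφ (d : D) : P.φ.SameCycle d (P.φ d) := ⟨1, by simp⟩

def Euler [Fintype D] (P : PM V D) : Prop :=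
  6 * (Fintype.card D : ℤ) + 24 ≤ 12 * (Nat.card (Quotient (SameCycle.setoid P.φ)) : ℤ)
    + 12 * (P.W.card : ℤ) + 3 * ((univ.filter fun d => P.kd d = 1).card : ℤ)
    + 2 * ((univ.filter fun d => P.kd d = 2).card : ℤ)

/-- planar case -/
theorem planar_bound [Fintype D] [DecidableEq D] (hE : P.Euler) (h0 : ∀ d, P.kd d = 0) :
    (Fintype.card D : ℤ) ≤ 4 * (P.W.card : ℤ) - 8 := by
  have key : (4 : ℤ) * (Nat.card (Quotient (SameCycle.setoid P.φ)) : ℤ) ≤ ∑ x : D, 1 := by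
    apply orbit_sum P.φ (fun _ => 1) 4 _ (fun _ => by norm_num)
    intro d
    have t1 : ∀ d, P.t (P.φ d) = P.t (P.α d) := fun d => P.tφ d (h0 _)
    have c1 : ∀ d, P.col (P.t (P.φ d)) = ! P.col (P.t d) := by
      intro d; rw [t1]; have := P.hcol d
      cases h : P.col (P.t d) <;> cases h' : P.col (P.t (P.α d)) <;> simp_all
    have n1 : ∀ d, P.φ d ≠ d := by
      intro d h; have := c1 d; rw [h] at this; simp at this
    have n3 : ∀ d, P.φ (P.φ (P.φ d)) ≠ d := by
      intro d h; have := c1 (P.φ (P.φ d)); rw [h, c1, c1] at this; simp at this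
    have n2 : ∀ d, P.φ (P.φ d) ≠ d := by
      intro d h
      have e1 : P.σ (P.φ d) = P.α d := P.σφ d
      have : P.α d = P.φ d := by
        apply P.simple _ _ (h0 _) (h0 _) (t1 d).symm
        rw [P.αα, ← t1 (P.φ d), h]
      rw [← this] at e1
      exact P.deg2 _ (h0 _) e1
    refine ⟨{d, P.φ d, P.φ (P.φ d), P.φ (P.φ (P.φ d))}, ?_, ?_⟩
    · intro x hx
      simp only [Finset.mem_insert, Finset.mem_singleton] at hx
      have := P.scφ
      rcases hx with rfl | rfl | rfl | rfl
      · exact SameCycle.refl _ _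
      · exact this _
      · exact (this _).trans (this _)
      · exact ((this _).trans (this _)).trans (this _)
    · rw [Finset.sum_const, nsmul_one]
      rw [Finset.card_insert_of_notMem, Finset.card_insert_of_notMem, Finset.card_insert_of_notMem]
      · simp
      · simp [(n1 _).symm]
      · simp [(n1 _).symm, (n2 _).symm]
      · simp [(n1 _).symm, (n2 _).symm, (n3 _).symm]
  unfold Euler at hE
  simp [h0] at hE
  simp at key
  linarith
end PM
end BCN

namespace BCN
open Equiv Equiv.Perm Finset
namespace PM
variable {V D : Type} (P : PM V D)

/-- left type of a dart: 0 uncrossed, 1 same colour, 2 opposite colour -/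
def Lt (d : D) : Fin 3 := if P.kd (P.α d) = 0 then 0 else
  if P.col (P.t d) = P.col (P.t (P.α (P.φ d))) then 1 else 2
def Rt (d : D) : Fin 3 := if P.kd (P.α d) = 0 then 0 else
  if P.col (P.t d) = P.col (P.t (P.α (P.σ (P.α d)))) then 1 else 2
def vl (x : Fin 3) : ℤ := if x = 0 then 4 else if x = 1 then 6 else 8
def nd (x y : Fin 3) : ℤ :=
  if x = 0 ∧ y = 0 then 2 else if x = 1 ∧ y = 2 then 2 else if x = 2 ∧ y = 1 then 2 else
  if x = 0 ∧ y = 1 then 1 else if x = 1 ∧ y = 0 then 1 else if x = 2 ∧ y = 2 then 1 else 0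
def nd2 (d : D) : ℤ := nd (P.Rt (P.σ d)) (P.Lt d)

theorem nd_nonneg (x y : Fin 3) : 0 ≤ nd x y := by revert x y; decide
theorem nd_le (x y : Fin 3) : nd x y ≤ 2 := by revert x y; decide
theorem six_le (x y : Fin 3) : 6 ≤ 2 * vl y - nd x y := by revert x y; decide

theorem tσσ (d : D) (h : P.kd d = 1) : P.t (P.σ (P.σ d)) = P.t (P.α d) := P.X2 d h

theorem hσφ (d : D) (h : P.kd (P.α d) = 1) : P.t (P.α (P.φ d)) = P.t (P.σ (P.α d)) := by
  have h1 : P.kd (P.φ d) = 1 := by rw [P.kdφ, h]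
  rw [← P.X2 _ h1, P.σφ]

theorem LR (d : D) (h1 : P.kd (P.α d) = 1) :
    (P.Lt d = 1 ∧ P.Rt d = 2) ∨ (P.Lt d = 2 ∧ P.Rt d = 1) := by
  unfold Lt Rt
  rw [P.hσφ d h1]
  have := P.hcol (P.σ (P.α d))
  simp only [h1]
  cases P.col (P.t d) <;> cases h2 : P.col (P.t (P.σ (P.α d))) <;>
    cases h3 : P.col (P.t (P.α (P.σ (P.α d)))) <;> simp_all

theorem LR0 (d : D) (h1 : P.kd (P.α d) = 0) : P.Lt d = 0 ∧ P.Rt d = 0 := by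
  simp [Lt, Rt, h1]

/-- next vertex dart along the face (1-planar case) -/
def ψ (d : D) : D := if P.kd (P.α d) = 0 then P.φ d else P.φ (P.φ d)

structure OneP : Prop where
  noY : ∀ d, P.kd d ≠ 2
  nomid : ∀ d, P.kd d = 1 → P.kd (P.α d) = 0

variable {P}
theorem OneP.k01 (H : P.OneP) (d : D) : P.kd d = 0 ∨ P.kd d = 1 := by
  have := H.noY d; have := P.kd_le d; omega

theorem OneP.kdψ (H : P.OneP) (d : D) : P.kd (P.ψ d) = 0 := by
  unfold ψ
  split_ifs with h
  · rw [P.kdφ, h]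
  · rw [P.kdφ]; apply H.nomid; rw [P.kdφ]; exact (H.k01 _).resolve_left h

theorem OneP.ψinj (H : P.OneP) (d e : D) (hd : P.kd d = 0) (he : P.kd e = 0) (h : P.ψ d = P.ψ e) :
    d = e := by
  unfold ψ at h
  split_ifs at h with h1 h2 h2
  · exact P.φ.injective h
  · have := P.φ.injective h; rw [this, P.kdφ] at hd; omega
  · have := P.φ.injective h; rw [← this, P.kdφ] at he; omega
  · exact P.φ.injective (P.φ.injective h)

theorem ψsc (P : PM V D) (d : D) : P.φ.SameCycle d (P.ψ d) := by
  unfold ψ; split_ifs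
  · exact P.scφ d
  · exact (P.scφ _).trans (P.scφ _)

theorem OneP.Lψ (H : P.OneP) (d : D) (hd : P.kd d = 0) : P.Rt (P.σ (P.ψ d)) = P.Lt d := by
  unfold ψ
  split_ifs with h
  · rw [P.σφ]; simp [Lt, Rt, h, P.αα, hd]
  · have h1 := (H.k01 _).resolve_left h
    rw [P.σφ]
    have h3 : P.kd (P.φ d) = 1 := by rw [P.kdφ, h1]
    have h4 := H.nomid _ h3
    unfold Lt Rt
    rw [P.αα, P.σφ, P.αα, h3]
    simp only [h, if_false, one_ne_zero]
    congr 1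
    exact propext eq_comm

/-- colour flip -/
theorem OneP.cψ (H : P.OneP) (d : D) :
    (P.Lt d = 1 ∧ P.col (P.t (P.ψ d)) = P.col (P.t d)) ∨
    (P.Lt d ≠ 1 ∧ P.col (P.t (P.ψ d)) = !P.col (P.t d)) := by
  unfold ψ Lt
  split_ifs with h h'
  · right; refine ⟨by decide, ?_⟩; rw [P.tφ d h]; have := P.hcol d
    cases h2 : P.col (P.t d) <;> cases h3 : P.col (P.t (P.α d)) <;> simp_all
  · left; refine ⟨rfl, ?_⟩
    have h1 := (H.k01 _).resolve_left h
    rw [P.tφ, h']; apply H.nomid; rw [P.kdφ, h1]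
  · right; refine ⟨by decide, ?_⟩
    have h1 := (H.k01 _).resolve_left h
    rw [P.tφ]
    · cases h2 : P.col (P.t d) <;> cases h3 : P.col (P.t (P.α (P.φ d))) <;> simp_all
    · apply H.nomid; rw [P.kdφ, h1]

theorem OneP.nψ1 (H : P.OneP) (d : D) : P.ψ d ≠ d := by
  intro h
  rcases H.cψ d with h1 | h1
  · unfold ψ at h
    split_ifs at h with h2
    · simp [Lt, h2] at h1
    · have h3 := (H.k01 _).resolve_left h2
      have h4 : P.kd (P.φ d) = 1 := by rw [P.kdφ, h3]
      have h5 : P.t (P.α (P.φ d)) = P.t d := by rw [← P.tφ _ (H.nomid _ h4), h]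
      have := (P.nadj _ h4).2.2.2
      rw [P.σφ, P.αα] at this; exact this h5
  · rw [h] at h1; simp at h1

theorem OneP.nψ2 (H : P.OneP) (d : D) (hd : P.kd d = 0) (h : P.ψ (P.ψ d) = d) :
    ¬ (P.Lt d = 0 ∧ P.Lt (P.ψ d) = 0) := by
  rintro ⟨h1, h2⟩
  have z : ∀ e, P.Lt e = 0 → P.kd (P.α e) = 0 := by
    intro e he; by_contra hc
    unfold Lt at he; rw [if_neg hc] at he; split_ifs at he <;> simp at he
  have k1 := z _ h1
  have k2 := z _ h2
  have e1 : P.ψ d = P.φ d := by simp [ψ, k1]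
  have e2 : P.ψ (P.ψ d) = P.φ (P.ψ d) := by exact if_pos k2
  rw [e2, e1] at h
  rw [e1] at k2
  have : P.α d = P.φ d := by
    apply P.simple _ _ k1 (by rw [P.kdφ, k1]) (P.tφ d k1).symm
    rw [P.αα, ← P.tφ (P.φ d) k2, h]
  have e3 := P.σφ d
  rw [← this] at e3
  exact P.deg2 _ k1 e3

def g1 (P : PM V D) (d : D) : ℤ := if P.kd d = 0 then 2 * vl (P.Lt d) - P.nd2 d else 0

theorem g1_nonneg (P : PM V D) (d : D) : 0 ≤ P.g1 d := by
  unfold g1; split_ifs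
  · have := six_le (P.Rt (P.σ d)) (P.Lt d); unfold nd2; omega
  · exact le_rfl

theorem OneP.face (H : P.OneP) [DecidableEq D] (d : D) :
    ∃ s : Finset D, (∀ x ∈ s, P.φ.SameCycle d x) ∧ 24 ≤ ∑ x ∈ s, P.g1 x := by
  obtain ⟨d0, hd0, hs0⟩ : ∃ d0, P.kd d0 = 0 ∧ P.φ.SameCycle d d0 := ⟨P.ψ d, H.kdψ d, P.ψsc d⟩
  set d1 := P.ψ d0 with e1
  set d2 := P.ψ d1 with e2
  set d3 := P.ψ d2 with e3
  have k1 : P.kd d1 = 0 := H.kdψ _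
  have k2 : P.kd d2 = 0 := H.kdψ _
  have k3 : P.kd d3 = 0 := H.kdψ _
  have s1 : P.φ.SameCycle d d1 := hs0.trans (P.ψsc _)
  have s2 : P.φ.SameCycle d d2 := s1.trans (P.ψsc _)
  have s3 : P.φ.SameCycle d d3 := s2.trans (P.ψsc _)
  have gv : ∀ x, P.kd x = 0 → P.g1 x = 2 * vl (P.Lt x) - nd (P.Rt (P.σ x)) (P.Lt x) := by
    intro x hx; simp [g1, hx, nd2]
  have g6 : ∀ x, P.kd x = 0 → 6 ≤ P.g1 x := fun x hx => by rw [gv x hx]; exact six_le _ _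
  have R1 : P.Rt (P.σ d1) = P.Lt d0 := H.Lψ d0 hd0
  have R2 : P.Rt (P.σ d2) = P.Lt d1 := H.Lψ d1 k1
  have R3 : P.Rt (P.σ d3) = P.Lt d2 := H.Lψ d2 k2
  have n01 : d0 ≠ d1 := (H.nψ1 _).symm
  have n12 : d1 ≠ d2 := (H.nψ1 _).symm
  have n23 : d2 ≠ d3 := (H.nψ1 _).symm
  have c0 := H.cψ d0
  have c1 := H.cψ d1
  have c2 := H.cψ d2
  by_cases h02 : d2 = d0
  · refine ⟨{d0, d1}, by simp [hs0, s1], ?_⟩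
    have := H.nψ2 d0 hd0 h02
    rw [Finset.sum_pair n01, gv _ hd0, gv _ k1, R1]
    rw [h02] at R2; rw [R2]
    rw [← e1] at c0 this
    rw [← e2, h02] at c1
    generalize P.Lt d0 = a at *
    generalize P.Lt d1 = b at *
    have p : (a = 1) ↔ (b = 1) := by
      generalize P.col (P.t d0) = x at c0 c1
      generalize P.col (P.t d1) = y at c0 c1
      clear * - c0 c1
      revert a b x y; decide
    clear c0 c1 R1 R2
    revert this p
    revert a b; decide
  by_cases h03 : d3 = d0
  · refine ⟨{d0, d1, d2}, by simp [hs0, s1, s2], ?_⟩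
    have h02' : d0 ≠ d2 := fun h => h02 h.symm
    rw [Finset.sum_insert (by simp [n01, h02']), Finset.sum_pair n12, gv _ hd0, gv _ k1, gv _ k2,
      R1, R2]
    rw [h03] at R3; rw [R3]
    rw [← e1] at c0
    rw [← e2] at c1
    rw [← e3, h03] at c2
    generalize P.Lt d0 = a at *
    generalize P.Lt d1 = b at *
    generalize P.Lt d2 = c at *
    have p : ¬ ((a ≠ 1 ∧ b ≠ 1 ∧ c ≠ 1) ∨ (a = 1 ∧ b = 1 ∧ c ≠ 1) ∨ (a = 1 ∧ b ≠ 1 ∧ c = 1) ∨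
       (a ≠ 1 ∧ b = 1 ∧ c = 1)) := by
      generalize P.col (P.t d0) = x at c0 c1 c2
      generalize P.col (P.t d1) = y at c0 c1 c2
      generalize P.col (P.t d2) = z at c0 c1 c2
      clear * - c0 c1 c2
      revert c0 c1 c2
      by_cases ha : a = 1 <;> by_cases hb : b = 1 <;> by_cases hc : c = 1 <;>
        cases x <;> cases y <;> cases z <;> simp [ha, hb, hc]
    clear c0 c1 c2 R1 R2 R3
    revert p
    revert a b c; decide
  · have n13 : d1 ≠ d3 := fun h => h02 (H.ψinj _ _ hd0 k2 h).symm
    refine ⟨{d0, d1, d2, d3}, by simp [hs0, s1, s2, s3], ?_⟩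
    rw [Finset.sum_insert (by simp [n01, Ne.symm h02, Ne.symm h03]),
      Finset.sum_insert (by simp [n12, n13]), Finset.sum_pair n23]
    have := g6 _ hd0; have := g6 _ k1; have := g6 _ k2; have := g6 _ k3
    omega
end PM
end BCN

namespace BCN
open Equiv Equiv.Perm Finset
namespace PM
variable {V D : Type} {P : PM V D}

def rr (x : Fin 3) : Fin 3 := if x = 0 then 0 else if x = 1 then 2 else 1

theorem OneP.Rr (H : P.OneP) (d : D) : P.Rt d = rr (P.Lt d) := by
  rcases H.k01 (P.α d) with h | h
  · obtain ⟨h1, h2⟩ := P.LR0 d h; rw [h1, h2]; rfl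
  · rcases P.LR d h with ⟨h1, h2⟩ | ⟨h1, h2⟩ <;> rw [h1, h2] <;> rfl

theorem dec4 : ∀ a b c d : Fin 3, 6 ≤ 1 + nd (rr b) a + (1 + nd (rr c) b) + (1 + nd (rr d) c)
    + (1 + nd (rr a) d) := by decide
theorem dec5 : ∀ a b c d e : Fin 3, 6 ≤ 1 + nd (rr b) a + (1 + nd (rr c) b) + (1 + nd (rr d) c)
    + (1 + nd (rr e) d) + (1 + nd (rr a) e) := by
  set_option maxRecDepth 100000 in decide

theorem kd_iter (P : PM V D) (d : D) (h : P.kd d = 0) (i : ℕ) : P.kd (P.σ^[i] d) = 0 ∧ P.t (P.σ^[i] d) = P.t d := by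
  induction i with
  | zero => simp [h]
  | succ i ih => rw [Function.iterate_succ_apply', P.kdσ, P.tσ _ ih.1]; exact ih

theorem OneP.vertex [Fintype D] [DecidableEq D] [DecidableEq V] (H : P.OneP) (v : V)
    (hdeg : 4 ≤ (univ.filter fun d => P.kd d = 0 ∧ P.t d = v).card) :
    6 ≤ ∑ d ∈ univ.filter (fun d => P.kd d = 0 ∧ P.t d = v), (1 + P.nd2 d) := by
  have hne : (univ.filter fun d => P.kd d = 0 ∧ P.t d = v).Nonempty := by
    rw [← Finset.card_pos]; omega
  obtain ⟨d, hd⟩ := hne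
  simp only [Finset.mem_filter, Finset.mem_univ, true_and] at hd
  obtain ⟨hd0, rfl⟩ := hd
  set k := Function.minimalPeriod P.σ d with hk
  have hper : P.σ^[k] d = d := Function.iterate_minimalPeriod
  have hpos : 0 < k := by
    apply Function.minimalPeriod_pos_of_mem_periodicPts
    exact (P.σ.injective.mem_periodicPts d)
  have himg : univ.filter (fun e => P.kd e = 0 ∧ P.t e = P.t d) =
      (Finset.range k).image (fun i => P.σ^[i] d) := by
    ext e
    simp only [Finset.mem_filter, Finset.mem_univ, true_and, Finset.mem_image, Finset.mem_range]
    constructor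
    · rintro ⟨h1, h2⟩
      obtain ⟨i, hi⟩ := (P.sc d e hd0 h1 h2.symm).exists_nat_pow_eq
      refine ⟨i % k, Nat.mod_lt _ hpos, ?_⟩
      rw [Function.iterate_mod_minimalPeriod_eq, ← hi]
      simp [Equiv.Perm.iterate_eq_pow]
    · rintro ⟨i, -, rfl⟩
      exact P.kd_iter d hd0 i
  have hinj : Set.InjOn (fun i => P.σ^[i] d) (Finset.range k) := by
    intro i hi j hj hij
    exact Function.iterate_injOn_Iio_minimalPeriod (by simpa using hi) (by simpa using hj) hij
  have hcard : (univ.filter fun e => P.kd e = 0 ∧ P.t e = P.t d).card = k := by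
    rw [himg, Finset.card_image_of_injOn hinj, Finset.card_range]
  by_cases h6 : 6 ≤ k
  · have : ∑ e ∈ univ.filter (fun e => P.kd e = 0 ∧ P.t e = P.t d), (1 : ℤ) ≤
      ∑ e ∈ univ.filter (fun e => P.kd e = 0 ∧ P.t e = P.t d), (1 + P.nd2 e) := by
      apply Finset.sum_le_sum
      intro e _
      have := nd_nonneg (P.Rt (P.σ e)) (P.Lt e)
      unfold nd2; omega
    rw [Finset.sum_const, hcard] at this
    simp at this
    omega
  rw [himg, Finset.sum_image hinj]
  clear_value k
  rw [hcard] at hdeg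
  obtain rfl | rfl : k = 4 ∨ k = 5 := by omega
  · simp only [Finset.sum_range_succ, Finset.sum_range_zero, nd2, H.Rr, Function.iterate_succ_apply',
      Function.iterate_zero, id] at *
    rw [hper]
    have := dec4 (P.Lt d) (P.Lt (P.σ d)) (P.Lt (P.σ (P.σ d))) (P.Lt (P.σ (P.σ (P.σ d))))
    omega
  · simp only [Finset.sum_range_succ, Finset.sum_range_zero, nd2, H.Rr, Function.iterate_succ_apply',
      Function.iterate_zero, id] at *
    rw [hper]
    have := dec5 (P.Lt d) (P.Lt (P.σ d)) (P.Lt (P.σ (P.σ d))) (P.Lt (P.σ (P.σ (P.σ d))))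
      (P.Lt (P.σ (P.σ (P.σ (P.σ d)))))
    omega

theorem OneP.half [Fintype D] [DecidableEq D] (H : P.OneP) :
    ∑ d : D, (if P.kd d = 0 ∧ P.kd (P.α d) = 1 then vl (P.Lt d) - 7 else 0) = 0 := by
  have hinv : ∀ d, P.kd (P.α d) = 1 → P.kd d = 0 := by
    intro d h; have := H.nomid _ h; rwa [P.αα] at this
  set f : D → ℤ := fun y => if P.kd y = 1 then vl (P.Lt (P.α y)) - 7 else 0 with hf
  have e1 : ∑ d : D, (if P.kd d = 0 ∧ P.kd (P.α d) = 1 then vl (P.Lt d) - 7 else 0) =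
      ∑ d, f (P.α d) := by
    apply Finset.sum_congr rfl
    intro d _
    simp only [hf, P.αα]
    by_cases h : P.kd (P.α d) = 1
    · simp [h, hinv d h]
    · simp [h]
  rw [e1, Equiv.sum_comp P.α f]
  have e2 : ∀ y, f (P.σ y) = - f y := by
    intro y
    simp only [hf, P.kdσ]
    split_ifs with h
    · have hy : P.kd (P.σ y) = 1 := by rw [P.kdσ, h]
      unfold Lt
      have a1 : P.φ (P.α (P.σ y)) = y := by rw [P.φ_iff, P.αα]
      rw [P.αα, P.αα, a1, h, hy]
      have a2 : P.t (P.α (P.φ (P.α y))) = P.t (P.σ y) := by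
        rw [P.hσφ _ (by rw [P.αα, h]), P.αα]
      rw [a2]
      have := P.hcol (P.σ y)
      cases h2 : P.col (P.t (P.σ y)) <;> cases h3 : P.col (P.t (P.α (P.σ y))) <;>
        cases h4 : P.col (P.t (P.α y)) <;> simp_all [vl]
    · simp
  have e3 := Equiv.sum_comp P.σ f
  simp only [e2, Finset.sum_neg_distrib] at e3
  omega

theorem OneP.bound [Fintype D] [DecidableEq D] [DecidableEq V] (H : P.OneP) (hE : P.Euler)
    (hdeg : ∀ v ∈ P.W, 4 ≤ (univ.filter fun d => P.kd d = 0 ∧ P.t d = v).card) :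
    ((univ.filter fun d => P.kd d = 0).card : ℤ) ≤ 6 * (P.W.card : ℤ) - 16 := by
  have key := orbit_sum P.φ P.g1 24 H.face P.g1_nonneg
  have hv : 6 * (P.W.card : ℤ) ≤ ∑ d ∈ univ.filter (fun d => P.kd d = 0), (1 + P.nd2 d) := by
    have : ∀ d ∈ univ.filter (fun d => P.kd d = 0), P.t d ∈ P.W := by
      intro d hd; exact P.tW d (by simpa using hd)
    rw [← Finset.sum_fiberwise_of_maps_to this]
    have : 6 * (P.W.card : ℤ) = ∑ v ∈ P.W, 6 := by simp [mul_comm]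
    rw [this]
    apply Finset.sum_le_sum
    intro v hv
    rw [Finset.filter_filter]
    exact H.vertex v (hdeg v hv)
  have e1 : ∑ x, P.g1 x = ∑ x : D, ((if P.kd x = 0 then 8 else 0) +
     (if P.kd x = 1 then 6 else 0)
      + 2 * (if P.kd x = 0 ∧ P.kd (P.α x) = 1 then vl (P.Lt x) - 7 else 0)) -
      ∑ d ∈ univ.filter (fun d => P.kd d = 0), P.nd2 d := by
    have r1 : ∑ x : D, (if P.kd x = 1 then (6:ℤ) else 0) = ∑ x : D, (if P.kd (P.α x) = 1 then (6:ℤ) else 0) :=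
      (Equiv.sum_comp P.α (fun x => if P.kd x = 1 then (6:ℤ) else 0)).symm
    rw [Finset.sum_add_distrib, Finset.sum_add_distrib, r1, ← Finset.sum_add_distrib,
      ← Finset.sum_add_distrib, Finset.sum_filter, ← Finset.sum_sub_distrib]
    apply Finset.sum_congr rfl
    intro d _
    unfold g1
    rcases H.k01 (P.α d) with h | h
    · rcases H.k01 d with h' | h'
      · simp [h, h', (P.LR0 d h).1, vl]
      · simp [h, h']
    · have := H.nomid _ h; rw [P.αα] at this
      simp [h, this]; ring
  rw [e1, Finset.sum_add_distrib, ← Finset.mul_sum, H.half, Finset.sum_add_distrib, ← Finset.sum_filter,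
    ← Finset.sum_filter, Finset.sum_const, Finset.sum_const] at key
  rw [Finset.sum_add_distrib, Finset.sum_const] at hv
  have hD : (Fintype.card D : ℤ) = ((univ.filter fun d => P.kd d = 0).card : ℤ) +
      ((univ.filter fun d => P.kd d = 1).card : ℤ) := by
    have := Finset.card_filter_add_card_filter_not (s := (univ : Finset D)) (fun d => P.kd d = 0)
    have h2 : univ.filter (fun d => ¬ P.kd d = 0) = univ.filter (fun d => P.kd d = 1) := by
      ext d; have := H.k01 d; simp; omega
    rw [h2] at this
    rw [← Finset.card_univ]; exact_mod_cast this.symm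
  have hY : (univ.filter fun d => P.kd d = 2).card = 0 := by
    simp [H.noY]
  unfold Euler at hE
  rw [hY] at hE
  simp at key hv
  push_cast at hE
  linarith
end PM
end BCN

namespace BCN
open Equiv Equiv.Perm Finset
namespace PM
variable {V D : Type} (P : PM V D)

/-- corner indicator -/
def pp (y : D) : Prop := P.kd y = 1 ∧ P.kd (P.α y) = 0 ∧ P.kd (P.α (P.σ.symm y)) = 0 ∧
  P.col (P.t (P.α y)) = P.col (P.t (P.α (P.σ.symm y)))

open Classical in
noncomputable def p (y : D) : ℤ := if P.pp y then 1 else 0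

def mid (d : D) : Prop := P.kd d = 1 ∧ P.kd (P.α d) = 1
def T (d : D) : Prop := P.kd (P.φ (P.φ d)) = 0 ∧ P.φ (P.φ (P.φ d)) = d
def N (d : D) : Prop := ∀ x, P.φ.SameCycle d x → P.kd x ≠ 0

noncomputable def Pc (d : D) : ℤ := P.p (P.σ (P.σ d)) + P.p (P.σ (P.σ (P.σ d))) +
  P.p (P.σ (P.σ (P.α d))) + P.p (P.σ (P.σ (P.σ (P.α d))))

open Classical in
noncomputable def sh (d : D) : ℤ := if P.T d then 10 else if P.T (P.α d) then
  (if 2 ≤ P.Pc d then 6 else 4) else if P.N d then 12 else if P.N (P.α d) then 0 else 6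

open Classical in
noncomputable def av (d : D) : ℤ := if P.kd (P.α d) = 0 then 10 else 18 - 4 * P.p (P.α d)

open Classical in
noncomputable def g2 (d : D) : ℤ := if P.kd d = 0 then P.av d else if P.mid d then P.sh d else 0

variable {P}

theorem p_nonneg (y : D) : 0 ≤ P.p y := by unfold p; split_ifs <;> norm_num
theorem p_le (y : D) : P.p y ≤ 1 := by unfold p; split_ifs <;> norm_num
theorem sh_nonneg (y : D) : 0 ≤ P.sh y := by unfold sh; split_ifs <;> norm_num
theorem av_ge (y : D) : 10 ≤ P.av y := by
  unfold av; have := p_le (P := P) (P.α y); split_ifs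
  · norm_num
  · linarith
theorem g2_nonneg (d : D) : 0 ≤ P.g2 d := by
  unfold g2; have := av_ge (P := P) d; have := sh_nonneg (P := P) d; split_ifs <;> linarith

theorem symσ (y : D) (h : P.kd y = 1) : P.σ.symm y = P.σ (P.σ (P.σ y)) := by
  rw [Equiv.symm_apply_eq, P.X4 y h]

theorem φsymm (d : D) : P.φ d = P.σ.symm (P.α d) := rfl

theorem col_ne {a b c : Bool} (h : a ≠ b) (h' : c ≠ a) : c = b := by
  revert a b c; decide

theorem mid.α {d : D} (h : P.mid d) : P.mid (P.α d) := ⟨h.2, by rw [P.αα]; exact h.1⟩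

/-- X darts have V or X heads -/
theorem Xhead (d : D) (h : P.kd d = 1) (h0 : P.kd (P.α d) ≠ 0) : P.mid d := by
  refine ⟨h, ?_⟩
  have := P.kd_le (P.α d)
  by_contra hc
  have h2 : P.kd (P.α d) = 2 := by omega
  have := P.Yh _ h2; rw [P.αα] at this; omega

theorem N_iff_φ (d : D) : P.N (P.φ d) ↔ P.N d := by
  unfold N
  constructor
  · intro h x hx; exact h x ((P.scφ d).symm.trans hx)
  · intro h x hx; exact h x ((P.scφ d).trans hx)

theorem N_same {d x : D} (h : P.N d) (hx : P.φ.SameCycle d x) : P.N x :=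
  fun y hy => h y (hx.trans hy)

theorem N_kd {d : D} (h : P.N d) : P.kd d ≠ 0 := h d (SameCycle.refl _ _)

/-- in an N face everything is mid -/
theorem N_mid {d : D} (h : P.N d) : P.mid d := by
  have h1 := N_kd h
  have h2 : P.kd (P.α d) ≠ 0 := by rw [← P.kdφ]; exact N_kd ((N_iff_φ d).2 h)
  have : P.kd d = 1 := by
    have := P.kd_le d
    by_contra hc
    have := P.Yh d (by omega); omega
  exact Xhead d this h2

/-- `d` and `φ d` mid: then the other side of `d` sees a vertex, and that of `φ d` too -/
theorem notN1 {d : D} (h2 : P.mid (P.φ d)) : ¬ P.N (P.α d) := by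
  intro h
  have := P.two _ h2.1 h2.2
  rw [P.σφ] at this
  have hs : P.φ (P.α (P.σ (P.α d))) = P.α d := by rw [P.φ_iff, P.αα]
  exact h _ (by have := P.scφ (P.α (P.σ (P.α d))); rw [hs] at this; exact this.symm) this

theorem notN2 {d : D} (h1 : P.mid d) : ¬ P.N (P.α (P.φ d)) := by
  intro h
  have h3 := P.two _ h1.α.1 h1.α.2
  have hs : P.φ (P.α (P.φ d)) = P.σ (P.σ (P.α d)) := by
    rw [P.φ_iff, P.αα, ← P.σφ]; apply P.X4; rw [P.kdφ]; exact h1.2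
  have h4 := (N_iff_φ _).2 ((N_iff_φ _).2 h)
  rw [hs] at h4
  have h5 := N_kd h4
  rw [P.kdφ] at h5; exact h5 h3

theorem N_excl {d : D} (h : P.N d) : ¬ P.N (P.α d) := notN1 (N_mid ((N_iff_φ d).2 h))

/-- description of a triangular face -/
theorem T_spec {d : D} (hd : P.mid d) (h : P.T d) :
    P.kd (P.α (P.σ d)) = 0 ∧ P.kd (P.α (P.φ d)) = 0 ∧ P.t (P.α (P.σ d)) = P.t (P.α (P.φ d)) := by
  obtain ⟨h1, h2⟩ := h
  have e : P.σ d = P.α (P.φ (P.φ d)) := by rw [P.φ_iff] at h2; exact h2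
  rw [e, P.αα]
  refine ⟨h1, by rw [← P.kdφ]; exact h1, ?_⟩
  rw [P.tφ]; rw [← P.kdφ]; exact h1

theorem T_excl {d : D} (hd : P.mid d) (h : P.T d) : ¬ P.T (P.α d) := by
  intro h'
  obtain ⟨a1, a2, a3⟩ := T_spec hd h
  obtain ⟨b1, b2, b3⟩ := T_spec hd.α h'
  have k : P.kd (P.α d) = 1 := hd.2
  have ho := (P.one d hd.1 hd.2).2
  rw [P.hσφ _ (by rw [P.αα]; exact hd.1), P.αα] at b3
  rw [P.hσφ _ k] at a3
  exact ho ⟨b3.symm, a3⟩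

theorem pp_iff (y : D) (h : P.kd y = 1) : P.pp (P.σ y) ↔ P.kd (P.α (P.σ y)) = 0 ∧ P.kd (P.α y) = 0 ∧
    P.col (P.t (P.α (P.σ y))) = P.col (P.t (P.α y)) := by
  unfold pp; rw [P.kdσ, Equiv.symm_apply_apply]; simp [h]

theorem p_of (y : D) (h : P.kd y = 1) (h1 : P.kd (P.α (P.σ y)) = 0) (h2 : P.kd (P.α y) = 0)
    (h3 : P.col (P.t (P.α (P.σ y))) = P.col (P.t (P.α y))) : P.p (P.σ y) = 1 := by
  unfold p; rw [if_pos]; exact (pp_iff y h).2 ⟨h1, h2, h3⟩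

theorem T_P {d : D} (hd : P.mid d) (h : P.T d) :
    1 ≤ P.p (P.σ (P.σ d)) + P.p (P.σ (P.σ (P.σ (P.α d)))) := by
  obtain ⟨a1, a2, a3⟩ := T_spec hd h
  have t1 := P.two _ hd.1 hd.2
  have t2 := P.two _ hd.α.1 hd.α.2
  have n1 := p_nonneg (P := P) (P.σ (P.σ d))
  have n2 := p_nonneg (P := P) (P.σ (P.σ (P.σ (P.α d))))
  have kσ : P.kd (P.σ d) = 1 := by rw [P.kdσ]; exact hd.1
  have kσ2 : P.kd (P.σ (P.σ (P.α d))) = 1 := by rw [P.kdσ, P.kdσ]; exact hd.2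
  have e : P.σ (P.σ (P.σ (P.α d))) = P.φ d := by rw [φsymm, symσ _ hd.2]
  by_cases hc : P.col (P.t d) = P.col (P.t (P.α (P.σ d)))
  · have := p_of (P := P) (P.σ d) kσ t1 a1 (by rw [P.X2' _ hd.1]; exact hc)
    omega
  · have := p_of (P := P) (P.σ (P.σ (P.α d))) kσ2 (by rw [e]; exact a2) t2 (by
      rw [e, ← a3, P.X2' _ hd.2]
      exact col_ne (P.hcol d) (fun h => hc h.symm))
    omega

theorem Pc_α (d : D) : P.Pc (P.α d) = P.Pc d := by
  unfold Pc; rw [P.αα]; ring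

theorem T_Pc {d : D} (hd : P.mid d) (h : P.T d) : 1 ≤ P.Pc d := by
  have := T_P hd h
  have := p_nonneg (P := P) (P.σ (P.σ (P.σ d)))
  have := p_nonneg (P := P) (P.σ (P.σ (P.α d)))
  unfold Pc; omega

theorem Pc_nonneg (d : D) : 0 ≤ P.Pc d := by
  have := p_nonneg (P := P) (P.σ (P.σ d))
  have := p_nonneg (P := P) (P.σ (P.σ (P.σ d)))
  have := p_nonneg (P := P) (P.σ (P.σ (P.α d)))
  have := p_nonneg (P := P) (P.σ (P.σ (P.σ (P.α d))))
  unfold Pc; omega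

theorem sh_pair {d : D} (hd : P.mid d) : P.sh d + P.sh (P.α d) ≤ 12 + 2 * P.Pc d := by
  have h0 := Pc_nonneg (P := P) d
  unfold sh
  rw [P.αα, Pc_α]
  by_cases h1 : P.T d
  · have h2 := T_excl hd h1
    have h3 := T_Pc hd h1
    simp only [h1, h2, if_true, if_false]
    split_ifs <;> omega
  · by_cases h2 : P.T (P.α d)
    · have h3 := T_Pc hd.α h2
      rw [Pc_α] at h3
      simp only [h1, h2, if_true, if_false]
      split_ifs <;> omega
    · simp only [h1, h2, if_false]
      by_cases h3 : P.N d
      · have := N_excl h3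
        simp only [h3, this, if_true, if_false]; omega
      · by_cases h4 : P.N (P.α d)
        · simp only [h3, h4, if_true, if_false]; omega
        · simp only [h3, h4, if_false]; omega

/-- crossing with both ends V on an edge -/
theorem c1_p (y : D) (h : P.kd y = 1) (h0 : P.kd (P.α y) = 0) (h2 : P.kd (P.α (P.σ (P.σ y))) = 0) :
    1 ≤ P.p y + P.p (P.σ y) + P.p (P.σ (P.σ y)) + P.p (P.σ (P.σ (P.σ y))) := by
  have n0 := p_nonneg (P := P) y
  have n1 := p_nonneg (P := P) (P.σ y)
  have n2 := p_nonneg (P := P) (P.σ (P.σ y))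
  have n3 := p_nonneg (P := P) (P.σ (P.σ (P.σ y)))
  have k1 : P.kd (P.σ y) = 1 := by rw [P.kdσ, h]
  have k2 : P.kd (P.σ (P.σ y)) = 1 := by rw [P.kdσ, k1]
  have k3 : P.kd (P.σ (P.σ (P.σ y))) = 1 := by rw [P.kdσ, k2]
  have hx2 : P.t (P.α (P.σ (P.σ y))) = P.t y := P.X2' y h
  have hc := P.hcol y
  by_cases hs : P.kd (P.α (P.σ y)) = 0
  · by_cases hh : P.col (P.t (P.α (P.σ y))) = P.col (P.t (P.α y))
    · have := p_of (P := P) y h hs h0 hh; omega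
    · have := p_of (P := P) _ k1 h2 hs (by rw [hx2]; exact (col_ne hc.symm hh).symm); omega
  · have hm := Xhead _ k1 hs
    have h3 := P.two _ hm.1 hm.2
    by_cases hh : P.col (P.t (P.α (P.σ (P.σ (P.σ y))))) = P.col (P.t y)
    · have := p_of (P := P) _ k2 h3 h2 (by rw [hx2]; exact hh); omega
    · have := p_of (P := P) _ k3 (by rw [P.X4 y h]; exact h0) h3 (by
        rw [P.X4 y h]; exact (col_ne hc hh).symm)
      rw [P.X4 y h] at this; omega
end PM
end BCN

namespace BCN
open Equiv Equiv.Perm Finset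
namespace PM
variable {V D : Type} {P : PM V D}

theorem T_next {g : D} (h : P.mid (P.φ g)) (hT : P.T (P.α (P.φ g))) :
    P.t (P.α g) = P.t (P.φ (P.φ g)) := by
  have hs := (T_spec h.α hT).2.2
  rw [P.hσφ _ (by rw [P.αα]; exact h.1), P.αα, P.σφ] at hs
  rw [← hs, ← P.σφ (P.φ g), P.X2' _ (by rw [P.kdφ]; exact h.2)]

theorem sh_ge4 {g : D} (h : P.mid g) (hN : ¬ P.N (P.α g)) : 4 ≤ P.sh g := by
  unfold sh; split_ifs <;> simp_all

theorem NT {g : D} (h : P.N g) : ¬ P.T g := by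
  intro hT; exact N_kd ((N_iff_φ _).2 ((N_iff_φ _).2 h)) hT.1

theorem N_sh4 {g : D} (h : P.N g) : 4 ≤ P.g2 g := by
  unfold g2; rw [if_neg (N_kd h), if_pos (N_mid h)]; exact sh_ge4 (N_mid h) (N_excl h)

theorem N_sh12 {g : D} (h : P.N g) (hT : ¬ P.T (P.α g)) : P.g2 g = 12 := by
  unfold g2; rw [if_neg (N_kd h), if_pos (N_mid h)]; unfold sh; simp [NT h, hT, h]

/-- same edge mids coincide -/
theorem mid_unique {g g' : D} (h : P.mid g) (h' : P.mid g') (e : P.t g = P.t g')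
    (e' : P.t (P.α g) = P.t (P.α g')) : g = g' := by
  have := P.simple (P.α (P.σ (P.σ g))) (P.α (P.σ (P.σ g'))) (P.two _ h.1 h.2) (P.two _ h'.1 h'.2)
    (by rw [P.X2' _ h.1, P.X2' _ h'.1, e]) (by rw [P.αα, P.αα, P.X2 _ h.1, P.X2 _ h'.1, e'])
  exact P.σ.injective (P.σ.injective (P.α.injective this))

theorem N_noα {g : D} (h : P.N g) : ¬ P.φ.SameCycle g (P.α (P.φ g)) := fun hs =>
  notN2 (N_mid h) (N_same h hs)

theorem scit (d : D) (i : ℕ) : P.φ.SameCycle d (P.φ^[i] d) := ⟨i, by simp [Equiv.Perm.iterate_eq_pow]⟩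

theorem N_face [Finite D] [DecidableEq D] {d : D} (h : P.N d) :
    ∃ s : Finset D, (∀ x ∈ s, P.φ.SameCycle d x) ∧ 28 ≤ ∑ x ∈ s, P.g2 x := by
  set k := Function.minimalPeriod P.φ d with hk
  have hper : P.φ^[k] d = d := Function.iterate_minimalPeriod
  have hpos : 0 < k := Function.minimalPeriod_pos_of_mem_periodicPts (P.φ.injective.mem_periodicPts d)
  have hinj : Set.InjOn (fun i => P.φ^[i] d) (Finset.range k) := by
    intro i hi j hj hij
    exact Function.iterate_injOn_Iio_minimalPeriod (by simpa using hi) (by simpa using hj) hij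
  have hN : ∀ i, P.N (P.φ^[i] d) := fun i => N_same h (scit d i)
  refine ⟨(Finset.range k).image (fun i => P.φ^[i] d), ?_, ?_⟩
  · simp only [Finset.mem_image, Finset.mem_range]
    rintro x ⟨i, -, rfl⟩; exact scit d i
  rw [Finset.sum_image hinj]
  have h4 : ∀ i, 4 ≤ P.g2 (P.φ^[i] d) := fun i => N_sh4 (hN i)
  by_cases h7 : 7 ≤ k
  · calc (28:ℤ) ≤ ∑ i ∈ Finset.range k, 4 := by simp; omega
      _ ≤ _ := Finset.sum_le_sum (fun i _ => h4 i)
  have hn := fun i => NT (hN i)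
  have h12 := fun i => N_sh12 (hN i)
  have hm0 := fun i => N_mid (hN i)
  have hα := fun i => N_noα (hN i)
  set g : ℕ → D := fun i => P.φ^[i] d with hg
  have hm : ∀ i, P.mid (g i) := hm0
  have gs : ∀ i, P.φ (g i) = g (i+1) := fun i => (Function.iterate_succ_apply' _ _ _).symm
  have hT : ∀ i, P.T (P.α (g (i+1))) → P.t (P.α (g i)) = P.t (g (i+2)) := by
    intro i hi; rw [← gs] at hi
    have := T_next (by rw [gs]; exact hm (i+1)) hi
    rw [this, gs, gs]
  have hcol : ∀ i, P.T (P.α (g (i+1))) → P.col (P.t (g (i+2))) = !P.col (P.t (g i)) := by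
    intro i hi; rw [← hT i hi]; have := P.hcol (g i)
    revert this; generalize P.col (P.t (g i)) = a; generalize P.col (P.t (P.α (g i))) = b
    revert a b; decide
  have hnadj : ∀ i, P.t (P.α (g (i+1))) ≠ P.t (g i) := by
    intro i
    have := (P.nadj _ (hm (i+1)).1).2.2.2
    rw [← gs, P.σφ, P.αα] at this
    rwa [gs] at this
  have hone : ∀ i, g (i+2) ≠ g i := by
    intro i hi
    have e1 : P.σ (g (i+1)) = P.α (g i) := by rw [← gs, P.σφ]
    have e2 : P.σ (g i) = P.α (g (i+1)) := by rw [← hi, ← gs (i+1), P.σφ]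
    have := (P.one _ (hm i).1 (hm i).2).1
    apply this
    rw [e2, P.αα, ← e1, P.X2 _ (hm (i+1)).1, P.X2' _ (hm (i+1)).1]; exact ⟨rfl, rfl⟩
  have hopp : ∀ i, g (i+4) = g i → ¬ (P.T (P.α (g (i+1))) ∧ P.T (P.α (g (i+3)))) := by
    rintro i hi ⟨a, b⟩
    have a' := hT i a
    have b' := hT (i+2) b
    rw [show i + 2 + 2 = i + 4 from rfl, hi] at b'
    have : g (i+2) = P.α (g i) := by
      apply mid_unique (hm (i+2)) (hm i).α a'.symm
      rw [P.αα]; exact b'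
    have hs := hα (i+3)
    change ¬ P.φ.SameCycle (g (i+3)) (P.α (P.φ (g (i+3)))) at hs
    rw [gs, hi, ← this] at hs
    apply hs
    have := P.scφ (g (i+2))
    rw [gs] at this; exact this.symm
  have hgk : g k = g 0 := hper
  have hgk' : ∀ i, g (k + i) = g i := by
    intro i; induction i with
    | zero => exact hgk
    | succ i ih => rw [← add_assoc, ← gs, ih, gs]
  change 28 ≤ ∑ i ∈ Finset.range k, P.g2 (g i)
  clear_value k
  have h4' : ∀ i, 4 ≤ P.g2 (g i) := h4
  have h12' : ∀ i, ¬ P.T (P.α (g i)) → P.g2 (g i) = 12 := h12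
  clear_value g
  clear h4 h12 hn hα hinj hN hper
  interval_cases k
  · exfalso
    have := hgk' 1
    exact hone 0 (by rw [show (0 : ℕ) + 2 = 1 + 1 from rfl, hgk' 1, show (1:ℕ) = 1 + 0 from rfl, hgk' 0])
  · exact absurd (hgk' 0) (hone 0)
  · have e : ∀ i, P.g2 (g (i + 1)) = 12 := by
      intro i
      apply h12'
      intro hi
      have h1 := hT i hi
      apply hnadj (i+2)
      rw [show i + 2 + 1 = 3 + i by ring, hgk' i, h1]
    have e0 := e 2
    rw [show 2 + 1 = 3 + 0 from rfl, hgk' 0] at e0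
    have e1 := e 0
    have e2 := e 1
    norm_num at e1 e2
    simp only [Finset.sum_range_succ, Finset.sum_range_zero]
    omega
  · have o1 := hopp 0 (hgk' 0)
    have o2 := hopp 1 (hgk' 1)
    norm_num at o1 o2
    rw [show g 4 = g 0 from hgk' 0] at o2
    simp only [Finset.sum_range_succ, Finset.sum_range_zero]
    have a0 := h4' 0; have a1 := h4' 1; have a2 := h4' 2; have a3 := h4' 3
    have b0 := h12' 0; have b1 := h12' 1; have b2 := h12' 2; have b3 := h12' 3
    by_cases c1 : P.T (P.α (g 1)) <;> by_cases c2 : P.T (P.α (g 2))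
    · have := b3 (o1 c1); have := b0 (o2 c2); omega
    · have := b3 (o1 c1); have := b2 c2; omega
    · have := b1 c1; have := b0 (o2 c2); omega
    · have := b1 c1; have := b2 c2; omega
  · have c0 := hcol 0; have c1 := hcol 1; have c2 := hcol 2; have c3 := hcol 3; have c4 := hcol 4
    norm_num at c0 c1 c2 c3 c4
    rw [show g 5 = g 0 from hgk' 0] at *
    rw [show g 6 = g 1 from hgk' 1] at *
    simp only [Finset.sum_range_succ, Finset.sum_range_zero]
    have a0 := h4' 0; have a1 := h4' 1; have a2 := h4' 2; have a3 := h4' 3; have a4 := h4' 4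
    by_cases t0 : P.T (P.α (g 0)); swap
    · have := h12' 0 t0; omega
    by_cases t1 : P.T (P.α (g 1)); swap
    · have := h12' 1 t1; omega
    by_cases t2 : P.T (P.α (g 2)); swap
    · have := h12' 2 t2; omega
    by_cases t3 : P.T (P.α (g 3)); swap
    · have := h12' 3 t3; omega
    by_cases t4 : P.T (P.α (g 4)); swap
    · have := h12' 4 t4; omega
    exfalso
    have q0 := c0 t1; have q1 := c1 t2; have q2 := c2 t3; have q3 := c3 t4; have q4 := c4 t0
    rw [q2, q0, q3, q1] at q4
    cases h : P.col (P.t (g 1)) <;> simp [h] at q4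
  · have c0 := hcol 0; have c2 := hcol 2; have c4 := hcol 4
    norm_num at c0 c2 c4
    rw [show g 6 = g 0 from hgk' 0] at *
    simp only [Finset.sum_range_succ, Finset.sum_range_zero]
    have a0 := h4' 0; have a1 := h4' 1; have a2 := h4' 2; have a3 := h4' 3; have a4 := h4' 4
    have a5 := h4' 5
    by_cases t1 : P.T (P.α (g 1)); swap
    · have := h12' 1 t1; omega
    by_cases t3 : P.T (P.α (g 3)); swap
    · have := h12' 3 t3; omega
    by_cases t5 : P.T (P.α (g 5)); swap
    · have := h12' 5 t5; omega
    exfalso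
    have q0 := c0 t1; have q2 := c2 t3; have q4 := c4 t5
    rw [q2, q0] at q4
    cases h : P.col (P.t (g 0)) <;> simp [h] at q4
end PM
end BCN

namespace BCN
open Equiv Equiv.Perm Finset
namespace PM
variable {V D : Type} {P : PM V D}

theorem φ_ne {d : D} (h : P.kd (P.α d) = 0) : P.φ d ≠ d := by
  intro e; have := P.hcol d; rw [← P.tφ d h, e] at this; exact this rfl

theorem phi_phi_ne {d : D} (h : P.kd (P.α d) = 0) (h' : P.kd (P.α (P.φ d)) = 0) : P.φ (P.φ d) ≠ d := by
  intro e
  have : P.α d = P.φ d := by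
    apply P.simple _ _ h (by rw [P.kdφ, h]) (P.tφ d h).symm
    rw [P.αα, ← P.tφ (P.φ d) h', e]
  have e3 := P.σφ d
  rw [← this] at e3
  exact P.deg2 _ h e3

theorem nadjφ {d : D} (h : P.kd (P.α d) = 1) : P.t (P.α (P.φ d)) ≠ P.t d := by
  have := (P.nadj (P.φ d) (by rw [P.kdφ, h])).2.2.2
  rwa [P.σφ, P.αα] at this

theorem p_of_not {y : D} (h : ¬ P.pp y) : P.p y = 0 := by unfold p; rw [if_neg h]

theorem two_aux {x y : D} (hx : P.kd x = 0) (hy : P.kd y = 0)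
    (hall : ∀ z, P.φ.SameCycle x z → P.kd z = 0 → z = x ∨ z = y) (hu : P.kd (P.α x) = 0) :
    18 ≤ P.av y := by
  have e1 : P.φ x = y := (hall _ (P.scφ x) (by rw [P.kdφ, hu])).resolve_left (φ_ne hu)
  have hc : P.kd (P.α y) ≠ 0 := by
    intro hc
    rw [← e1] at hc
    have s2 := (P.scφ x).trans (P.scφ (P.φ x))
    rcases hall _ s2 (by rw [P.kdφ, hc]) with h | h
    · exact phi_phi_ne hu hc h
    · rw [← e1] at h; exact φ_ne hc h
  unfold av
  rw [if_neg hc, p_of_not]; · norm_num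
  rintro ⟨h1, h2, h3, h4⟩
  rw [P.αα] at h4
  rw [← φsymm] at h3 h4
  have s2 : P.φ.SameCycle x (P.φ (P.φ y)) := by
    have := (P.scφ x); rw [e1] at this
    exact (this.trans (P.scφ _)).trans (P.scφ _)
  rcases hall _ s2 (by rw [P.kdφ, h3]) with h | h
  · have c := P.hcol x
    rw [← P.tφ x hu, e1, h4, ← P.tφ _ h3, h] at c; exact c rfl
  · rw [← P.tφ _ h3] at h4
    exact nadjφ h1 (by rw [← P.tφ _ h3, h])

theorem one_face [DecidableEq D] {d0 : D} (h0 : P.kd d0 = 0)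
    (hall : ∀ z, P.φ.SameCycle d0 z → P.kd z = 0 → z = d0) :
    ∃ s : Finset D, (∀ x ∈ s, P.φ.SameCycle d0 x) ∧ 28 ≤ ∑ x ∈ s, P.g2 x := by
  have s1 := P.scφ d0
  have s2 := s1.trans (P.scφ _)
  have s3 := s2.trans (P.scφ _)
  have s4 := s3.trans (P.scφ _)
  have hc : P.kd (P.α d0) ≠ 0 := fun hc => φ_ne hc (hall _ s1 (by rw [P.kdφ, hc]))
  have hc1 : P.kd (P.α d0) = 1 := by
    have := P.kd_le (P.α d0)
    by_contra hcc
    have h2 : P.kd (P.φ d0) = 2 := by rw [P.kdφ]; omega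
    have h3 := P.Yh _ h2
    have h4 := P.Yn _ h2
    rw [P.σφ, P.αα, ← P.tφ _ h3] at h4
    exact h4 (by rw [hall _ s2 (by rw [P.kdφ, h3])])
  have k1 : P.kd (P.φ d0) = 1 := by rw [P.kdφ, hc1]
  have m1 : P.mid (P.φ d0) := by
    apply Xhead _ k1
    intro h
    exact nadjφ hc1 (by rw [← P.tφ _ h, hall _ s2 (by rw [P.kdφ, h])])
  have ga : P.g2 d0 = 18 := by
    unfold g2 av; rw [if_pos h0, if_neg hc, p_of_not]; · norm_num
    rintro ⟨_, _, h3, _⟩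
    rw [← φsymm] at h3; have := m1.2; omega
  have gm : ∀ x, P.mid x → P.g2 x = P.sh x := by
    intro x hx; unfold g2; rw [if_neg (by have := hx.1; omega), if_pos hx]
  have nN : ∀ x, P.φ.SameCycle d0 x → ¬ P.N x := fun x hx h => h d0 hx.symm h0
  set d1 := P.φ d0 with e1
  have n01 : d0 ≠ d1 := by intro h; rw [← h] at k1; omega
  have k2 : P.kd (P.φ d1) = 1 := by rw [P.kdφ]; exact m1.2
  set d2 := P.φ d1 with e2
  have n02 : d0 ≠ d2 := by intro h; rw [← h] at k2; omega
  have n12 : d1 ≠ d2 := fun h => n01 (P.φ.injective h)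
  by_cases hv2 : P.kd (P.α d2) = 0
  · refine ⟨{d0, d1}, by simp [s1, SameCycle.refl], ?_⟩
    rw [Finset.sum_pair n01, ga, gm _ m1]
    have : P.T d1 := by
      have : P.φ (P.φ d1) = d0 := hall _ s3 (by rw [P.kdφ, hv2])
      refine ⟨by rw [this]; exact h0, by rw [this]⟩
    unfold sh; rw [if_pos this]; norm_num
  have m2 := Xhead _ k2 hv2
  have f1 : 4 ≤ P.sh d1 := sh_ge4 m1 (notN1 m2)
  have f2 : 4 ≤ P.sh d2 := sh_ge4 m2 (notN2 m1)
  have k3 : P.kd (P.φ d2) = 1 := by rw [P.kdφ]; exact m2.2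
  set d3 := P.φ d2 with e3
  have n03 : d0 ≠ d3 := by intro h; rw [← h] at k3; omega
  have n13 : d1 ≠ d3 := fun h => n02 (P.φ.injective h)
  have n23 : d2 ≠ d3 := fun h => n12 (P.φ.injective h)
  by_cases hv3 : P.kd (P.α d3) = 0; swap
  · have m3 := Xhead _ k3 hv3
    have f3 : 4 ≤ P.sh d3 := sh_ge4 m3 (notN2 m2)
    refine ⟨{d0, d1, d2, d3}, by simp [s1, s2, s3, SameCycle.refl], ?_⟩
    rw [Finset.sum_insert (by simp [n01, n02, n03]), Finset.sum_insert (by simp [n12, n13]),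
      Finset.sum_pair n23, ga, gm _ m1, gm _ m2, gm _ m3]
    omega
  refine ⟨{d0, d1, d2}, by simp [s1, s2, SameCycle.refl], ?_⟩
  rw [Finset.sum_insert (by simp [n01, n02]), Finset.sum_pair n12, ga, gm _ m1, gm _ m2]
  have T1 : ¬ P.T d1 := by
    rintro ⟨h, -⟩; change P.kd d3 = 0 at h; omega
  have e4 : P.φ d3 = d0 := hall _ s4 (by rw [P.kdφ, hv3])
  have T2 : ¬ P.T d2 := by
    rintro ⟨-, h⟩
    change P.φ (P.φ d3) = d2 at h
    rw [e4, ← e1] at h; exact n12 h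
  by_cases a1 : P.T (P.α d1); swap
  · have : 6 ≤ P.sh d1 := by
      unfold sh; rw [if_neg T1, if_neg a1, if_neg (nN _ s1), if_neg (notN1 m2)]
    omega
  by_cases a2 : P.T (P.α d2); swap
  · have : 6 ≤ P.sh d2 := by
      unfold sh; rw [if_neg T2, if_neg a2, if_neg (nN _ s2), if_neg (notN2 m1)]
    omega
  have q1 := T_P m1.α a1
  rw [P.αα] at q1
  have q2 := T_next (g := d1) m2 a2
  have q3 : P.t (P.α d3) = P.t d0 := by rw [← P.tφ _ hv3, e4]
  have q4 : P.p (P.σ (P.σ d1)) = 1 := by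
    have es : P.σ d1 = P.α d0 := P.σφ d0
    apply p_of _ (by rw [P.kdσ]; exact k1) (P.two _ m1.1 m1.2) (by rw [es, P.αα]; exact h0)
    rw [P.X2' _ k1, es, P.αα, ← q3]
    change P.t (P.α d1) = P.t d3 at q2
    have c1 := P.hcol d1
    have c2 := P.hcol d3
    rw [q2] at c1
    exact col_ne c2 c1
  have := p_nonneg (P := P) (P.σ (P.σ (P.σ (P.α d1))))
  have : 2 ≤ P.Pc d1 := by unfold Pc; omega
  have : P.sh d1 = 6 := by
    unfold sh; rw [if_neg T1, if_pos a1, if_pos this]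
  omega

theorem face2 [Finite D] [DecidableEq D] (d : D) :
    ∃ s : Finset D, (∀ x ∈ s, P.φ.SameCycle d x) ∧ 28 ≤ ∑ x ∈ s, P.g2 x := by
  by_cases hN : P.N d
  · exact N_face hN
  unfold N at hN
  push Not at hN
  obtain ⟨x, sx, kx⟩ := hN
  have gv : ∀ z, P.kd z = 0 → P.g2 z = P.av z := fun z hz => by unfold g2; rw [if_pos hz]
  by_cases h1 : ∃ y, P.φ.SameCycle d y ∧ P.kd y = 0 ∧ y ≠ x
  · obtain ⟨y, sy, ky, nyx⟩ := h1
    by_cases h2 : ∃ z, P.φ.SameCycle d z ∧ P.kd z = 0 ∧ z ≠ x ∧ z ≠ y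
    · obtain ⟨z, sz, kz, nzx, nzy⟩ := h2
      refine ⟨{x, y, z}, by simp [sx, sy, sz], ?_⟩
      rw [Finset.sum_insert (by simp [nyx.symm, nzx.symm]), Finset.sum_pair nzy.symm,
        gv _ kx, gv _ ky, gv _ kz]
      have := av_ge (P := P) x; have := av_ge (P := P) y; have := av_ge (P := P) z
      omega
    · push Not at h2
      refine ⟨{x, y}, by simp [sx, sy], ?_⟩
      rw [Finset.sum_pair nyx.symm, gv _ kx, gv _ ky]
      have hx := av_ge (P := P) x; have hy := av_ge (P := P) y
      by_cases ux : P.kd (P.α x) = 0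
      · have := two_aux kx ky (fun z hz k => by
          by_cases h : z = x
          · exact Or.inl h
          · exact Or.inr (h2 z (sx.trans hz) k h)) ux
        omega
      · by_cases uy : P.kd (P.α y) = 0
        · have := two_aux ky kx (fun z hz k => by
            by_cases h : z = x
            · exact Or.inr h
            · exact Or.inl (h2 z (sy.trans hz) k h)) uy
          omega
        · unfold av; rw [if_neg ux, if_neg uy]
          have := p_le (P := P) (P.α x); have := p_le (P := P) (P.α y)
          omega
  · push Not at h1
    obtain ⟨s, hs, hsum⟩ := one_face kx (fun z hz k => h1 z (sx.trans hz) k)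
    exact ⟨s, fun z hz => sx.trans (hs z hz), hsum⟩

theorem bound2 [Fintype D] [DecidableEq D] (hE : P.Euler) :
    4 * ((univ.filter fun d => P.kd d = 0).card : ℤ) ≤ 28 * (P.W.card : ℤ) - 56 := by
  classical
  have key := orbit_sum P.φ P.g2 28 face2 g2_nonneg
  set M : ℤ := ((univ.filter fun d => P.kd d = 0).card : ℤ) with hM
  set X : ℤ := ((univ.filter fun d => P.kd d = 1).card : ℤ) with hX
  set Y : ℤ := ((univ.filter fun d => P.kd d = 2).card : ℤ) with hY
  set H : D → ℤ := fun y => if P.kd y = 1 then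
    (if P.kd (P.α y) = 0 then 1 - 2 * P.p y - 2 * P.p (P.σ y) else P.sh y - 7) else 0 with hH
  have pz : ∀ y, ¬ (P.kd y = 1 ∧ P.kd (P.α y) = 0) → P.p y = 0 ∧ P.p (P.σ y) = 0 := by
    intro y hy
    constructor
    · apply p_of_not; intro h; exact hy ⟨h.1, h.2.1⟩
    · apply p_of_not; intro h; apply hy
      have h1 := h.1; have h2 := h.2.2.1
      rw [P.kdσ] at h1; rw [Equiv.symm_apply_apply] at h2; exact ⟨h1, h2⟩
  have hD : (Fintype.card D : ℤ) = M + X + Y := by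
    have e : (Fintype.card D : ℤ) = ∑ d : D, 1 := by simp
    rw [e, hM, hX, hY]
    simp only [Finset.card_filter]
    push_cast
    rw [← Finset.sum_add_distrib, ← Finset.sum_add_distrib]
    apply Finset.sum_congr rfl
    intro d _
    have := P.kd_le d
    interval_cases P.kd d <;> simp
  have hsum : ∑ d, P.g2 d = 10 * M + 7 * X + 8 * Y + ∑ d, H d := by
    set k : D → ℤ := fun y => if P.kd (P.α y) = 0 ∧ P.kd y ≠ 0 then 8 - 4 * P.p y else 0 with hk
    have e1 : ∑ d, P.g2 d = ∑ d, ((if P.kd d = 0 then 10 else 0) + k (P.α d) +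
        (if P.mid d then P.sh d else 0)) := by
      apply Finset.sum_congr rfl
      intro d _
      simp only [hk, P.αα]
      unfold g2 av
      by_cases h0 : P.kd d = 0
      · have : ¬ P.mid d := fun h => by have := h.1; omega
        by_cases h1 : P.kd (P.α d) = 0 <;> simp [h0, h1, this]; ring
      · simp [h0]
    rw [e1, Finset.sum_add_distrib, Finset.sum_add_distrib, Equiv.sum_comp P.α k, hM, hX, hY]
    simp only [Finset.card_filter]
    push_cast
    have e2 : ∑ d, H d = ∑ d, (H d + 2 * P.p (P.σ d) - 2 * P.p d) := by
      rw [Finset.sum_sub_distrib, Finset.sum_add_distrib, ← Finset.mul_sum, ← Finset.mul_sum,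
        Equiv.sum_comp P.σ P.p]; ring
    rw [e2, Finset.mul_sum, Finset.mul_sum, Finset.mul_sum, ← Finset.sum_add_distrib,
      ← Finset.sum_add_distrib, ← Finset.sum_add_distrib, ← Finset.sum_add_distrib,
      ← Finset.sum_add_distrib]
    apply Finset.sum_congr rfl
    intro d _
    simp only [hk, hH]
    have := P.kd_le d
    obtain h | h | h : P.kd d = 0 ∨ P.kd d = 1 ∨ P.kd d = 2 := by omega
    · have z := pz d (by omega)
      have : ¬ P.mid d := fun h => by have := h.1; omega
      simp [h, z, this]
    · by_cases h1 : P.kd (P.α d) = 0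
      · have : ¬ P.mid d := fun h => by have := h.2; omega
        simp [h, h1, this]; ring
      · have z := pz d (by tauto)
        simp [h, h1, Xhead d h h1, z]
    · have z := pz d (by omega)
      have : ¬ P.mid d := fun h => by have := h.1; omega
      simp [h, z, this, P.Yh d h]
  have hHle : ∑ d, H d ≤ 0 := by
    set K : D → ℤ := fun y => H y + H (P.σ (P.σ y)) with hK
    set Q : D → ℤ := fun y => if P.mid y then K y else 0 with hQ
    have kσσ : ∀ y, P.kd (P.σ (P.σ y)) = P.kd y := fun y => by rw [P.kdσ, P.kdσ]
    have a1 : ∑ d, K d = 2 * ∑ d, H d := by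
      rw [Finset.sum_add_distrib, Equiv.sum_comp P.σ (fun y => H (P.σ y)), Equiv.sum_comp P.σ H]
      ring
    have a2 : ∑ d, K d ≤ ∑ d, (Q d + Q (P.σ (P.σ d))) := by
      apply Finset.sum_le_sum
      intro y _
      by_cases h1 : P.kd y = 1
      · have KK : K (P.σ (P.σ y)) = K y := by
          simp only [hK]; rw [P.X4 y h1]; ring
        by_cases m : P.mid y
        · have := P.two _ m.1 m.2
          have n : ¬ P.mid (P.σ (P.σ y)) := fun h => by have := h.2; omega
          simp [hQ, m, n]
        · by_cases n : P.mid (P.σ (P.σ y))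
          · simp [hQ, m, n, KK]
          · simp only [hQ, m, n, if_false]
            have b0 : P.kd (P.α y) = 0 := by by_contra h; exact m (Xhead y h1 h)
            have b2 : P.kd (P.α (P.σ (P.σ y))) = 0 := by
              by_contra h; exact n (Xhead _ (by rw [kσσ, h1]) h)
            have := c1_p y h1 b0 b2
            simp only [hK, hH, h1, b0, b2, kσσ, if_true]
            omega
      · have n1 : ¬ P.mid y := fun h => h1 h.1
        have n2 : ¬ P.mid (P.σ (P.σ y)) := fun h => by have := h.1; rw [kσσ] at this; exact h1 this
        simp [hQ, hK, hH, n1, n2, kσσ, h1]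
    have a3 : ∑ d, (Q d + Q (P.σ (P.σ d))) = 2 * ∑ d, Q d := by
      rw [Finset.sum_add_distrib, Equiv.sum_comp P.σ (fun y => Q (P.σ y)), Equiv.sum_comp P.σ Q]
      ring
    have a4 : ∑ d, (Q d + Q (P.α d)) = 2 * ∑ d, Q d := by
      rw [Finset.sum_add_distrib, Equiv.sum_comp P.α Q]; ring
    have a5 : ∑ d, (Q d + Q (P.α d)) ≤ ∑ d : D, 0 := by
      apply Finset.sum_le_sum
      intro d _
      by_cases m : P.mid d
      · have b := P.two _ m.1 m.2
        have b' := P.two _ m.2 m.α.2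
        have s := sh_pair m
        simp only [hQ, m, m.α, if_true, hK, hH, kσσ, m.1, m.2, b, b', P.αα]
        norm_num
        unfold Pc at s
        omega
      · have : ¬ P.mid (P.α d) := fun h => by have := h.α; rw [P.αα] at this; exact m this
        simp [hQ, m, this]
    simp at a5
    linarith
  unfold Euler at hE
  rw [hD] at hE
  have : 0 ≤ Y := by rw [hY]; positivity
  rw [hsum] at key
  change _ ≤ _ + 12 * (P.W.card : ℤ) + 3 * X + 2 * Y at hE
  linarith
end PM
end BCN

namespace BCN
open Equiv Equiv.Perm Finset

/-- homological planarity certificate for a rotation system -/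
def Cert {D Λ : Type} [Fintype D] [DecidableEq Λ] (α φ : Perm D) (lab : D → Λ) : Prop :=
  ∀ C : D → ZMod 2, (∀ d, C (α d) = C d) → (∀ l, ∑ d ∈ univ.filter (fun d => lab d = l), C d = 0) →
    ∃ w : D → ZMod 2, (∀ d, w (φ d) = w d) ∧ ∀ d, w d + w (α d) = C d

theorem z2_two : (1 : ZMod 2) + 1 = 0 := by decide
theorem z2_add_self (x : ZMod 2) : x + x = 0 := by revert x; decide

theorem euler_of_cert {D Λ : Type} [Fintype D] [DecidableEq D] [Nonempty D] [Fintype Λ]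
    [DecidableEq Λ] (α φ : Perm D) (lab : D → Λ) (dir : D → Bool) (hα : ∀ d, α (α d) = d)
    (hdir : ∀ d, dir (α d) = !dir d) (hc : Cert α φ lab) :
    Fintype.card D + 4 ≤ 2 * Nat.card (Quotient (SameCycle.setoid φ)) + 2 * Fintype.card Λ := by
  classical
  let d0 : D := Classical.arbitrary D
  let Seg := {d : D // dir d = true}
  let F := Quotient (SameCycle.setoid φ)
  have : Fintype F := Fintype.ofFinite _
  have : Fact (Nat.Prime 2) := ⟨Nat.prime_two⟩
  have hone := z2_two
  -- number of segments
  have hS : Fintype.card D = 2 * Fintype.card Seg := by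
    have e : {d : D // dir d = false} ≃ Seg :=
      { toFun := fun d => ⟨α d.1, by rw [hdir, d.2]; rfl⟩
        invFun := fun d => ⟨α d.1, by rw [hdir, d.2]; rfl⟩
        left_inv := fun d => by ext; exact hα _
        right_inv := fun d => by ext; exact hα _ }
    have h1 := Fintype.card_congr e
    have h2 := Fintype.card_subtype_compl (fun d : D => dir d = true)
    have h3 := Fintype.card_subtype_le (fun d : D => dir d = true)
    have h4 : Fintype.card {d : D // ¬ dir d = true} = Fintype.card {d : D // dir d = false} :=
      Fintype.card_congr (Equiv.subtypeEquivRight (fun d => by simp))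
    change _ = 2 * Fintype.card {d : D // dir d = true}
    change _ = Fintype.card {d : D // dir d = true} at h1
    omega
  let seg : D → Seg := fun d => if h : dir d = true then ⟨d, h⟩ else ⟨α d, by rw [hdir]; simpa using h⟩
  have segα : ∀ d, seg (α d) = seg d := by
    intro d
    by_cases h : dir d = true
    · simp [seg, hdir, h, hα]
    · simp [seg, hdir, h]
  have segS : ∀ s : Seg, seg s.1 = s := by
    intro s; simp [seg, s.2]
  let f : (F → ZMod 2) →ₗ[ZMod 2] (D → ZMod 2) :=
    { toFun := fun w d => w (Quotient.mk _ d) + w (Quotient.mk _ (α d))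
      map_add' := fun x y => by ext d; simp; ring
      map_smul' := fun c x => by ext d; simp; ring }
  let E : (Seg → ZMod 2) →ₗ[ZMod 2] (D → ZMod 2) := LinearMap.funLeft _ _ seg
  have hE : Function.Injective E := LinearMap.funLeft_injective_of_surjective _ _ _
    (fun s => ⟨s.1, segS s⟩)
  let del : (Seg → ZMod 2) →ₗ[ZMod 2] (Λ → ZMod 2) :=
    { toFun := fun c l => ∑ d ∈ univ.filter (fun d => lab d = l), c (seg d)
      map_add' := fun x y => by ext d; simp [Finset.sum_add_distrib]
      map_smul' := fun c x => by ext d; simp [Finset.mul_sum] }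
  let sm : (Λ → ZMod 2) →ₗ[ZMod 2] ZMod 2 :=
    { toFun := fun c => ∑ l, c l
      map_add' := fun x y => by simp [Finset.sum_add_distrib]
      map_smul' := fun c x => by simp [Finset.mul_sum] }
  have r1 := LinearMap.finrank_range_add_finrank_ker f
  have r2 := LinearMap.finrank_range_add_finrank_ker del
  have r3 := LinearMap.finrank_range_add_finrank_ker sm
  have hker : 1 ≤ Module.finrank (ZMod 2) (LinearMap.ker f) := by
    rw [Nat.one_le_iff_ne_zero, ← Nat.pos_iff_ne_zero, Module.finrank_pos_iff_exists_ne_zero]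
    refine ⟨⟨fun _ => 1, ?_⟩, ?_⟩
    · rw [LinearMap.mem_ker]; ext d; simp [f, hone]
    · intro h
      have := congrFun (congrArg Subtype.val h) (Quotient.mk _ d0)
      simp at this
  have hsurj : LinearMap.range sm = ⊤ := by
    rw [LinearMap.range_eq_top]
    intro c
    exact ⟨Pi.single (lab d0) c, by simp [sm]⟩
  have hdel : LinearMap.range del ≤ LinearMap.ker sm := by
    rintro _ ⟨c, rfl⟩
    rw [LinearMap.mem_ker]
    change ∑ l, ∑ d ∈ univ.filter (fun d => lab d = l), c (seg d) = 0
    rw [Finset.sum_fiberwise]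
    apply Finset.sum_involution (fun d _ => α d)
    · intro d _; rw [segα]
      exact z2_add_self _
    · intro d _ _ h
      have := hdir d; rw [h] at this; simp at this
    · intro d _; exact Finset.mem_univ _
    · intro d _; exact hα d
  have hcert : (LinearMap.ker del).map E ≤ LinearMap.range f := by
    rintro _ ⟨c, hc0, rfl⟩
    obtain ⟨w, hw1, hw2⟩ := hc (fun d => c (seg d)) (fun d => by simp [segα]) (fun l => by
      have := LinearMap.mem_ker.1 hc0
      exact congrFun this l)
    have hwc : ∀ a b, φ.SameCycle a b → w a = w b := by
      intro a b hab
      obtain ⟨i, rfl⟩ := hab.exists_nat_pow_eq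
      induction i with
      | zero => simp
      | succ i ih => rw [pow_succ', Equiv.Perm.mul_apply, hw1]; exact ih ⟨i, by simp⟩
    refine ⟨fun q => Quotient.lift w hwc q, ?_⟩
    ext d
    exact hw2 d
  have i1 := Submodule.finrank_mono hcert
  have i2 := Submodule.finrank_mono hdel
  rw [(Submodule.equivMapOfInjective E hE _).symm.finrank_eq] at i1
  · rw [hsurj, finrank_top] at r3
    simp only [Module.finrank_fintype_fun_eq_card, Module.finrank_self] at r1 r2 r3
    rw [Nat.card_eq_fintype_card]
    change _ ≤ 2 * Fintype.card F + _
    omega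
end BCN

namespace BCN
open Equiv Equiv.Perm Finset

theorem cyc_next {D Λ : Type} [Finite D] (lab : D → Λ) (key : D → ℕ) (L : ℕ) (hL : ∀ d, key d < L)
    (hinj : ∀ d d', lab d = lab d' → key d = key d' → d = d') :
    ∃ σ : Perm D, (∀ d, lab (σ d) = lab d) ∧ (∀ d d', lab d = lab d' → σ.SameCycle d d') ∧
      ∀ d, ∃ n, key (σ d) = (key d + 1 + n) % L ∧
        ∀ i < n, ∀ d', lab d' = lab d → key d' ≠ (key d + 1 + i) % L := by
  classical
  have hex : ∀ d, ∃ n, ∃ d', lab d' = lab d ∧ key d' = (key d + 1 + n) % L := by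
    intro d
    refine ⟨L - 1, d, rfl, ?_⟩
    have := hL d
    rw [show key d + 1 + (L - 1) = key d + L by omega, Nat.add_mod_right, Nat.mod_eq_of_lt this]
  let nx : D → ℕ := fun d => Nat.find (hex d)
  have hnx : ∀ d, ∃ d', lab d' = lab d ∧ key d' = (key d + 1 + nx d) % L := fun d => Nat.find_spec (hex d)
  choose f hf1 hf2 using hnx
  have hmin : ∀ d, ∀ i < nx d, ∀ d', lab d' = lab d → key d' ≠ (key d + 1 + i) % L := by
    intro d i hi d' h1 h2
    exact Nat.find_min (hex d) hi ⟨d', h1, h2⟩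
  have hlt : ∀ d d', f d = f d' → nx d < nx d' → False := by
    intro d d' h hn
    have e1 := hf2 d
    have e2 := hf2 d'
    rw [h, e2] at e1
    apply hmin d' (nx d' - nx d - 1) (by omega) d (by rw [← hf1 d, h, hf1 d'])
    have e3 : (key d + (1 + nx d)) ≡ (key d' + 1 + (nx d' - nx d - 1)) + (1 + nx d) [MOD L] := by
      unfold Nat.ModEq
      rw [← add_assoc, ← e1]; congr 1; omega
    have e4 := Nat.ModEq.add_right_cancel' _ e3
    unfold Nat.ModEq at e4
    rw [← e4, Nat.mod_eq_of_lt (hL d)]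
  have hfi : Function.Injective f := by
    intro d d' h
    rcases lt_trichotomy (nx d) (nx d') with hn | hn | hn
    · exact (hlt d d' h hn).elim
    · have e1 := hf2 d
      have e2 := hf2 d'
      rw [h, e2] at e1
      apply hinj d d' (by rw [← hf1 d, h, hf1 d'])
      rw [hn] at e1
      have e3 : key d + (1 + nx d') ≡ key d' + (1 + nx d') [MOD L] := by
        unfold Nat.ModEq
        rw [← add_assoc, ← add_assoc, ← e1]
      have e4 := Nat.ModEq.add_right_cancel' _ e3
      unfold Nat.ModEq at e4
      rwa [Nat.mod_eq_of_lt (hL d), Nat.mod_eq_of_lt (hL d')] at e4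
    · exact (hlt d' d h.symm hn).elim
  let σ : Perm D := Equiv.ofBijective f (Finite.injective_iff_bijective.1 hfi)
  have hσ : ∀ d, σ d = f d := fun d => rfl
  refine ⟨σ, fun d => hf1 d, ?_, fun d => ⟨nx d, hf2 d, hmin d⟩⟩
  have main : ∀ m d d', lab d = lab d' → key d' = (key d + m) % L → σ.SameCycle d d' := by
    intro m
    induction m using Nat.strong_induction_on with
    | _ m ih =>
      intro d d' hl hk
      rcases Nat.eq_zero_or_pos m with rfl | hm
      · rw [add_zero, Nat.mod_eq_of_lt (hL d)] at hk
        rw [hinj d d' hl hk.symm]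
      · have hn : nx d ≤ m - 1 := by
          by_contra hc
          exact hmin d (m - 1) (by omega) d' hl.symm (by rw [hk]; congr 1; omega)
        have : σ.SameCycle (f d) d' := by
          apply ih (m - 1 - nx d) (by omega) (f d) d' ((hf1 d).trans hl)
          rw [hf2, hk, Nat.mod_add_mod]; congr 1; omega
        exact SameCycle.trans ⟨1, by simp [hσ]⟩ this
  intro d d' hl
  apply main (key d' + (L - key d)) d d' hl
  have := hL d
  rw [show key d + (key d' + (L - key d)) = key d' + L by omega, Nat.add_mod_right,
    Nat.mod_eq_of_lt (hL d')]

-- grid chains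
abbrev Pt := ℤ × ℤ
abbrev UE := Pt × Bool
abbrev Ch := UE →₀ ZMod 2

def ev (k : Fin 4) : Pt := ![(1, 0), (0, 1), (-1, 0), (0, -1)] k
def Qc (z : Pt) (k : Fin 4) : Pt := z + ![(0, 0), (-1, 0), (-1, -1), (0, -1)] k
def ed (z : Pt) (k : Fin 4) : UE := ![(z, false), (z, true), (z - (1, 0), false), (z - (0, 1), true)] k

theorem ed_rev (z : Pt) (k : Fin 4) : ed (z + ev k) (k + 2) = ed z k := by
  fin_cases k <;> simp [ed, ev, sub_eq_add_neg, add_assoc]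

theorem Qc_rev (z : Pt) (k : Fin 4) : Qc (z + ev k) (k + 1) = Qc z k := by
  fin_cases k <;> simp [Qc, ev, add_assoc]

theorem Qc_rev' (z : Pt) (k : Fin 4) : Qc (z + ev k) (k + 2) = Qc z (k + 3) := by
  fin_cases k <;> simp [Qc, ev, add_assoc]

theorem ed_eq (z v : Pt) (k k' : Fin 4) (h : ed z k = ed v k') :
    (z = v ∧ k = k') ∨ (z + ev k = v ∧ k' = k + 2) := by
  obtain ⟨a, b⟩ := z
  obtain ⟨c, d⟩ := v
  fin_cases k <;> fin_cases k' <;> simp_all [ed, ev] <;> omega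

def bd (c : Ch) (z : Pt) : ZMod 2 := ∑ k, c (ed z k)

theorem bd_add (c c' : Ch) (z : Pt) : bd (c + c') z = bd c z + bd c' z := by
  simp [bd, Finset.sum_add_distrib]
theorem bd_sum {ι : Type} (s : Finset ι) (f : ι → Ch) (z : Pt) :
    bd (∑ i ∈ s, f i) z = ∑ i ∈ s, bd (f i) z := by
  classical
  induction s using Finset.induction_on with
  | empty => simp [bd]
  | insert a s ha ih => rw [Finset.sum_insert ha, Finset.sum_insert ha, bd_add, ih]
theorem bd_smul (a : ZMod 2) (c : Ch) (z : Pt) : bd (a • c) z = a * bd c z := by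
  simp [bd, Finset.mul_sum, mul_add]

open Classical in
noncomputable def dl (a z : Pt) : ZMod 2 := if z = a then 1 else 0

theorem single_ed (z v : Pt) (k k' : Fin 4) : (Finsupp.single (ed z k) (1 : ZMod 2)) (ed v k') =
      (if k = k' then dl z v else 0) + (if k + 2 = k' then dl (z + ev k) v else 0) := by
  classical
  rw [Finsupp.single_apply]
  have hk : k ≠ k + 2 := by fin_cases k <;> decide
  by_cases h : ed z k = ed v k'
  · rw [if_pos h]
    rcases ed_eq _ _ _ _ h with ⟨h1, h2⟩ | ⟨h1, h2⟩
    · subst h1 h2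
      rw [if_pos rfl, if_neg (Ne.symm hk)]; simp [dl]
    · rw [h2, if_neg hk, if_pos rfl]; simp [dl, h1]
  · rw [if_neg h]
    by_cases h1 : k = k'
    · subst h1
      rw [if_pos rfl, if_neg (Ne.symm hk)]
      have : v ≠ z := by rintro rfl; exact h rfl
      simp [dl, this]
    · rw [if_neg h1]
      by_cases h2 : k + 2 = k'
      · rw [if_pos h2]
        have : v ≠ z + ev k := by
          rintro rfl; apply h; rw [← h2, ed_rev]
        simp [dl, this]
      · simp [h2]

theorem bd_single (z v : Pt) (k : Fin 4) : bd (Finsupp.single (ed z k) 1) v = dl z v + dl (z + ev k) v := by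
  unfold bd
  simp only [single_ed, Finset.sum_add_distrib]
  simp

/-- an even chain bounds -/
theorem even_bounds (c : Ch) (h : ∀ z, bd c z = 0) :
    ∃ w : Pt → ZMod 2, ∀ z k, w (Qc z k) + w (Qc z (k + 3)) = c (ed z k) := by
  classical
  obtain ⟨B, hB⟩ : ∃ B : ℤ, ∀ i j b, B < j → c ((i, j), b) = 0 := by
    obtain ⟨B, hB⟩ := (c.support.image (fun e => e.1.2)).bddAbove
    refine ⟨B, fun i j b hj => ?_⟩
    by_contra hc
    have : j ∈ c.support.image (fun e => e.1.2) := by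
      rw [Finset.mem_image]; exact ⟨((i, j), b), by simpa using hc, rfl⟩
    have := hB this
    omega
  let w : Pt → ZMod 2 := fun z => ∑ j ∈ Finset.Ioc z.2 B, c ((z.1, j), false)
  have hstep : ∀ i j, w (i, j) + w (i, j - 1) = c ((i, j), false) := by
    intro i j
    by_cases hj : B < j
    · rw [hB i j _ hj]
      simp only [w]
      rw [Finset.Ioc_eq_empty (by simp; omega), Finset.Ioc_eq_empty (by simp; omega)]; simp
    · have : Finset.Ioc (j - 1) B = insert j (Finset.Ioc j B) := by
        ext x; simp; omega
      simp only [w]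
      rw [this, Finset.sum_insert (by simp)]
      generalize ∑ x ∈ Finset.Ioc j B, c ((i, x), false) = a
      generalize c ((i, j), false) = b
      revert a b; decide
  have hvert : ∀ (n : ℕ) i j, B - j < n → w (i - 1, j) + w (i, j) = c ((i, j), true) := by
    intro n
    induction n with
    | zero =>
      intro i j hj
      have hj : B < j := by push_cast at hj; omega
      rw [hB i j _ hj]
      simp only [w]
      rw [Finset.Ioc_eq_empty (by simp; omega)]; simp
    | succ n ih =>
      intro i j hj
      have e1 := ih i (j + 1) (by push_cast at hj; omega)
      have e2 := hstep i (j + 1)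
      have e3 := hstep (i - 1) (j + 1)
      have e4 := h (i, j + 1)
      unfold bd at e4
      rw [Fin.sum_univ_four] at e4
      simp [ed] at e4
      rw [add_sub_cancel_right] at e2 e3
      revert e1 e2 e3 e4
      generalize w (i - 1, j + 1) = a1
      generalize w (i, j + 1) = a2
      generalize w (i - 1, j) = a3
      generalize w (i, j) = a4
      generalize c ((i, j + 1), true) = a5
      generalize c ((i, j + 1), false) = a6
      generalize c ((i - 1, j + 1), false) = a7
      generalize c ((i, j), true) = a8
      intro e1 e2 e3 e4
      subst e1 e2 e3
      clear * - e4
      revert e4; revert a1 a2 a3 a4 a8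
      decide
  refine ⟨w, ?_⟩
  rintro ⟨i, j⟩ k
  have hv := fun i j => hvert (B - j + 1).toNat i j (by omega)
  fin_cases k
  · have := hstep i j
    simpa [Qc, ed, sub_eq_add_neg] using this
  · have := hv i j
    simpa [Qc, ed, sub_eq_add_neg] using this
  · have := hstep (i - 1) j
    rw [add_comm] at this
    simpa [Qc, ed, sub_eq_add_neg] using this
  · have := hv i (j - 1)
    rw [add_comm] at this
    simpa [Qc, ed, sub_eq_add_neg] using this
end BCN

namespace BCN
open Equiv Equiv.Perm Finset

/-- closed lattice square of radius `R` -/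
def InSq (R : ℕ) (c z : Pt) : Prop := |z.1 - c.1| ≤ R ∧ |z.2 - c.2| ≤ R

/-- exits of a square -/
def UU (R : ℕ) (c : Pt) (k : Fin 4) (t : ℤ) : Pt :=
  c + ![((R : ℤ), t), (-t, (R : ℤ)), (-(R : ℤ), -t), (t, -(R : ℤ))] k

def xK (R x : ℕ) : Fin 4 := Fin.ofNat 4 (x / (2 * R + 1))
def xU (R : ℕ) (c : Pt) (x : ℕ) : Pt := UU R c (xK R x) (((x % (2 * R + 1) : ℕ) : ℤ) - R)

theorem xK_mod (R x : ℕ) : xK R (x % (4 * (2 * R + 1))) = xK R x := by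
  unfold xK
  rw [Nat.mod_mul_left_div_self]
  ext
  simp [Fin.ofNat]

theorem xU_mod (R : ℕ) (c : Pt) (x : ℕ) : xU R c (x % (4 * (2 * R + 1))) = xU R c x := by
  unfold xU
  rw [xK_mod, Nat.mod_mul_left_mod]

theorem UU_next (R : ℕ) (c : Pt) (k : Fin 4) (t : ℤ) :
    Qc (UU R c k (t + 1)) (k + 3) = Qc (UU R c k t) k := by
  obtain ⟨a, b⟩ := c
  fin_cases k <;> simp [Qc, UU] <;> ring_nf

theorem UU_corner (R : ℕ) (c : Pt) (k : Fin 4) :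
    Qc (UU R c (k + 1) (-R)) (k + 1 + 3) = Qc (UU R c k R) k := by
  obtain ⟨a, b⟩ := c
  fin_cases k <;> simp [Qc, UU]

theorem x_next (R : ℕ) (c : Pt) (x : ℕ) :
    Qc (xU R c (x + 1)) (xK R (x + 1) + 3) = Qc (xU R c x) (xK R x) := by
  have hM : 0 < 2 * R + 1 := by omega
  have hlt := Nat.mod_lt x hM
  by_cases h : x % (2 * R + 1) = 2 * R
  · have h1 : (x + 1) % (2 * R + 1) = 0 := by
      rw [Nat.add_mod, h]
      rcases Nat.eq_zero_or_pos R with rfl | hR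
      · simp
      · rw [Nat.mod_eq_of_lt (show 1 < 2 * R + 1 by omega), Nat.mod_self]
    have h2 : (x + 1) / (2 * R + 1) = x / (2 * R + 1) + 1 := by
      have e1 := Nat.div_add_mod x (2 * R + 1)
      have e2 := Nat.div_add_mod (x + 1) (2 * R + 1)
      rw [h1] at e2; rw [h] at e1
      have : (2 * R + 1) * ((x + 1) / (2 * R + 1)) = (2 * R + 1) * (x / (2 * R + 1) + 1) := by
        rw [mul_add, mul_one]; omega
      exact Nat.eq_of_mul_eq_mul_left hM this
    have h3 : xK R (x + 1) = xK R x + 1 := by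
      unfold xK; rw [h2]; ext; simp [Fin.ofNat, Fin.val_add]
    unfold xU
    rw [h3, h1, h]
    have := UU_corner R c (xK R x)
    convert this using 3
    · push_cast; ring
    · push_cast; ring
  · have e1 := Nat.div_add_mod x (2 * R + 1)
    have h12 : (x + 1) / (2 * R + 1) = x / (2 * R + 1) ∧ (x + 1) % (2 * R + 1) = x % (2 * R + 1) + 1 := by
      rw [Nat.div_mod_unique hM]
      constructor
      · omega
      · omega
    have h3 : xK R (x + 1) = xK R x := by unfold xK; rw [h12.1]
    unfold xU
    rw [h3, h12.2]
    have := UU_next R c (xK R x) (((x % (2 * R + 1) : ℕ) : ℤ) - R)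
    rw [← this]
    congr 2
    push_cast; ring

theorem xU_in (R : ℕ) (c : Pt) (x : ℕ) : InSq R c (xU R c x) ∧ ¬ InSq R c (xU R c x + ev (xK R x)) ∧
    InSq (R + 1) c (xU R c x + ev (xK R x)) := by
  have hM : 0 < 2 * R + 1 := by omega
  have hlt := Nat.mod_lt x hM
  unfold xU
  generalize xK R x = k
  generalize x % (2 * R + 1) = y at *
  obtain ⟨a, b⟩ := c
  fin_cases k <;> simp [InSq, UU, ev, abs_le] <;> omega

theorem exit_exists (R : ℕ) (c u : Pt) (k : Fin 4) (h1 : InSq R c u) (h2 : ¬ InSq R c (u + ev k)) :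
    ∃ x < 4 * (2 * R + 1), xU R c x = u ∧ xK R x = k := by
  have hM : 0 < 2 * R + 1 := by omega
  obtain ⟨t, ht1, ht2, ht⟩ : ∃ t : ℤ, -R ≤ t ∧ t ≤ R ∧ UU R c k t = u := by
    obtain ⟨a, b⟩ := c
    obtain ⟨u, v⟩ := u
    fin_cases k <;> simp [InSq, UU, ev, abs_le] at *
    · exact ⟨v - b, by omega, by omega, by omega, by omega⟩
    · exact ⟨a - u, by omega, by omega, by omega, by omega⟩
    · exact ⟨b - v, by omega, by omega, by omega, by omega⟩
    · exact ⟨u - a, by omega, by omega, by omega, by omega⟩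
  have h12 : ((2 * R + 1) * k.val + (t + R).toNat) / (2 * R + 1) = k.val ∧
      ((2 * R + 1) * k.val + (t + R).toNat) % (2 * R + 1) = (t + R).toNat := by
    rw [Nat.div_mod_unique hM]
    constructor
    · omega
    · omega
  refine ⟨(2 * R + 1) * k.val + (t + R).toNat, ?_, ?_, ?_⟩
  · have hk : (2 * R + 1) * k.val ≤ (2 * R + 1) * 3 := Nat.mul_le_mul_left _ (by omega)
    omega
  · unfold xU xK
    rw [h12.1, h12.2, ← ht]
    have : Fin.ofNat 4 k.val = k := by ext; simp [Fin.ofNat]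
    rw [this]
    congr 1
    omega
  · unfold xK; rw [h12.1]; ext; simp [Fin.ofNat]

theorem in_chain (R : ℕ) (c : Pt) : ∀ (n : ℕ) (z : Pt), |z.1 - c.1| + |z.2 - c.2| ≤ n → InSq R c z →
    ∃ ch : Ch, (∀ v m, ch (ed v m) ≠ 0 → InSq R c v ∧ InSq R c (v + ev m)) ∧
      ∀ v, bd ch v = dl c v + dl z v := by
  intro n
  have hgo : ∀ z k, InSq R c z → InSq R c (z + ev k) →
      (∃ ch : Ch, (∀ v m, ch (ed v m) ≠ 0 → InSq R c v ∧ InSq R c (v + ev m)) ∧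
      ∀ v, bd ch v = dl c v + dl (z + ev k) v) → ∃ ch : Ch, (∀ v m, ch (ed v m) ≠ 0 → InSq R c v ∧ InSq R c (v + ev m)) ∧
      ∀ v, bd ch v = dl c v + dl z v := by
    rintro z k h1 h2 ⟨ch, hc1, hc2⟩
    refine ⟨ch + Finsupp.single (ed z k) 1, ?_, ?_⟩
    · intro v m h
      by_cases h0 : ch (ed v m) = 0
      · rw [Finsupp.add_apply, h0, zero_add, Finsupp.single_apply] at h
        have h : ed z k = ed v m := by by_contra hh; simp [hh] at h
        rcases ed_eq _ _ _ _ h with ⟨rfl, rfl⟩ | ⟨rfl, rfl⟩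
        · exact ⟨h1, h2⟩
        · refine ⟨h2, ?_⟩
          have : z + ev k + ev (k + 2) = z := by
            fin_cases k <;> simp [ev, add_assoc]
          rwa [this]
      · exact hc1 v m h0
    · intro v
      rw [bd_add, hc2, bd_single]
      generalize dl c v = a1
      generalize dl (z + ev k) v = a2
      generalize dl z v = a3
      revert a1 a2 a3; decide
  induction n with
  | zero =>
    intro z h hz
    have h1 := abs_nonneg (z.1 - c.1)
    have h2 := abs_nonneg (z.2 - c.2)
    push_cast at h
    have e1 : z.1 - c.1 = 0 := abs_eq_zero.1 (by omega)
    have e2 : z.2 - c.2 = 0 := abs_eq_zero.1 (by omega)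
    have : z = c := Prod.ext (by omega) (by omega)
    subst this
    refine ⟨0, by simp, fun v => ?_⟩
    rw [z2_add_self]; simp [bd]
  | succ n ih =>
    intro z h hz
    obtain ⟨a, b⟩ := c
    obtain ⟨x, y⟩ := z
    push_cast at h
    simp only [InSq] at hz
    obtain ⟨hz1, hz2⟩ := hz
    have key : ∀ k, InSq R (a, b) ((x, y) + ev k) → 
       |((x, y) + ev k).1 - (a, b).1| + |((x, y) + ev k).2 - (a, b).2| ≤ (n : ℤ) → ∃ ch : Ch, (∀ v m, ch (ed v m) ≠ 0 → InSq R (a, b) v ∧ InSq R (a, b) (v + ev m)) ∧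
      ∀ v, bd ch v = dl (a, b) v + dl (x, y) v := fun k h1 h2 =>
      hgo (x, y) k ⟨hz1, hz2⟩ h1 (ih _ h2 h1)
    rcases lt_trichotomy x a with hx | hx | hx
    · have e1 : |x - a| = a - x := by rw [abs_of_nonpos (by omega)]; ring
      have e2 : |x + 1 - a| = a - x - 1 := by rw [abs_of_nonpos (by omega)]; ring
      apply key 0 <;> simp [InSq, ev] <;> omega
    · rcases lt_trichotomy y b with hy | hy | hy
      · have e1 : |y - b| = b - y := by rw [abs_of_nonpos (by omega)]; ring
        have e2 : |y + 1 - b| = b - y - 1 := by rw [abs_of_nonpos (by omega)]; ring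
        apply key 1 <;> simp [InSq, ev] <;> omega
      · subst hx hy
        exact ih (x, y) (by simp) ⟨hz1, hz2⟩
      · have e1 : |y - b| = y - b := by rw [abs_of_nonneg (by omega)]
        have e2 : |y + -1 - b| = y - b - 1 := by rw [abs_of_nonneg (by omega)]; ring
        apply key 3 <;> simp [InSq, ev] <;> omega
    · have e1 : |x - a| = x - a := by rw [abs_of_nonneg (by omega)]
      have e2 : |x + -1 - a| = x - a - 1 := by rw [abs_of_nonneg (by omega)]; ring
      apply key 2 <;> simp [InSq, ev] <;> omega

end BCN

namespace BCN
open Equiv Equiv.Perm Finset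

/-- orientation reversal of half segments -/
def flipP (Seg : Type) : Perm (Seg × Bool) := (Equiv.refl Seg).prodCongr Equiv.boolNot

@[simp] theorem flipP_apply {Seg : Type} (s : Seg) (b : Bool) : flipP Seg (s, b) = (s, !b) := rfl

def labP {Seg Λ : Type} (p q : Seg → Λ) (d : Seg × Bool) : Λ := if d.2 then p d.1 else q d.1

structure GD (Λ Seg : Type) where
  c : Λ → Pt
  R : ℕ
  p : Seg → Λ
  q : Seg → Λ
  pq : ∀ s, p s ≠ q s
  sep : ∀ l l' z, InSq (R + 1) (c l) z → InSq R (c l') z → l = l'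
  ℓ : Seg → ℕ
  hℓ : ∀ s, 2 ≤ ℓ s
  z : Seg → ℕ → Pt
  k : Seg → ℕ → Fin 4
  step : ∀ s i, i < ℓ s → z s (i + 1) = z s i + ev (k s i)
  z0 : ∀ s, InSq R (c (p s)) (z s 0)
  zl : ∀ s, InSq R (c (q s)) (z s (ℓ s))
  out : ∀ s i, 0 < i → i < ℓ s → ∀ l, ¬ InSq R (c l) (z s i)
  inj : ∀ s i s' j, 0 < i → i < ℓ s → 0 < j → j < ℓ s' → z s i = z s' j → s = s' ∧ i = j

theorem ev_rev (z : Pt) (k : Fin 4) : z + ev k + ev (k + 2) = z := by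
  fin_cases k <;> simp [ev, add_assoc]

theorem InSq.succ {R : ℕ} {c z : Pt} (h : InSq R c z) : InSq (R + 1) c z := by
  obtain ⟨h1, h2⟩ := h
  exact ⟨by push_cast; omega, by push_cast; omega⟩

theorem around (f : Fin 4 → ZMod 2) (C : ZMod 2) (k m : Fin 4) (hkm : k ≠ m)
    (h : ∀ i, f i + f (i + 3) = C * ((if k = i then 1 else 0) + (if m = i then 1 else 0))) :
    f (m + 3) = f k := by
  have key : ∀ k m : Fin 4, k ≠ m → ∀ a0 a1 a2 a3 C : ZMod 2,
      a0 + a3 = C * ((if k = 0 then 1 else 0) + (if m = 0 then 1 else 0)) →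
      a1 + a0 = C * ((if k = 1 then 1 else 0) + (if m = 1 then 1 else 0)) →
      a2 + a1 = C * ((if k = 2 then 1 else 0) + (if m = 2 then 1 else 0)) →
      a3 + a2 = C * ((if k = 3 then 1 else 0) + (if m = 3 then 1 else 0)) →
      (![a0, a1, a2, a3] : Fin 4 → ZMod 2) (m + 3) = (![a0, a1, a2, a3] : Fin 4 → ZMod 2) k := by
    decide
  have hf : f = ![f 0, f 1, f 2, f 3] := by
    ext i; fin_cases i <;> rfl
  rw [hf]
  exact key k m hkm _ _ _ _ C (h 0) (h 1) (h 2) (h 3)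

theorem x_inj (R : ℕ) (c : Pt) (x y : ℕ) (h1 : xU R c x = xU R c y) (h2 : xK R x = xK R y) :
    x % (4 * (2 * R + 1)) = y % (4 * (2 * R + 1)) := by
  rw [mul_comm, Nat.mod_mul, Nat.mod_mul]
  have e2 : x / (2 * R + 1) % 4 = y / (2 * R + 1) % 4 := by
    have := congrArg Fin.val h2
    simpa [xK, Fin.ofNat] using this
  have e1 : ((x % (2 * R + 1) : ℕ) : ℤ) = ((y % (2 * R + 1) : ℕ) : ℤ) := by
    unfold xU at h1
    rw [h2] at h1
    generalize ((x % (2 * R + 1) : ℕ) : ℤ) = a at *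
    generalize ((y % (2 * R + 1) : ℕ) : ℤ) = b at *
    generalize xK R y = k at *
    obtain ⟨c1, c2⟩ := c
    fin_cases k <;> simp [UU] at h1 <;> omega
  have e1 : x % (2 * R + 1) = y % (2 * R + 1) := by exact_mod_cast e1
  rw [e1, e2]

namespace GD
variable {Λ Seg : Type} (g : GD Λ Seg)

/-- start of an exit edge -/
def u (d : Seg × Bool) : Pt := if d.2 then g.z d.1 0 else g.z d.1 (g.ℓ d.1)
def kk (d : Seg × Bool) : Fin 4 := if d.2 then g.k d.1 0 else g.k d.1 (g.ℓ d.1 - 1) + 2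

theorem u_in (d) : InSq g.R (g.c (labP g.p g.q d)) (g.u d) := by
  obtain ⟨s, b⟩ := d
  cases b <;> simp [labP, u, g.z0, g.zl]

theorem u_next (d) : g.u d + ev (g.kk d) = if d.2 then g.z d.1 1 else g.z d.1 (g.ℓ d.1 - 1) := by
  obtain ⟨s, b⟩ := d
  have h2 := g.hℓ s
  cases b
  · simp only [u, kk, Bool.false_eq_true, if_false]
    have := g.step s (g.ℓ s - 1) (by omega)
    rw [show g.ℓ s - 1 + 1 = g.ℓ s by omega] at this
    rw [this, ev_rev]
  · simp only [u, kk, if_true]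
    exact (g.step s 0 (by omega)).symm

theorem u_out (d) (l) : ¬ InSq g.R (g.c l) (g.u d + ev (g.kk d)) := by
  rw [u_next]
  obtain ⟨s, b⟩ := d
  have h2 := g.hℓ s
  cases b
  · exact g.out s _ (by simp only; omega) (by simp only; omega) l
  · exact g.out s _ (by simp) (by omega) l

theorem c_inj {l l'} (h : g.c l = g.c l') : l = l' := by
  apply g.sep l l' (g.c l)
  · simp [InSq]; omega
  · rw [h]; simp [InSq]

theorem noback (s i) (h : i + 1 < g.ℓ s) : g.k s (i + 1) ≠ g.k s i + 2 := by
  intro hk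
  have e1 := g.step s i (by omega)
  have e2 := g.step s (i + 1) h
  rw [hk, e1, ev_rev] at e2
  rcases Nat.eq_zero_or_pos i with rfl | hi
  · rcases Nat.lt_or_ge 2 (g.ℓ s) with h2 | h2
    · exact g.out s 2 (by omega) h2 (g.p s) (by rw [e2]; exact g.z0 s)
    · have : g.ℓ s = 2 := by omega
      have h3 := g.zl s
      rw [this] at h3
      rw [e2] at h3
      exact g.pq s (g.sep _ _ _ (g.z0 s).succ h3)
  · rcases Nat.lt_or_ge (i + 2) (g.ℓ s) with h2 | h2
    · have := (g.inj s (i + 1 + 1) s i (by omega) (by omega) hi (by omega) e2).2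
      omega
    · have h3 := g.zl s
      rw [show g.ℓ s = i + 1 + 1 by omega, e2] at h3
      exact g.out s i hi (by omega) _ h3

/-- path chain -/
noncomputable def path (s : Seg) : Ch := ∑ i ∈ Finset.range (g.ℓ s), Finsupp.single (ed (g.z s i) (g.k s i)) 1

theorem bd_path (s : Seg) (v : Pt) : bd (g.path s) v = dl (g.z s 0) v + dl (g.z s (g.ℓ s)) v := by
  unfold path
  rw [bd_sum]
  have : ∀ n, n ≤ g.ℓ s → ∑ i ∈ Finset.range n, bd (Finsupp.single (ed (g.z s i) (g.k s i)) 1) v =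
      dl (g.z s 0) v + dl (g.z s n) v := by
    intro n
    induction n with
    | zero => intro _; simp [z2_add_self]
    | succ n ih =>
      intro hn
      rw [Finset.sum_range_succ, ih (by omega), bd_single, ← g.step s n (by omega)]
      generalize dl (g.z s 0) v = a1
      generalize dl (g.z s n) v = a2
      generalize dl (g.z s (n+1)) v = a3
      revert a1 a2 a3; decide
  exact this _ le_rfl

theorem path_off (s' : Seg) (v : Pt) (hv : ∀ l, ¬ InSq g.R (g.c l) v)
    (hn : ∀ j, 0 < j → j < g.ℓ s' → g.z s' j ≠ v) (m : Fin 4) :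
    g.path s' (ed v m) = 0 := by
  unfold path
  rw [Finsupp.finsetSum_apply]
  apply Finset.sum_eq_zero
  intro i hi
  rw [Finset.mem_range] at hi
  rw [single_ed]
  have h1 : ∀ i, i ≤ g.ℓ s' → dl (g.z s' i) v = 0 := by
    intro i hi
    have : v ≠ g.z s' i := by
      intro h
      rcases Nat.eq_zero_or_pos i with rfl | h0
      · exact hv _ (h ▸ g.z0 s')
      rcases Nat.eq_or_lt_of_le hi with rfl | h3
      · exact hv _ (h ▸ g.zl s')
      exact hn i h0 h3 h.symm
    simp [dl, this]
  rw [← g.step s' i hi, h1 i hi.le, h1 (i + 1) hi]; simp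

open Classical in
theorem path_at (s s' : Seg) (j : ℕ) (hj : 0 < j) (hj' : j < g.ℓ s) (m : Fin 4) :
    g.path s' (ed (g.z s j) m) = if s' = s then (if g.k s j = m then 1 else 0) +
      (if g.k s (j - 1) + 2 = m then 1 else 0) else 0 := by
  by_cases hs : s' = s
  · subst hs
    rw [if_pos rfl]
    unfold path
    rw [Finsupp.finsetSum_apply]
    have h1 : ∀ i, i ≤ g.ℓ s' → dl (g.z s' i) (g.z s' j) = if i = j then 1 else 0 := by
      intro i hi
      by_cases hij : i = j
      · subst hij; simp [dl]
      · have : g.z s' j ≠ g.z s' i := by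
          intro h
          rcases Nat.eq_zero_or_pos i with rfl | h0
          · exact g.out s' j hj hj' _ (h ▸ g.z0 s')
          rcases Nat.eq_or_lt_of_le hi with rfl | h3
          · exact g.out s' j hj hj' _ (h ▸ g.zl s')
          exact hij (g.inj s' j s' i hj hj' h0 h3 h).2.symm
        simp [dl, this, hij]
    have h2 : ∀ i ∈ Finset.range (g.ℓ s'), (Finsupp.single (ed (g.z s' i) (g.k s' i)) (1 : ZMod 2)) (ed (g.z s' j) m) =
        (if i = j then (if g.k s' j = m then 1 else 0) else 0) +
        (if i = j - 1 then (if g.k s' (j - 1) + 2 = m then 1 else 0) else 0) := by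
      intro i hi
      rw [Finset.mem_range] at hi
      rw [single_ed, ← g.step s' i hi, h1 i hi.le, h1 (i + 1) hi]
      congr 1
      · by_cases hij : i = j
        · subst hij; simp
        · simp [hij]
      · by_cases hij : i = j - 1
        · have : j - 1 + 1 = j := by omega
          simp [hij, this]
        · have : ¬ (i + 1 = j) := by omega
          simp [hij, this]
    rw [Finset.sum_congr rfl h2, Finset.sum_add_distrib, Finset.sum_ite_eq', Finset.sum_ite_eq',
      if_pos (Finset.mem_range.2 hj'), if_pos (Finset.mem_range.2 (by omega))]
  · rw [if_neg hs]
    exact g.path_off s' _ (g.out s j hj hj') (fun i h1 h2 h => hs (g.inj s' i s j h1 h2 hj hj' h).1) m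


variable [Fintype Seg]

open Classical in
theorem cert : ∃ σ : Perm (Seg × Bool), (∀ d, labP g.p g.q (σ d) = labP g.p g.q d) ∧
    (∀ d d', labP g.p g.q d = labP g.p g.q d' → σ.SameCycle d d') ∧
    Cert (flipP Seg) (σ⁻¹ * flipP Seg) (labP g.p g.q) := by
  have hkey : ∀ d, ∃ x < 4 * (2 * g.R + 1), xU g.R (g.c (labP g.p g.q d)) x = g.u d ∧ xK g.R x = g.kk d :=
    fun d => exit_exists _ _ _ _ (g.u_in d) (g.u_out d _)
  choose key hkL hkU hkK using hkey
  have hinj : ∀ d d', labP g.p g.q d = labP g.p g.q d' → key d = key d' → d = d' := by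
    rintro ⟨s, b⟩ ⟨s', b'⟩ hl hk
    have h1 : g.u (s, b) = g.u (s', b') := by rw [← hkU, ← hkU, hl, hk]
    have h2 : g.kk (s, b) = g.kk (s', b') := by rw [← hkK, ← hkK, hk]
    have h3 := g.u_next (s, b)
    rw [h1, h2, g.u_next] at h3
    have l1 := g.hℓ s
    have l2 := g.hℓ s'
    have hs : s = s' := by
      cases b <;> cases b' <;> simp at h3
      · exact (g.inj s _ s' _ (by omega) (by omega) (by omega) (by omega) h3.symm).1
      · exact (g.inj s _ s' _ (by omega) (by omega) (by omega) (by omega) h3.symm).1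
      · exact (g.inj s _ s' _ (by omega) (by omega) (by omega) (by omega) h3.symm).1
      · exact (g.inj s _ s' _ (by omega) (by omega) (by omega) (by omega) h3.symm).1
    subst hs
    have := g.pq s
    cases b <;> cases b' <;> simp [labP] at hl ⊢
    · exact this hl.symm
    · exact this hl
  obtain ⟨σ, hσ1, hσ2, hσ3⟩ := cyc_next (labP g.p g.q) key _ hkL hinj
  refine ⟨σ, hσ1, hσ2, ?_⟩
  intro C hC hsum
  have hJ : ∀ d : Seg × Bool, ∃ ch : Ch, (∀ v m, ch (ed v m) ≠ 0 → InSq g.R (g.c (labP g.p g.q d)) v ∧ 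
        InSq g.R (g.c (labP g.p g.q d)) (v + ev m)) ∧
      ∀ v, bd ch v = dl (g.c (labP g.p g.q d)) v + dl (g.u d) v := fun d =>
    in_chain _ _ (|(g.u d).1 - (g.c (labP g.p g.q d)).1| + |(g.u d).2 - (g.c (labP g.p g.q d)).2|).toNat _
      (Int.self_le_toNat _) (g.u_in d)
  choose J hJ1 hJ2 using hJ
  let T : Ch := ∑ s, C (s, true) • (g.path s + (J (s, true) + J (s, false)))
  have hT : ∀ v, bd T v = 0 := by
    intro v
    have e1 : bd T v = ∑ s, C (s, true) * (dl (g.c (g.p s)) v + dl (g.c (g.q s)) v) := by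
      simp only [T]
      rw [bd_sum]
      apply Finset.sum_congr rfl
      intro s _
      rw [bd_smul, bd_add, bd_add, bd_path, hJ2, hJ2]
      simp only [u, labP, if_true, Bool.false_eq_true, if_false]
      congr 1
      generalize dl (g.z s 0) v = a1
      generalize dl (g.z s (g.ℓ s)) v = a2
      generalize dl (g.c (g.p s)) v = a3
      generalize dl (g.c (g.q s)) v = a4
      revert a1 a2 a3 a4; decide
    have e2 : bd T v = ∑ d : Seg × Bool, C d * dl (g.c (labP g.p g.q d)) v := by
      rw [e1, Fintype.sum_prod_type]
      apply Finset.sum_congr rfl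
      intro s _
      rw [Fintype.sum_bool]
      have := hC (s, true)
      simp at this
      simp [labP, this, mul_add]
    rw [e2]
    by_cases hv : ∃ l, v = g.c l
    · obtain ⟨l, rfl⟩ := hv
      rw [← hsum l, Finset.sum_filter]
      apply Finset.sum_congr rfl
      intro d _
      by_cases h : labP g.p g.q d = l
      · rw [if_pos h, h]; simp [dl]
      · rw [if_neg h]
        have : g.c l ≠ g.c (labP g.p g.q d) := fun hh => h (g.c_inj hh).symm
        simp [dl, this]
    · apply Finset.sum_eq_zero
      intro d _
      have : v ≠ g.c (labP g.p g.q d) := fun hh => hv ⟨_, hh⟩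
      simp [dl, this]
  obtain ⟨w, hw⟩ := even_bounds T hT
  -- coefficients outside of squares
  have hTo : ∀ v m, (∀ l, ¬ InSq g.R (g.c l) v) → T (ed v m) = ∑ s, C (s, true) * g.path s (ed v m) := by
    intro v m hv
    simp only [T]
    rw [Finsupp.finsetSum_apply]
    apply Finset.sum_congr rfl
    intro s _
    have h0 : ∀ d, J d (ed v m) = 0 := by
      intro d
      by_contra h
      exact hv _ (hJ1 d v m h).1
    simp [h0]
  have hTa : ∀ s j m, 0 < j → j < g.ℓ s → T (ed (g.z s j) m) =
      C (s, true) * ((if g.k s j = m then 1 else 0) + (if g.k s (j - 1) + 2 = m then 1 else 0)) := by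
    intro s j m h1 h2
    rw [hTo _ _ (g.out s j h1 h2)]
    simp only [g.path_at s _ j h1 h2]
    simp
  have hTn : ∀ v m, (∀ l, ¬ InSq g.R (g.c l) v) → T (ed v m) ≠ 0 → ∃ s j, 0 < j ∧ j < g.ℓ s ∧ g.z s j = v ∧
      (g.k s j = m ∨ g.k s (j - 1) + 2 = m) := by
    intro v m hv h
    by_cases hn : ∃ s j, 0 < j ∧ j < g.ℓ s ∧ g.z s j = v
    · obtain ⟨s, j, h1, h2, h3⟩ := hn
      refine ⟨s, j, h1, h2, h3, ?_⟩
      rw [← h3, hTa s j m h1 h2] at h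
      by_contra hc
      push Not at hc
      simp [hc.1, hc.2] at h
    · exfalso
      apply h
      rw [hTo v m hv]
      apply Finset.sum_eq_zero
      intro s _
      rw [g.path_off s v hv (fun j h1 h2 h3 => hn ⟨s, j, h1, h2, h3⟩), mul_zero]
  -- left cells agree along a path
  have hleft : ∀ s i, i + 1 < g.ℓ s → w (Qc (g.z s i) (g.k s i)) = w (Qc (g.z s (i + 1)) (g.k s (i + 1))) := by
    intro s i hi
    have := around (fun m => w (Qc (g.z s (i + 1)) m)) (C (s, true)) (g.k s (i + 1)) (g.k s i + 2)
      (g.noback s i hi) (fun m => by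
        rw [hw, hTa s (i + 1) m (by omega) hi]; simp)
    rw [← this, g.step s i (by omega), show g.k s i + 2 + 3 = g.k s i + 1 by
      generalize g.k s i = a; revert a; decide, Qc_rev]
  have hleft' : ∀ s i, i < g.ℓ s → w (Qc (g.z s 0) (g.k s 0)) = w (Qc (g.z s i) (g.k s i)) := by
    intro s i
    induction i with
    | zero => intro _; rfl
    | succ i ih => intro hi; rw [ih (by omega), hleft s i hi]
  let Lf : Seg × Bool → ZMod 2 := fun d => w (Qc (g.u d) (g.kk d))
  let Rt : Seg × Bool → ZMod 2 := fun d => w (Qc (g.u d) (g.kk d + 3))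
  have hLR : ∀ d, Lf d + Rt d = C d := by
    rintro ⟨s, b⟩
    have h2 := g.hℓ s
    simp only [Lf, Rt]
    rw [hw, ← ed_rev, g.u_next]
    have := hC (s, true)
    simp at this
    cases b
    · simp only [Bool.false_eq_true, if_false]
      rw [hTa s _ _ (by omega) (by omega), this]
      have hb := g.noback s (g.ℓ s - 1 - 1) (by omega)
      rw [show g.ℓ s - 1 - 1 + 1 = g.ℓ s - 1 by omega] at hb
      simp only [kk, Bool.false_eq_true, if_false]
      rw [if_pos (by generalize g.k s (g.ℓ s - 1) = a; revert a; decide), if_neg]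
      · simp
      · intro h; apply hb; rw [h]; generalize g.k s (g.ℓ s - 1) = a; revert a; decide
    · simp only [if_true]
      rw [hTa s _ _ (by omega) (by omega)]
      have hb := g.noback s 0 (by omega)
      simp only [kk, if_true]
      simp only [zero_add] at hb
      rw [if_neg hb]
      simp
  have hR1 : ∀ s, Lf (s, true) = Rt (s, false) := by
    intro s
    have h2 := g.hℓ s
    simp only [Lf, Rt, u, kk, if_true, Bool.false_eq_true, if_false]
    rw [hleft' s (g.ℓ s - 1) (by omega)]
    have := g.step s (g.ℓ s - 1) (by omega)
    rw [show g.ℓ s - 1 + 1 = g.ℓ s by omega] at this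
    rw [this, show g.k s (g.ℓ s - 1) + 2 + 3 = g.k s (g.ℓ s - 1) + 1 by
      generalize g.k s (g.ℓ s - 1) = a; revert a; decide, Qc_rev]
  have hRa : ∀ d, Lf d = Rt (flipP Seg d) := by
    rintro ⟨s, b⟩
    cases b
    · have e1 := hLR (s, false)
      have e2 := hLR (s, true)
      have e3 := hR1 s
      have e4 := hC (s, true)
      simp at e4 ⊢
      rw [e4, ← e2, e3] at e1
      revert e1
      generalize Lf (s, false) = a1
      generalize Rt (s, false) = a2
      generalize Rt (s, true) = a3
      revert a1 a2 a3; decide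
    · exact hR1 s
  -- around a square
  have hun : ∀ l x, (∀ d, labP g.p g.q d = l → key d ≠ x % (4 * (2 * g.R + 1))) →
      T (ed (xU g.R (g.c l) x) (xK g.R x)) = 0 := by
    intro l x hd
    by_contra hne
    obtain ⟨h1, h2, h3⟩ := xU_in g.R (g.c l) x
    rw [← ed_rev] at hne
    have hv : ∀ l', ¬ InSq g.R (g.c l') (xU g.R (g.c l) x + ev (xK g.R x)) := by
      intro l' h'
      have := g.sep l l' _ h3 h'
      subst this
      exact h2 h'
    obtain ⟨s, j, j1, j2, j3, j4⟩ := hTn _ _ hv hne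
    have hU : xU g.R (g.c l) x = g.z s j + ev (xK g.R x + 2) := by rw [j3, ev_rev]
    have fin : ∀ d, g.u d = xU g.R (g.c l) x → g.kk d = xK g.R x → False := by
      intro d hu hk
      have hl : labP g.p g.q d = l := by
        apply g.sep _ _ (g.u d) (g.u_in d).succ
        rw [hu]; exact h1
      apply hd d hl
      rw [← Nat.mod_eq_of_lt (hkL d)]
      apply x_inj g.R (g.c l)
      · rw [← hu, ← hkU d, hl]
      · rw [← hk, ← hkK d]
    rcases j4 with j4 | j4
    · rw [← j4, ← g.step s j j2] at hU
      have : j + 1 = g.ℓ s := by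
        by_contra hh
        exact g.out s (j + 1) (by omega) (by omega) l (hU ▸ h1)
      apply fin (s, false)
      · simp [u, hU, this]
      · simp only [kk, Bool.false_eq_true, if_false]
        rw [← this, Nat.add_sub_cancel, j4]
        generalize xK g.R x = a; revert a; decide
    · have j4 : g.k s (j - 1) = xK g.R x := add_right_cancel j4
      have hs := g.step s (j - 1) (by omega)
      rw [show j - 1 + 1 = j by omega] at hs
      rw [← j4, hs, ev_rev] at hU
      have : j - 1 = 0 := by
        by_contra hh
        exact g.out s (j - 1) (by omega) (by omega) l (hU ▸ h1)
      rw [this] at j4 hU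
      apply fin (s, true)
      · simp [u, hU]
      · simp [kk, j4]
  have hσR : ∀ d, Lf d = Rt (σ d) := by
    intro d
    obtain ⟨n, hn1, hn2⟩ := hσ3 d
    have hmain : ∀ i ≤ n, Lf d = w (Qc (xU g.R (g.c (labP g.p g.q d)) (key d + 1 + i)) (xK g.R (key d + 1 + i) + 3)) := by
      intro i
      induction i with
      | zero =>
        intro _
        rw [add_zero, x_next, hkU, hkK]
      | succ i ih =>
        intro hi
        rw [ih (by omega), ← add_assoc, x_next]
        have h0 := hun (labP g.p g.q d) (key d + 1 + i) (hn2 i (by omega))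
        rw [← hw] at h0
        revert h0
        generalize w (Qc (xU g.R (g.c (labP g.p g.q d)) (key d + 1 + i)) (xK g.R (key d + 1 + i) + 3)) = a1
        generalize w (Qc (xU g.R (g.c (labP g.p g.q d)) (key d + 1 + i)) (xK g.R (key d + 1 + i))) = a2
        revert a1 a2; decide
    rw [hmain n le_rfl, ← xU_mod, ← xK_mod, ← hn1]
    simp only [Rt]
    rw [← hkU (σ d), ← hkK (σ d), hσ1]
  refine ⟨Lf, ?_, ?_⟩
  · intro d
    have := hσR (σ⁻¹ (flipP Seg d))
    rw [Equiv.Perm.mul_apply, this, hRa]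
    simp
  · intro d
    rw [hRa d, ← hC d, ← hLR (flipP Seg d), add_comm]

end GD
end BCN

namespace BCN
open Equiv Equiv.Perm Finset

def Wk (S A B : Set Pt) (n : ℕ) (z : ℕ → Pt) : Prop :=
  z 0 ∈ A ∧ z n ∈ B ∧ (∀ i ≤ n, z i ∈ S) ∧ ∀ i < n, ∃ k, z (i + 1) = z i + ev k

def Lk (S : Set Pt) (x y : Pt) : Prop := y ∈ S ∧ ∃ k, y = x + ev k

theorem wk_of_refl {S : Set Pt} {a b : Pt} (ha : a ∈ S) (h : Relation.ReflTransGen (Lk S) a b) :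
    ∃ n z, Wk S {a} {b} n z := by
  induction h with
  | refl => exact ⟨0, fun _ => a, by simp [Wk, ha]⟩
  | @tail b c h1 h2 ih =>
    obtain ⟨n, z, h3, h4, h5, h6⟩ := ih
    obtain ⟨h7, k, h8⟩ := h2
    refine ⟨n + 1, fun i => if i ≤ n then z i else c, by simpa using h3, by simp, ?_, ?_⟩
    · intro i hi
      by_cases hi' : i ≤ n
      · simp [hi', h5 i hi']
      · simp [hi', h7]
    · intro i hi
      by_cases hi' : i = n
      · subst hi'
        refine ⟨k, ?_⟩
        simp only [Set.mem_singleton_iff] at h4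
        simp [h4, h8]
      · obtain ⟨k', hk'⟩ := h6 i (by omega)
        refine ⟨k', ?_⟩
        simp [show i ≤ n by omega, show i + 1 ≤ n by omega, hk']

theorem min_walk {S A B : Set Pt} (h : ∃ n z, Wk S A B n z) :
    ∃ n z, Wk S A B n z ∧ (∀ i, 0 < i → i < n → z i ∉ A ∧ z i ∉ B) ∧
      ∀ i j, i < j → j ≤ n → z i ≠ z j := by
  classical
  have hs := Nat.find_spec h
  have hmin := fun m (hm : m < Nat.find h) => Nat.find_min h hm
  set n := Nat.find h
  obtain ⟨z, h1, h2, h3, h4⟩ := hs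
  refine ⟨n, z, ⟨h1, h2, h3, h4⟩, ?_, ?_⟩
  · intro i hi hin
    constructor
    · intro hA
      apply hmin (n - i) (by omega)
      refine ⟨fun j => z (i + j), hA, ?_, fun j hj => h3 _ (by omega), fun j hj => h4 (i + j) (by omega)⟩
      simp only
      rwa [show i + (n - i) = n by omega]
    · intro hB
      apply hmin i hin
      exact ⟨z, h1, hB, fun j hj => h3 _ (by omega), fun j hj => h4 j (by omega)⟩
  · intro i j hij hj he
    apply hmin (n - (j - i)) (by omega)
    refine ⟨fun m => if m ≤ i then z m else z (m + (j - i)), by simpa using h1, ?_, ?_, ?_⟩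
    · by_cases hc : n - (j - i) ≤ i
      · simp only [hc, if_true]
        have : n - (j - i) = i := by omega
        rw [this, he, show j = n by omega]; exact h2
      · simp only [hc, if_false]
        rwa [show n - (j - i) + (j - i) = n by omega]
    · intro m hm
      dsimp only
      split_ifs
      · exact h3 _ (by omega)
      · exact h3 _ (by omega)
    · intro m hm
      rcases lt_trichotomy m i with hc | hc | hc
      · simp only [show m ≤ i by omega, show m + 1 ≤ i by omega, if_true]
        exact h4 m (by omega)
      · subst hc
        simp only [le_refl, if_true, show ¬ (m + 1 ≤ m) by omega, if_false]
        obtain ⟨k, hk⟩ := h4 j (by omega)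
        exact ⟨k, by rw [show m + 1 + (j - m) = j + 1 by omega, hk, he]⟩
      · simp only [show ¬ m ≤ i by omega, show ¬ m + 1 ≤ i by omega, if_false]
        obtain ⟨k, hk⟩ := h4 (m + (j - i)) (by omega)
        exact ⟨k, by rw [← hk]; congr 1; omega⟩

/-- lattice floor -/
noncomputable def fl (x : ℝ × ℝ) : Pt := (⌊x.1⌋, ⌊x.2⌋)
/-- lattice embedding -/
def emb (z : Pt) : ℝ × ℝ := ((z.1 : ℝ), (z.2 : ℝ))

theorem dist_le_iff' (x y : ℝ × ℝ) (r : ℝ) : dist x y ≤ r ↔ |x.1 - y.1| ≤ r ∧ |x.2 - y.2| ≤ r := by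
  rw [Prod.dist_eq, max_le_iff, Real.dist_eq, Real.dist_eq]

theorem dist_fl (x : ℝ × ℝ) : dist (emb (fl x)) x ≤ 1 := by
  rw [dist_le_iff']
  have a1 := Int.floor_le x.1
  have a2 := Int.lt_floor_add_one x.1
  have b1 := Int.floor_le x.2
  have b2 := Int.lt_floor_add_one x.2
  simp only [emb, fl, abs_le]
  constructor <;> constructor <;> linarith

/-- lattice neighbourhood of a curve -/
def Sn (γ : ℝ → ℝ × ℝ) : Set Pt := {z | ∃ t ∈ Set.Icc (0:ℝ) 1, dist (emb z) (γ t) ≤ 2}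

theorem lk_step (γ : ℝ → ℝ × ℝ) (s t : ℝ) (hs : s ∈ Set.Icc (0:ℝ) 1) (ht : t ∈ Set.Icc (0:ℝ) 1)
    (h : dist (γ s) (γ t) ≤ 1 / 2) : Relation.ReflTransGen (Lk (Sn γ)) (fl (γ s)) (fl (γ t)) := by
  have hst := h
  rw [dist_le_iff'] at h
  obtain ⟨h1, h2⟩ := h
  set x := γ s with hx
  set y := γ t with hy
  have key : ∀ u v : ℝ, |u - v| ≤ 1 / 2 → ⌊v⌋ = ⌊u⌋ ∨ ⌊v⌋ = ⌊u⌋ + 1 ∨ ⌊v⌋ = ⌊u⌋ - 1 := by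
    intro u v huv
    rw [abs_le] at huv
    have a1 := Int.floor_le u
    have a2 := Int.lt_floor_add_one u
    have b1 := Int.floor_le v
    have b2 := Int.lt_floor_add_one v
    have c1 : (⌊v⌋ : ℝ) < ⌊u⌋ + 2 := by linarith
    have c2 : (⌊u⌋ : ℝ) < ⌊v⌋ + 2 := by linarith
    have c1 : ⌊v⌋ < ⌊u⌋ + 2 := by exact_mod_cast c1
    have c2 : ⌊u⌋ < ⌊v⌋ + 2 := by exact_mod_cast c2
    omega
  have mid : (⌊y.1⌋, ⌊x.2⌋) ∈ Sn γ := by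
    refine ⟨s, hs, ?_⟩
    rw [← hx, dist_le_iff']
    have a1 := Int.floor_le y.1
    have a2 := Int.lt_floor_add_one y.1
    have b1 := Int.floor_le x.2
    have b2 := Int.lt_floor_add_one x.2
    rw [abs_le] at h1
    simp only [emb, abs_le]
    constructor <;> constructor <;> linarith
  have fin : fl y ∈ Sn γ := ⟨t, ht, by rw [← hy]; linarith [dist_fl y]⟩
  have s1 : Relation.ReflTransGen (Lk (Sn γ)) (fl x) (⌊y.1⌋, ⌊x.2⌋) := by
    rcases key _ _ h1 with h | h | h
    · rw [h]; exact Relation.ReflTransGen.refl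
    · exact Relation.ReflTransGen.single ⟨mid, 0, by simp [h, fl, ev]⟩
    · exact Relation.ReflTransGen.single ⟨mid, 2, by simp [h, fl, ev]; ring⟩
  have s2 : Relation.ReflTransGen (Lk (Sn γ)) (⌊y.1⌋, ⌊x.2⌋) (fl y) := by
    rcases key _ _ h2 with h | h | h
    · rw [← h]; exact Relation.ReflTransGen.refl
    · exact Relation.ReflTransGen.single ⟨fin, 1, by simp [h, fl, ev]⟩
    · exact Relation.ReflTransGen.single ⟨fin, 3, by simp [h, fl, ev]; ring⟩
  exact s1.trans s2

theorem lk_curve (γ : ℝ → ℝ × ℝ) (hc : ContinuousOn γ (Set.Icc 0 1)) :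
    Relation.ReflTransGen (Lk (Sn γ)) (fl (γ 0)) (fl (γ 1)) := by
  have hu : UniformContinuousOn γ (Set.Icc 0 1) := isCompact_Icc.uniformContinuousOn_of_continuous hc
  rw [Metric.uniformContinuousOn_iff] at hu
  obtain ⟨δ, hδ, hu⟩ := hu (1 / 2) (by norm_num)
  obtain ⟨M, hM⟩ := exists_nat_one_div_lt hδ
  have hM0 : (0 : ℝ) < (M : ℝ) + 1 := by positivity
  have main : ∀ i : ℕ, i ≤ M + 1 → Relation.ReflTransGen (Lk (Sn γ)) (fl (γ 0)) (fl (γ (i / ((M : ℝ) + 1)))) := by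
    intro i
    induction i with
    | zero => intro _; simp; exact Relation.ReflTransGen.refl
    | succ i ih =>
      intro hi
      refine (ih (by omega)).trans ?_
      have hi' : (i : ℝ) + 1 ≤ M + 1 := by exact_mod_cast hi
      have m1 : (i / ((M : ℝ) + 1)) ∈ Set.Icc (0:ℝ) 1 := ⟨by positivity, by rw [div_le_one hM0]; linarith⟩
      have m2 : (((i + 1 : ℕ) : ℝ) / ((M : ℝ) + 1)) ∈ Set.Icc (0:ℝ) 1 :=
        ⟨by positivity, by rw [div_le_one hM0]; push_cast; linarith⟩
      apply lk_step γ _ _ m1 m2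
      apply le_of_lt
      apply hu _ m1 _ m2
      rw [Real.dist_eq, ← sub_div]
      push_cast
      rw [show (i : ℝ) - (i + 1) = -1 by ring, abs_div, abs_neg, abs_one, abs_of_pos hM0]
      exact hM
  have := main (M + 1) le_rfl
  push_cast at this
  rwa [div_self hM0.ne'] at this

end BCN

namespace BCN
open Equiv Equiv.Perm Finset

/-- topological plane drawing of a multigraph, with simple-closed-type conditions only between
different segments -/
structure TD (Λ Seg : Type) where
  pt : Λ → ℝ × ℝ
  pt_inj : Function.Injective pt
  γ : Seg → ℝ → ℝ × ℝ
  cont : ∀ s, ContinuousOn (γ s) (Set.Icc 0 1)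
  p : Seg → Λ
  q : Seg → Λ
  pq : ∀ s, p s ≠ q s
  γ0 : ∀ s, γ s 0 = pt (p s)
  γ1 : ∀ s, γ s 1 = pt (q s)
  av : ∀ s, ∀ t ∈ Set.Ioo (0:ℝ) 1, ∀ l, γ s t ≠ pt l
  dis : ∀ s s', ∀ t ∈ Set.Ioo (0:ℝ) 1, ∀ t' ∈ Set.Ioo (0:ℝ) 1, γ s t = γ s' t' → s = s'

theorem InSq.step {R : ℕ} {c z : Pt} (h : InSq R c z) (k : Fin 4) : InSq (R + 1) c (z + ev k) := by
  obtain ⟨q1, q2⟩ := h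
  obtain ⟨x, y⟩ := z
  rw [abs_le] at q1 q2
  fin_cases k <;> simp [InSq, ev, abs_le] at * <;> omega

theorem grid_of_scaled {Λ Seg : Type} (T : TD Λ Seg) (r : ℝ) (hr : 10 ≤ r)
    (h1 : ∀ l l', l ≠ l' → 10 * r ≤ dist (T.pt l) (T.pt l'))
    (h2 : ∀ s l, l ≠ T.p s → l ≠ T.q s → ∀ t ∈ Set.Icc (0:ℝ) 1, 10 * r ≤ dist (T.γ s t) (T.pt l))
    (h3 : ∀ s s', s ≠ s' → ∀ t ∈ Set.Icc (0:ℝ) 1, ∀ t' ∈ Set.Icc (0:ℝ) 1,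
      (∀ l, r ≤ dist (T.γ s t) (T.pt l)) → (∀ l, r ≤ dist (T.γ s' t') (T.pt l)) →
      10 ≤ dist (T.γ s t) (T.γ s' t')) :
    ∃ g : GD Λ Seg, g.p = T.p ∧ g.q = T.q := by
  classical
  let c : Λ → Pt := fun l => fl (T.pt l)
  obtain ⟨R, hR1, hR2⟩ : ∃ R : ℕ, (R : ℝ) ≤ 2 * r ∧ 2 * r < R + 1 :=
    ⟨⌊2 * r⌋₊, Nat.floor_le (by linarith), Nat.lt_floor_add_one _⟩
  have hsq : ∀ (Q : ℕ) (l : Λ) (z : Pt), InSq Q (c l) z → dist (emb z) (T.pt l) ≤ Q + 1 := by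
    intro Q l z ⟨hz1, hz2⟩
    have e1 : dist (emb z) (emb (c l)) ≤ Q := by
      rw [dist_le_iff']; simp only [emb]
      constructor <;> exact_mod_cast (by assumption)
    have e2 := dist_fl (T.pt l)
    have := dist_triangle (emb z) (emb (c l)) (T.pt l)
    linarith
  have hnsq : ∀ (l : Λ) (z : Pt), ¬ InSq R (c l) z → 2 * r - 1 ≤ dist (emb z) (T.pt l) := by
    intro l z hz
    have e1 : (R : ℝ) + 1 ≤ dist (emb z) (emb (c l)) := by
      by_contra hc
      push Not at hc
      apply hz
      have := (dist_le_iff' _ _ _).1 (le_refl (dist (emb z) (emb (c l))))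
      simp only [emb] at this hc
      have f1 := lt_of_le_of_lt this.1 hc
      have f2 := lt_of_le_of_lt this.2 hc
      have f1 : |z.1 - (c l).1| < R + 1 := by exact_mod_cast f1
      have f2 : |z.2 - (c l).2| < R + 1 := by exact_mod_cast f2
      exact ⟨by omega, by omega⟩
    have e2 := dist_fl (T.pt l)
    have := dist_triangle (emb z) (T.pt l) (emb (c l))
    rw [dist_comm (T.pt l)] at this
    change dist (emb (c l)) (T.pt l) ≤ 1 at e2
    linarith
  have hsep : ∀ l l' z, InSq (R + 1) (c l) z → InSq R (c l') z → l = l' := by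
    intro l l' z hz hz'
    by_contra hne
    have e1 := hsq _ _ _ hz
    have e2 := hsq _ _ _ hz'
    have e3 := h1 l l' hne
    have := dist_triangle_left (T.pt l) (T.pt l') (emb z)
    push_cast at e1
    linarith
  have hfl : ∀ l, InSq R (c l) (c l) := fun l => by simp [InSq]
  have hw : ∀ s, ∃ n z, Wk (Sn (T.γ s)) {x | InSq R (c (T.p s)) x} {x | InSq R (c (T.q s)) x} n z := by
    intro s
    have h0 : fl (T.γ s 0) ∈ Sn (T.γ s) := ⟨0, by simp, by linarith [dist_fl (T.γ s 0)]⟩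
    obtain ⟨n, z, a1, a2, a3⟩ := wk_of_refl h0 (lk_curve (T.γ s) (T.cont s))
    refine ⟨n, z, ?_, ?_, a3⟩
    · rw [Set.mem_singleton_iff.1 a1, T.γ0]; exact hfl _
    · rw [Set.mem_singleton_iff.1 a2, T.γ1]; exact hfl _
  choose n z hz hz1 hz2 using fun s => min_walk (hw s)
  have hk : ∀ s i, ∃ k, i < n s → z s (i + 1) = z s i + ev k := by
    intro s i
    by_cases h : i < n s
    · obtain ⟨k, hk⟩ := (hz s).2.2.2 i h
      exact ⟨k, fun _ => hk⟩
    · exact ⟨0, fun h' => absurd h' h⟩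
  choose k hk using hk
  have hout : ∀ s i, 0 < i → i < n s → ∀ l, ¬ InSq R (c l) (z s i) := by
    intro s i hi hin l hl
    obtain ⟨t, ht, hd⟩ := (hz s).2.2.1 i hin.le
    have := hz1 s i hi hin
    have hp : l ≠ T.p s := by rintro rfl; exact this.1 hl
    have hq : l ≠ T.q s := by rintro rfl; exact this.2 hl
    have e1 := h2 s l hp hq t ht
    have e2 := hsq _ _ _ hl
    have := dist_triangle_left (T.γ s t) (T.pt l) (emb (z s i))
    linarith
  have hfar : ∀ s i, 0 < i → i < n s → ∃ t ∈ Set.Icc (0:ℝ) 1, dist (emb (z s i)) (T.γ s t) ≤ 2 ∧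
      ∀ l, r ≤ dist (T.γ s t) (T.pt l) := by
    intro s i hi hin
    obtain ⟨t, ht, hd⟩ := (hz s).2.2.1 i hin.le
    refine ⟨t, ht, hd, fun l => ?_⟩
    have e1 := hnsq l _ (hout s i hi hin l)
    have := dist_triangle (emb (z s i)) (T.γ s t) (T.pt l)
    linarith
  refine ⟨⟨c, R, T.p, T.q, T.pq, hsep, n, ?_, z, k, hk, fun s => (hz s).1, fun s => (hz s).2.1, hout, ?_⟩, rfl, rfl⟩
  · intro s
    have hA := (hz s).1
    have hB := (hz s).2.1
    by_contra hc
    have : n s = 0 ∨ n s = 1 := by omega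
    rcases this with h0 | h0
    · rw [h0] at hB
      exact T.pq s (hsep _ _ _ (InSq.succ hA) hB)
    · rw [h0] at hB
      have hs := hk s 0 (by omega)
      rw [zero_add] at hs
      apply T.pq s (hsep _ _ (z s 1) ?_ hB)
      rw [hs]
      exact InSq.step hA _
  · intro s i s' j hi hin hj hjn he
    have hs : s = s' := by
      by_contra hne
      obtain ⟨t, ht, hd, hf⟩ := hfar s i hi hin
      obtain ⟨t', ht', hd', hf'⟩ := hfar s' j hj hjn
      have e1 := h3 s s' hne t ht t' ht' hf hf'
      rw [← he] at hd'
      have := dist_triangle_left (T.γ s t) (T.γ s' t') (emb (z s i))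
      linarith
    subst hs
    refine ⟨rfl, ?_⟩
    rcases lt_trichotomy i j with h | h | h
    · exact absurd he (hz2 s i j h hjn.le)
    · exact h
    · exact absurd he.symm (hz2 s j i h hin.le)

/-- rescaling -/
def TD.scale {Λ Seg : Type} (T : TD Λ Seg) (N : ℝ) (hN : 0 < N) : TD Λ Seg where
  pt l := N • T.pt l
  pt_inj := fun a b h => T.pt_inj (smul_right_injective _ hN.ne' h)
  γ s t := N • T.γ s t
  cont s := (T.cont s).const_smul N
  p := T.p
  q := T.q
  pq := T.pq
  γ0 s := by rw [T.γ0]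
  γ1 s := by rw [T.γ1]
  av s t ht l h := T.av s t ht l (smul_right_injective _ hN.ne' h)
  dis s s' t ht t' ht' h := T.dis s s' t ht t' ht' (smul_right_injective _ hN.ne' h)

theorem dist_pos_of_compact {A B : Set (ℝ × ℝ)} (hA : IsCompact A) (hB : IsCompact B) (h : Disjoint A B) :
    ∃ δ > 0, ∀ a ∈ A, ∀ b ∈ B, δ ≤ dist a b := by
  obtain ⟨δ, hδ, h⟩ := Metric.exists_pos_forall_lt_edist hA hB.isClosed h
  refine ⟨δ, hδ, fun a ha b hb => ?_⟩
  have := h a ha b hb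
  rw [edist_nndist] at this
  have : δ < nndist a b := by exact_mod_cast this
  exact this.le

theorem fin_pos {ι : Type} [Finite ι] (P : ι → ℝ → Prop) (hP : ∀ i, ∃ δ > 0, P i δ)
    (hm : ∀ i δ δ', 0 < δ' → δ' ≤ δ → P i δ → P i δ') : ∃ δ > 0, ∀ i, P i δ := by
  classical
  have := Fintype.ofFinite ι
  choose δ h1 h2 using hP
  rcases isEmpty_or_nonempty ι with hι | hι
  · exact ⟨1, one_pos, fun i => isEmptyElim i⟩
  · obtain ⟨i0, hi0⟩ := Finite.exists_min δ
    exact ⟨δ i0, h1 i0, fun i => hm i _ _ (h1 i0) (hi0 i) (h2 i)⟩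

theorem TD.grid {Λ Seg : Type} [Finite Λ] [Finite Seg] (T : TD Λ Seg) :
    ∃ g : GD Λ Seg, g.p = T.p ∧ g.q = T.q := by
  classical
  have him : ∀ s, IsCompact (T.γ s '' Set.Icc 0 1) := fun s => isCompact_Icc.image_of_continuousOn (T.cont s)
  obtain ⟨r1, hr1, h1⟩ := fin_pos (ι := Λ × Λ) (fun x δ => x.1 ≠ x.2 → δ ≤ dist (T.pt x.1) (T.pt x.2))
    (fun x => by
      by_cases h : x.1 = x.2
      · exact ⟨1, one_pos, fun h' => absurd h h'⟩
      · exact ⟨_, dist_pos.2 (fun h' => h (T.pt_inj h')), fun _ => le_rfl⟩)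
    (fun x δ δ' _ h h' h'' => h.trans (h' h''))
  have hicc : ∀ t ∈ Set.Icc (0:ℝ) 1, t = 0 ∨ t = 1 ∨ t ∈ Set.Ioo (0:ℝ) 1 := by
    intro t ht
    rcases eq_or_lt_of_le ht.1 with h | h
    · exact Or.inl h.symm
    · rcases eq_or_lt_of_le ht.2 with h' | h'
      · exact Or.inr (Or.inl h')
      · exact Or.inr (Or.inr ⟨h, h'⟩)
  obtain ⟨r2, hr2, h2⟩ := fin_pos (ι := Seg × Λ)
    (fun x δ => x.2 ≠ T.p x.1 → x.2 ≠ T.q x.1 → ∀ t ∈ Set.Icc (0:ℝ) 1, δ ≤ dist (T.γ x.1 t) (T.pt x.2))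
    (fun x => by
      obtain ⟨s, l⟩ := x
      by_cases h : l ≠ T.p s ∧ l ≠ T.q s
      · obtain ⟨δ, hδ, hh⟩ := dist_pos_of_compact (him s) (isCompact_singleton (x := T.pt l)) (by
          rw [Set.disjoint_singleton_right]
          rintro ⟨t, ht, he⟩
          rcases hicc t ht with rfl | rfl | ht
          · rw [T.γ0] at he; exact h.1 (T.pt_inj he).symm
          · rw [T.γ1] at he; exact h.2 (T.pt_inj he).symm
          · exact T.av s t ht l he)
        exact ⟨δ, hδ, fun _ _ t ht => hh _ ⟨t, ht, rfl⟩ _ rfl⟩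
      · exact ⟨1, one_pos, fun a b => absurd ⟨a, b⟩ h⟩)
    (fun x δ δ' _ h h' a b t ht => h.trans (h' a b t ht))
  obtain ⟨r, hr, hrr1, hrr2⟩ : ∃ r > 0, 10 * r ≤ r1 ∧ 10 * r ≤ r2 :=
    ⟨min r1 r2 / 10, by positivity, by linarith [min_le_left r1 r2], by linarith [min_le_right r1 r2]⟩
  have hK : ∀ s, IsCompact (T.γ s '' Set.Icc 0 1 ∩ ⋂ l, {x | r ≤ dist x (T.pt l)}) := by
    intro s
    apply (him s).inter_right
    apply isClosed_iInter
    intro l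
    exact isClosed_le continuous_const (continuous_id.dist continuous_const)
  obtain ⟨δ, hδ, h3⟩ := fin_pos (ι := Seg × Seg) (fun x δ => x.1 ≠ x.2 →
      ∀ a ∈ (T.γ x.1 '' Set.Icc 0 1 ∩ ⋂ l, {x | r ≤ dist x (T.pt l)}),
      ∀ b ∈ (T.γ x.2 '' Set.Icc 0 1 ∩ ⋂ l, {x | r ≤ dist x (T.pt l)}), δ ≤ dist a b)
    (fun x => by
      obtain ⟨s, s'⟩ := x
      by_cases h : s = s'
      · exact ⟨1, one_pos, fun h' => absurd h h'⟩
      · obtain ⟨δ, hδ, hh⟩ := dist_pos_of_compact (hK s) (hK s') (by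
          have inner : ∀ s x, x ∈ (T.γ s '' Set.Icc 0 1 ∩ ⋂ l, {x | r ≤ dist x (T.pt l)}) →
              ∃ t ∈ Set.Ioo (0:ℝ) 1, T.γ s t = x := by
            rintro s x ⟨⟨t, ht, rfl⟩, hx⟩
            rw [Set.mem_iInter] at hx
            rcases hicc t ht with rfl | rfl | ht
            · have := hx (T.p s)
              rw [T.γ0] at this; simp at this; linarith
            · have := hx (T.q s)
              rw [T.γ1] at this; simp at this; linarith
            · exact ⟨t, ht, rfl⟩
          rw [Set.disjoint_left]
          intro x hx hx'
          obtain ⟨t, ht, e⟩ := inner s x hx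
          obtain ⟨t', ht', e'⟩ := inner s' x hx'
          exact h (T.dis s s' t ht t' ht' (e.trans e'.symm)))
        exact ⟨δ, hδ, fun _ => hh⟩)
    (fun x δ δ' _ h h' a b hb c hc => h.trans (h' a b hb c hc))
  obtain ⟨N, hN, hN1, hN2⟩ : ∃ N : ℝ, 0 < N ∧ 10 ≤ N * r ∧ 10 ≤ N * δ := by
    refine ⟨10 / r + 10 / δ, by positivity, ?_, ?_⟩
    · rw [add_mul, div_mul_cancel₀ _ hr.ne']
      have : 0 < 10 / δ * r := by positivity
      linarith
    · rw [add_mul, div_mul_cancel₀ _ hδ.ne']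
      have : 0 < 10 / r * δ := by positivity
      linarith
  have hds : ∀ x y : ℝ × ℝ, dist (N • x) (N • y) = N * dist x y := by
    intro x y
    rw [dist_smul₀, Real.norm_of_nonneg hN.le]
  apply grid_of_scaled (T.scale N hN) (N * r) hN1
  · intro l l' hne
    change _ ≤ dist (N • _) (N • _)
    rw [hds]
    have := h1 (l, l') hne
    calc 10 * (N * r) = N * (10 * r) := by ring
      _ ≤ _ := by
        apply mul_le_mul_of_nonneg_left _ hN.le
        exact hrr1.trans this
  · intro s l hp hq t ht
    change _ ≤ dist (N • _) (N • _)
    rw [hds]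
    have := h2 (s, l) hp hq t ht
    calc 10 * (N * r) = N * (10 * r) := by ring
      _ ≤ _ := by
        apply mul_le_mul_of_nonneg_left _ hN.le
        exact hrr2.trans this
  · intro s s' hne t ht t' ht' a b
    change _ ≤ dist (N • _) (N • _)
    rw [hds]
    have ha : ∀ l, r ≤ dist (T.γ s t) (T.pt l) := by
      intro l
      have := a l
      change _ ≤ dist (N • _) (N • _) at this
      rw [hds] at this
      exact le_of_mul_le_mul_left this hN
    have hb : ∀ l, r ≤ dist (T.γ s' t') (T.pt l) := by
      intro l
      have := b l
      change _ ≤ dist (N • _) (N • _) at this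
      rw [hds] at this
      exact le_of_mul_le_mul_left this hN
    refine hN2.trans (mul_le_mul_of_nonneg_left ?_ hN.le)
    exact h3 (s, s') hne _ ⟨⟨t, ht, rfl⟩, by simpa using ha⟩ _ ⟨⟨t', ht', rfl⟩, by simpa using hb⟩

open Classical in
theorem TD.cert {Λ Seg : Type} [Finite Λ] [Fintype Seg] (T : TD Λ Seg) :
    ∃ σ : Perm (Seg × Bool), (∀ d, labP T.p T.q (σ d) = labP T.p T.q d) ∧
    (∀ d d', labP T.p T.q d = labP T.p T.q d' → σ.SameCycle d d') ∧
    Cert (flipP Seg) (σ⁻¹ * flipP Seg) (labP T.p T.q) := by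
  obtain ⟨g, h1, h2⟩ := T.grid
  rw [← h1, ← h2]
  exact g.cert
end BCN

namespace BCN
open Equiv Equiv.Perm Finset

section smooth
variable {D Λ : Type} (α σ : Perm D) (π : D → D) (tc : D → Prop)

open Classical in
/-- step back over a touching node -/
noncomputable def bk (d : D) : D := if tc d then α (π d) else d
noncomputable def qq (d : D) : D := bk α π tc (bk α π tc d)

structure Smooth : Prop where
  αα : ∀ d, α (α d) = d
  tπ : ∀ d, tc d → tc (π d)
  ππ : ∀ d, tc d → π (π d) = d
  tσ : ∀ d, tc (σ d) ↔ tc d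
  tw : ∀ d, tc d → σ d = π d ∨ σ (π d) = d
  q : ∀ d, ¬ tc (qq α π tc d)

variable {α σ π tc}

theorem Smooth.bk_of_not (S : Smooth α σ π tc) {d : D} (h : ¬ tc d) : bk α π tc d = d := by simp [bk, h]
theorem Smooth.qq_of_not (S : Smooth α σ π tc) {d : D} (h : ¬ tc d) : qq α π tc d = d := by
  rw [qq, S.bk_of_not h, S.bk_of_not h]
theorem Smooth.qbk (S : Smooth α σ π tc) (d : D) : qq α π tc (bk α π tc d) = qq α π tc d := by
  change bk α π tc (qq α π tc d) = _
  rw [S.bk_of_not (S.q d)]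
theorem Smooth.qπ (S : Smooth α σ π tc) {d : D} (h : tc d) : qq α π tc (π d) = qq α π tc (α d) := by
  rw [← S.qbk (π d)]
  simp only [bk]
  rw [if_pos (S.tπ d h), S.ππ d h]
theorem Smooth.qαb (S : Smooth α σ π tc) (d : D) : qq α π tc (α (bk α π tc d)) = qq α π tc (α d) := by
  by_cases h : tc d
  · rw [bk, if_pos h, S.αα, S.qπ h]
  · rw [S.bk_of_not h]
theorem Smooth.qαq (S : Smooth α σ π tc) (d : D) : qq α π tc (α (qq α π tc d)) = qq α π tc (α d) := by
  change qq α π tc (α (bk α π tc (bk α π tc d))) = _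
  rw [S.qαb, S.qαb]

noncomputable def Smooth.α' (S : Smooth α σ π tc) : Perm {d : D // ¬ tc d} where
  toFun x := ⟨qq α π tc (α x.1), S.q _⟩
  invFun x := ⟨qq α π tc (α x.1), S.q _⟩
  left_inv x := by ext; simp only; rw [S.qαq, S.αα, S.qq_of_not x.2]
  right_inv x := by ext; simp only; rw [S.qαq, S.αα, S.qq_of_not x.2]

theorem Smooth.α'_val (S : Smooth α σ π tc) (x : {d : D // ¬ tc d}) : (S.α' x).1 = qq α π tc (α x.1) := rfl

theorem Smooth.alpha_alpha (S : Smooth α σ π tc) (x : {d : D // ¬ tc d}) : S.α' (S.α' x) = x := S.α'.left_inv x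

noncomputable def Smooth.σ' (S : Smooth α σ π tc) : Perm {d : D // ¬ tc d} :=
  σ.subtypePerm (fun d => by rw [S.tσ])

theorem Smooth.σ'_val (S : Smooth α σ π tc) (x : {d : D // ¬ tc d}) : (S.σ' x).1 = σ x.1 := rfl

theorem Smooth.σ'_inv_val (S : Smooth α σ π tc) (x : {d : D // ¬ tc d}) : σ (S.σ'⁻¹ x).1 = x.1 := by
  rw [← S.σ'_val]; simp

open Classical in
theorem Smooth.cert (S : Smooth α σ π tc) {Λ' : Type} [Fintype D] (lab : D → Λ) (lab' : {d : D // ¬ tc d} → Λ')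
    (hl : ∀ l, (∀ d, lab d = l → tc d) ∨ (∀ d, lab d = l → ¬ tc d))
    (hl' : ∀ x y, lab' x = lab' y ↔ lab x.1 = lab y.1)
    (hlπ : ∀ d, tc d → lab (π d) = lab d) (hne : ∀ d, tc d → π d ≠ d)
    (hc : Cert α (σ⁻¹ * α) lab) : Cert S.α' (S.σ'⁻¹ * S.α') lab' := by
  intro C' hC' hs'
  let C : D → ZMod 2 := fun d => C' ⟨qq α π tc d, S.q d⟩
  have hq : ∀ d e, qq α π tc d = qq α π tc e → C d = C e := by
    intro d e h; simp only [C]; congr 2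
  have hCα : ∀ d, C (α d) = C d := by
    intro d
    have := hC' ⟨qq α π tc d, S.q d⟩
    simp only [C]
    rw [← this]
    congr 1
    ext
    rw [S.α'_val, S.qαq]
  have hCπ : ∀ d, tc d → C (π d) = C d := by
    intro d h
    rw [← hCα d]; exact hq _ _ (S.qπ h)
  have hCn : ∀ d (h : ¬ tc d), C d = C' ⟨d, h⟩ := by
    intro d h
    simp only [C]; congr 2; exact S.qq_of_not h
  obtain ⟨w, hw1, hw2⟩ := hc C hCα (by
    intro l
    rcases hl l with h | h
    · apply Finset.sum_involution (fun d _ => π d)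
      · intro d hd
        rw [hCπ d (h d (by simpa using hd)), z2_add_self]
      · intro d hd _
        exact hne d (h d (by simpa using hd))
      · intro d hd
        have hd : lab d = l := by simpa using hd
        simp [hlπ d (h d hd), hd]
      · intro d hd
        exact S.ππ d (h d (by simpa using hd))
    · by_cases hex : ∃ x : {d : D // ¬ tc d}, lab x.1 = l
      · obtain ⟨x0, hx0⟩ := hex
        rw [← hs' (lab' x0)]
        symm
        apply Finset.sum_bij (fun (x : {d : D // ¬ tc d}) _ => x.1)
        · intro x hx
          have : lab' x = lab' x0 := by simpa using hx
          simp [(hl' _ _).1 this, hx0]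
        · intro x _ y _ hxy
          exact Subtype.ext hxy
        · intro d hd
          have hd : lab d = l := by simpa using hd
          refine ⟨⟨d, h d hd⟩, ?_, rfl⟩
          simp [hl', hd, hx0]
        · intro x _
          exact (hCn x.1 x.2).symm
      · apply Finset.sum_eq_zero
        intro d hd
        have hd : lab d = l := by simpa using hd
        exact absurd ⟨⟨d, h d hd⟩, hd⟩ hex)
  have hσ : ∀ y, w (σ⁻¹ y) = w (α y) := by
    intro y
    have := hw1 (α y)
    rwa [Equiv.Perm.mul_apply, S.αα] at this
  have hπ : ∀ d, tc d → w (π d) = w (α d) := by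
    intro d h
    rcases S.tw d h with h1 | h1
    · have e1 := hσ (π d)
      rw [← h1] at e1
      have e2 := hw2 (π d)
      have e3 := hw2 d
      rw [hCπ d h] at e2
      rw [h1] at e1
      have e4 : σ⁻¹ (π d) = d := by rw [← h1]; simp
      rw [e4] at e1
      rw [← e1, ← e3] at e2
      revert e2
      generalize w (π d) = a1
      generalize w d = a2
      generalize w (α d) = a3
      revert a1 a2 a3; decide
    · have := hσ d
      rw [show σ⁻¹ d = π d by rw [Equiv.Perm.inv_eq_iff_eq]; exact h1.symm] at this
      exact this
  have hαb : ∀ d, w (α (bk α π tc d)) = w (α d) := by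
    intro d
    by_cases h : tc d
    · rw [bk, if_pos h, S.αα, hπ d h]
    · rw [S.bk_of_not h]
  have hαq : ∀ d, w (α (qq α π tc d)) = w (α d) := by
    intro d
    rw [qq, hαb, hαb]
  have hwq : ∀ d, w (qq α π tc d) = w d := by
    intro d
    have e1 := hw2 d
    have e2 := hw2 (qq α π tc d)
    rw [hαq, hq (qq α π tc d) d (S.qq_of_not (S.q d)), ← e1] at e2
    exact add_right_cancel e2
  refine ⟨fun x => w x.1, ?_, ?_⟩
  · intro x
    have h1 := S.σ'_inv_val (S.α' x)
    have h2 : (S.σ'⁻¹ (S.α' x)).1 = σ⁻¹ (S.α' x).1 := by rw [← h1]; simp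
    simp only [Equiv.Perm.mul_apply]
    rw [h2, hσ, S.α'_val, hαq, S.αα]
  · intro x
    simp only
    rw [S.α'_val, hwq, hw2, hCn x.1 x.2]
end smooth
end BCN

namespace BCN
open Equiv Equiv.Perm Finset

open Classical in
/-- combinatorial record of a drawing in which every edge has at most two crossings -/
structure CD (V E IP D : Type) [Fintype E] [Fintype D] where
  W : Finset V
  col : V → Bool
  a : E → V
  b : E → V
  aW : ∀ e, a e ∈ W
  bW : ∀ e, b e ∈ W
  col_ne : ∀ e, col (a e) ≠ col (b e)
  simp1 : ∀ e f, a e = a f → b e = b f → e = f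
  simp2 : ∀ e f, a e = b f → b e = a f → e = f
  x : E → ℕ
  ip : E → ℕ → IP
  ip_inj : ∀ e i j, 0 < i → i ≤ x e → 0 < j → j ≤ x e → ip e i = ip e j → i = j
  nonadj : ∀ e f i j, e ≠ f → 0 < i → i ≤ x e → 0 < j → j ≤ x f → ip e i = ip f j →
    a e ≠ a f ∧ a e ≠ b f ∧ b e ≠ a f ∧ b e ≠ b f
  once : ∀ e f i j i' j', e ≠ f → 0 < i → i ≤ x e → 0 < j → j ≤ x f → ip e i = ip f j →
    0 < i' → i' ≤ x e → 0 < j' → j' ≤ x f → ip e i' = ip f j' → i = i'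
  m23 : ∀ e i, 0 < i → i ≤ x e →
    (univ.filter fun e' => ∃ j, 0 < j ∧ j ≤ x e' ∧ ip e' j = ip e i).card = 2 ∨
    (univ.filter fun e' => ∃ j, 0 < j ∧ j ≤ x e' ∧ ip e' j = ip e i).card = 3
  x2 : ∀ e, x e ≤ 2
  Y1 : ∀ e i, 0 < i → i ≤ x e →
    (univ.filter fun e' => ∃ j, 0 < j ∧ j ≤ x e' ∧ ip e' j = ip e i).card ≠ 2 → x e = 1
  ed : D → E
  ps : D → ℕ
  dr : D → Bool
  dext : ∀ d d', ed d = ed d' → ps d = ps d' → dr d = dr d' → d = d'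
  dexT : ∀ e i, i ≤ x e → ∃ d, ed d = e ∧ ps d = i ∧ dr d = true
  dexF : ∀ e i, 0 < i → i ≤ x e + 1 → ∃ d, ed d = e ∧ ps d = i ∧ dr d = false
  dvT : ∀ d, dr d = true → ps d ≤ x (ed d)
  dvF : ∀ d, dr d = false → 0 < ps d ∧ ps d ≤ x (ed d) + 1
  α : Perm D
  edα : ∀ d, ed (α d) = ed d
  drα : ∀ d, dr (α d) = !dr d
  psT : ∀ d, dr d = true → ps (α d) = ps d + 1
  psF : ∀ d, dr d = false → ps (α d) = ps d - 1
  lab : D → V ⊕ IP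
  lab0 : ∀ d, ps d = 0 → lab d = Sum.inl (a (ed d))
  lab1 : ∀ d, ps d = x (ed d) + 1 → lab d = Sum.inl (b (ed d))
  labi : ∀ d, 0 < ps d → ps d ≤ x (ed d) → lab d = Sum.inr (ip (ed d) (ps d))
  σ : Perm D
  labσ : ∀ d, lab (σ d) = lab d
  sc : ∀ d d', lab d = lab d' → σ.SameCycle d d'
  cert : Cert α (σ⁻¹ * α) lab
  deg : ∀ d v, lab d = Sum.inl v → ∃ d', d' ≠ d ∧ lab d' = lab d

namespace CD
open Classical
variable {V E IP D : Type} [Fintype E] [Fintype D] (c : CD V E IP D)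

noncomputable def m (p : IP) : ℕ := (univ.filter fun e => ∃ i, 0 < i ∧ i ≤ c.x e ∧ c.ip e i = p).card

/-- tail end of the edge of a dart -/
def t (d : D) : V := if c.dr d then c.a (c.ed d) else c.b (c.ed d)

noncomputable def kdL : V ⊕ IP → ℕ
  | Sum.inl _ => 0
  | Sum.inr p => if c.m p = 2 then 1 else 2

noncomputable def kd (d : D) : ℕ := c.kdL (c.lab d)

def In (d : D) : Prop := 0 < c.ps d ∧ c.ps d ≤ c.x (c.ed d)

theorem αα (d : D) : c.α (c.α d) = d := by
  apply c.dext
  · rw [c.edα, c.edα]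
  · cases h : c.dr d
    · rw [c.psT _ (by rw [c.drα, h]; rfl), c.psF _ h]
      have := c.dvF d h; omega
    · rw [c.psF _ (by rw [c.drα, h]; rfl), c.psT _ h]; omega
  · rw [c.drα, c.drα]; simp

theorem cases_d (d : D) : (c.In d ∧ c.lab d = Sum.inr (c.ip (c.ed d) (c.ps d))) ∨
    (c.dr d = true ∧ c.ps d = 0 ∧ c.lab d = Sum.inl (c.t d)) ∨
    (c.dr d = false ∧ c.ps d = c.x (c.ed d) + 1 ∧ c.lab d = Sum.inl (c.t d)) := by
  by_cases hi : c.In d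
  · exact Or.inl ⟨hi, c.labi d hi.1 hi.2⟩
  · right
    cases h : c.dr d
    · right
      have := c.dvF d h
      have h1 : c.ps d = c.x (c.ed d) + 1 := by
        by_contra hc; exact hi ⟨this.1, by omega⟩
      exact ⟨rfl, h1, by rw [c.lab1 d h1]; simp [t, h]⟩
    · left
      have := c.dvT d h
      have h1 : c.ps d = 0 := by
        by_contra hc; exact hi ⟨by omega, this⟩
      exact ⟨rfl, h1, by rw [c.lab0 d h1]; simp [t, h]⟩

theorem lab_inl (d : D) (h : ¬ c.In d) : c.lab d = Sum.inl (c.t d) := by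
  rcases c.cases_d d with h1 | h1 | h1
  · exact absurd h1.1 h
  · exact h1.2.2
  · exact h1.2.2

theorem lab_inr (d : D) (h : c.In d) : c.lab d = Sum.inr (c.ip (c.ed d) (c.ps d)) := c.labi d h.1 h.2

theorem In_iff {d d' : D} (h : c.lab d = c.lab d') : c.In d ↔ c.In d' := by
  by_cases h1 : c.In d <;> by_cases h2 : c.In d'
  · simp [h1, h2]
  · rw [c.lab_inr d h1, c.lab_inl d' h2] at h; cases h
  · rw [c.lab_inl d h1, c.lab_inr d' h2] at h; cases h
  · simp [h1, h2]

theorem kd0 (d : D) : c.kd d = 0 ↔ ¬ c.In d := by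
  constructor
  · intro h hi
    rw [kd, c.lab_inr d hi, kdL] at h
    split_ifs at h
  · intro h
    rw [kd, c.lab_inl d h, kdL]

theorem exπ (d : D) : ∃ d', (c.In d → c.ed d' = c.ed d ∧ c.ps d' = c.ps d ∧ c.dr d' = !c.dr d) := by
  by_cases h : c.In d
  · cases hd : c.dr d
    · obtain ⟨d', h'⟩ := c.dexT (c.ed d) (c.ps d) h.2
      exact ⟨d', fun _ => by simpa using h'⟩
    · obtain ⟨d', h'⟩ := c.dexF (c.ed d) (c.ps d) h.1 (by have := h.2; omega)
      exact ⟨d', fun _ => by simpa using h'⟩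
  · exact ⟨d, fun h' => absurd h' h⟩

/-- opposite dart at an interior node -/
noncomputable def π (d : D) : D := (c.exπ d).choose
theorem edπ {d : D} (h : c.In d) : c.ed (c.π d) = c.ed d := ((c.exπ d).choose_spec h).1
theorem psπ {d : D} (h : c.In d) : c.ps (c.π d) = c.ps d := ((c.exπ d).choose_spec h).2.1
theorem drπ {d : D} (h : c.In d) : c.dr (c.π d) = !c.dr d := ((c.exπ d).choose_spec h).2.2
theorem Inπ {d : D} (h : c.In d) : c.In (c.π d) := by
  unfold In; rw [c.edπ h, c.psπ h]; exact h
theorem ππ {d : D} (h : c.In d) : c.π (c.π d) = d := by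
  have h' := c.Inπ h
  apply c.dext
  · rw [c.edπ h', c.edπ h]
  · rw [c.psπ h', c.psπ h]
  · rw [c.drπ h', c.drπ h]; simp
theorem πne {d : D} (h : c.In d) : c.π d ≠ d := by
  intro h'
  have := c.drπ h
  rw [h'] at this
  cases hd : c.dr d <;> rw [hd] at this <;> cases this
theorem labπ {d : D} (h : c.In d) : c.lab (c.π d) = c.lab d := by
  rw [c.lab_inr _ (c.Inπ h), c.lab_inr _ h, c.edπ h, c.psπ h]

theorem tα (d : D) : c.t (c.α d) = if c.dr d then c.b (c.ed d) else c.a (c.ed d) := by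
  unfold t; rw [c.drα, c.edα]; cases c.dr d <;> rfl
theorem tπ {d : D} (h : c.In d) : c.t (c.π d) = c.t (c.α d) := by
  rw [tα]; unfold t; rw [c.drπ h, c.edπ h]; cases c.dr d <;> rfl
theorem tαπ {d : D} (h : c.In d) : c.t (c.α (c.π d)) = c.t d := by
  rw [tα]; unfold t; rw [c.drπ h, c.edπ h]; cases c.dr d <;> rfl
theorem tne (d : D) : c.col (c.t d) ≠ c.col (c.t (c.α d)) := by
  rw [tα]; unfold t
  have := c.col_ne (c.ed d)
  cases c.dr d
  · simpa using this.symm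
  · simpa using this

/-- darts at an interior point with the same edge -/
theorem same_ed {d d' : D} (h : c.In d) (hl : c.lab d' = c.lab d) (he : c.ed d' = c.ed d) :
    d' = d ∨ d' = c.π d := by
  have h' : c.In d' := (c.In_iff hl).2 h
  rw [c.lab_inr _ h, c.lab_inr _ h', he] at hl
  have hp : c.ps d' = c.ps d := by
    refine c.ip_inj (c.ed d) _ _ h'.1 (he ▸ h'.2) h.1 h.2 (Sum.inr.inj hl)
  by_cases hd : c.dr d' = c.dr d
  · exact Or.inl (c.dext _ _ he hp hd)
  · refine Or.inr (c.dext _ _ (by rw [he, c.edπ h]) (by rw [hp, c.psπ h]) ?_)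
    rw [c.drπ h]
    cases h1 : c.dr d <;> cases h2 : c.dr d' <;> simp_all

theorem diff_ed {d d' : D} (h : c.In d) (hl : c.lab d' = c.lab d) (he : c.ed d' ≠ c.ed d) :
    c.t d ≠ c.t d' ∧ c.t d ≠ c.t (c.α d') ∧ c.t (c.α d) ≠ c.t d' ∧ c.t (c.α d) ≠ c.t (c.α d') := by
  have h' : c.In d' := (c.In_iff hl).2 h
  rw [c.lab_inr _ h, c.lab_inr _ h'] at hl
  obtain ⟨h1, h2, h3, h4⟩ := c.nonadj _ _ _ _ (Ne.symm he) h.1 h.2 h'.1 h'.2 (Sum.inr.inj hl).symm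
  rw [tα, tα]; unfold t
  cases c.dr d <;> cases c.dr d' <;> simp_all

/-- fibre of labels -/
noncomputable def F (d : D) : Finset D := univ.filter fun d' => c.lab d' = c.lab d
theorem mem_F {d d' : D} : d' ∈ c.F d ↔ c.lab d' = c.lab d := by simp [F]

theorem cycF (d : D) : c.σ.IsCycleOn (c.F d : Set D) := by
  constructor
  · refine ⟨fun x hx => ?_, c.σ.injective.injOn, fun x hx => ?_⟩
    · rw [Finset.mem_coe, mem_F] at hx ⊢
      rw [c.labσ, hx]
    · refine ⟨c.σ⁻¹ x, ?_, by simp⟩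
      rw [Finset.mem_coe, mem_F] at hx ⊢
      rw [← c.labσ]; simpa using hx
  · intro x hx y hy
    rw [Finset.mem_coe, mem_F] at hx hy
    exact c.sc _ _ (hx.trans hy.symm)

theorem cardF {d : D} (h : c.In d) : (c.F d).card = 2 * c.m (c.ip (c.ed d) (c.ps d)) := by
  set p := c.ip (c.ed d) (c.ps d) with hp
  have : (c.F d).card = ((univ.filter fun e => ∃ i, 0 < i ∧ i ≤ c.x e ∧ c.ip e i = p) ×ˢ
      (univ : Finset Bool)).card := by
    apply Finset.card_bij (fun d' _ => (c.ed d', c.dr d'))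
    · intro d' hd'
      rw [mem_F] at hd'
      have h' := (c.In_iff hd').2 h
      rw [c.lab_inr _ h, c.lab_inr _ h'] at hd'
      simp only [mem_product, mem_filter, mem_univ, true_and, and_true]
      exact ⟨_, h'.1, h'.2, Sum.inr.inj hd'⟩
    · intro x hx y hy hxy
      rw [mem_F] at hx hy
      rw [Prod.mk.injEq] at hxy
      have hy' := (c.In_iff hy).2 h
      rcases c.same_ed hy' (hx.trans hy.symm) hxy.1 with h1 | h1
      · exact h1
      · have := c.drπ hy'
        rw [← h1, hxy.2] at this
        cases hd : c.dr y <;> rw [hd] at this <;> cases this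
    · rintro ⟨e, b⟩ hb
      simp only [mem_product, mem_filter, mem_univ, true_and, and_true] at hb
      obtain ⟨i, h1, h2, h3⟩ := hb
      have : ∃ d', c.ed d' = e ∧ c.ps d' = i ∧ c.dr d' = b := by
        cases b
        · exact c.dexF e i h1 (by omega)
        · exact c.dexT e i h2
      obtain ⟨d', g1, g2, g3⟩ := this
      refine ⟨d', ?_, by rw [g1, g3]⟩
      rw [mem_F, c.lab_inr _ h, c.labi d' (by rw [g2]; exact h1) (by rw [g1, g2]; exact h2), g1, g2, h3]
  rw [this, Finset.card_product, Finset.card_univ, Fintype.card_bool, mul_comm]; rfl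

/-- touching node -/
def tc (d : D) : Prop := c.In d ∧ c.m (c.ip (c.ed d) (c.ps d)) = 2 ∧
  ∃ d', c.lab d' = c.lab d ∧ c.σ d' = c.π d'

theorem tc_congr {d d' : D} (h : c.lab d = c.lab d') : c.tc d ↔ c.tc d' := by
  have key : ∀ d d', c.lab d = c.lab d' → c.tc d → c.tc d' := by
    rintro d d' h ⟨h1, h2, x, h3, h4⟩
    have h1' := (c.In_iff h).1 h1
    refine ⟨h1', ?_, x, h3.trans h, h4⟩
    rw [c.lab_inr _ h1, c.lab_inr _ h1'] at h
    rw [← Sum.inr.inj h]; exact h2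
  exact ⟨key _ _ h, key _ _ h.symm⟩

theorem tc_tw (d : D) (h : c.tc d) : c.σ d = c.π d ∨ c.σ (c.π d) = d := by
  obtain ⟨h1, h2, x, h3, h4⟩ := h
  have hx : c.In x := (c.In_iff h3).2 h1
  have hF := c.cardF h1
  rw [h2] at hF
  have hF : (c.F d).card = 4 := hF
  have hc := c.cycF d
  have hxF : x ∈ c.F d := c.mem_F.2 h3
  have inj : ∀ i j, i < 4 → j < 4 → (c.σ ^ i) x = (c.σ ^ j) x → i = j := by
    intro i j hi hj he
    rw [hc.pow_apply_eq_pow_apply hxF, hF] at he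
    unfold Nat.ModEq at he
    omega
  obtain ⟨n, hn, hdn⟩ := hc.exists_pow_eq hxF (c.mem_F.2 rfl : d ∈ c.F d)
  obtain ⟨k, hk, hdk⟩ := hc.exists_pow_eq hxF (c.mem_F.2 (c.labπ h1) : c.π d ∈ c.F d)
  rw [hF] at hn hk
  have e1 : (c.σ ^ 1) x = c.π x := by rw [pow_one, h4]
  have hnk : n ≠ k := by
    rintro rfl; exact c.πne h1 (hdk.symm.trans hdn)
  have sN : ∀ i, c.σ ((c.σ ^ i) x) = (c.σ ^ (i + 1)) x := by
    intro i; rw [pow_succ', Equiv.Perm.mul_apply]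
  have n0 : n = 0 → k = 1 := by
    rintro rfl
    apply inj k 1 hk (by omega)
    rw [hdk, e1, ← hdn]; rfl
  have n1 : n = 1 → k = 0 := by
    rintro rfl
    apply inj k 0 hk (by omega)
    rw [hdk, ← hdn, e1, c.ππ hx]; rfl
  have k0 : k = 0 → n = 1 := by
    rintro rfl
    apply inj n 1 hn (by omega)
    rw [hdn, e1, ← c.ππ h1, ← hdk]; rfl
  have k1 : k = 1 → n = 0 := by
    rintro rfl
    apply inj n 0 hn (by omega)
    rw [hdn, ← c.ππ h1, ← hdk, e1, c.ππ hx]; rfl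
  have : k = n + 1 ∨ n = k + 1 := by omega
  rcases this with h | h
  · left; rw [← hdk, h, ← sN, hdn]
  · right; rw [← hdk, sN, ← h, hdn]

theorem smooth : Smooth c.α c.σ c.π c.tc where
  αα := c.αα
  tπ d h := (c.tc_congr (c.labπ h.1)).2 h
  ππ d h := c.ππ h.1
  tσ d := c.tc_congr (c.labσ d)
  tw := c.tc_tw
  q d := by
    have key : ∀ d, c.tc d → (bk c.α c.π c.tc d = c.α (c.π d)) ∧ c.ed (c.α (c.π d)) = c.ed d ∧
        c.dr (c.α (c.π d)) = c.dr d ∧ (c.dr d = true → c.ps (c.α (c.π d)) = c.ps d - 1) ∧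
        (c.dr d = false → c.ps (c.α (c.π d)) = c.ps d + 1) := by
      intro d h
      refine ⟨by rw [bk, if_pos h], by rw [c.edα, c.edπ h.1], by rw [c.drα, c.drπ h.1]; simp, ?_, ?_⟩
      · intro h'
        rw [c.psF _ (by rw [c.drπ h.1, h']; rfl), c.psπ h.1]
      · intro h'
        rw [c.psT _ (by rw [c.drπ h.1, h']; rfl), c.psπ h.1]
    intro hq
    by_cases h1 : c.tc d
    · obtain ⟨a1, a2, a3, a4, a5⟩ := key d h1
      rw [qq, a1] at hq
      set y := c.α (c.π d)
      by_cases h2 : c.tc y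
      · obtain ⟨b1, b2, b3, b4, b5⟩ := key y h2
        rw [b1] at hq
        set z := c.α (c.π y)
        obtain ⟨q1, q2⟩ := hq.1
        obtain ⟨q3, q4⟩ := h1.1
        obtain ⟨q5, q6⟩ := h2.1
        have := c.x2 (c.ed d)
        rw [b2, a2] at q2
        rw [a2] at q6
        cases hd : c.dr d
        · have := a5 hd
          have := b5 (a3.trans hd)
          omega
        · have := a4 hd
          have := b4 (a3.trans hd)
          omega
      · rw [bk, if_neg h2] at hq; exact h2 hq
    · have : bk c.α c.π c.tc d = d := by rw [bk, if_neg h1]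
      rw [qq, this, this] at hq; exact h1 hq

end CD
end BCN

namespace BCN
open Equiv Equiv.Perm Finset
namespace CD
open Classical
variable {V E IP D : Type} [Fintype E] [Fintype D] (c : CD V E IP D)

theorem bk_facts (d : D) : c.ed (bk c.α c.π c.tc d) = c.ed d ∧ c.dr (bk c.α c.π c.tc d) = c.dr d ∧
    (c.dr d = true → c.ps (bk c.α c.π c.tc d) ≤ c.ps d) ∧
    (c.dr d = false → c.ps d ≤ c.ps (bk c.α c.π c.tc d)) := by
  by_cases h : c.tc d
  · have e1 : bk c.α c.π c.tc d = c.α (c.π d) := by rw [bk, if_pos h]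
    rw [e1]
    refine ⟨by rw [c.edα, c.edπ h.1], by rw [c.drα, c.drπ h.1]; simp, ?_, ?_⟩
    · intro h'
      rw [c.psF _ (by rw [c.drπ h.1, h']; rfl), c.psπ h.1]; omega
    · intro h'
      rw [c.psT _ (by rw [c.drπ h.1, h']; rfl), c.psπ h.1]; omega
  · have e1 : bk c.α c.π c.tc d = d := by rw [bk, if_neg h]
    rw [e1]; simp

theorem qq_facts (d : D) : c.ed (qq c.α c.π c.tc d) = c.ed d ∧ c.dr (qq c.α c.π c.tc d) = c.dr d ∧
    (c.dr d = true → c.ps (qq c.α c.π c.tc d) ≤ c.ps d) ∧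
    (c.dr d = false → c.ps d ≤ c.ps (qq c.α c.π c.tc d)) := by
  obtain ⟨h1, h2, h3, h4⟩ := c.bk_facts d
  obtain ⟨g1, g2, g3, g4⟩ := c.bk_facts (bk c.α c.π c.tc d)
  refine ⟨g1.trans h1, g2.trans h2, fun h => (g3 (h2.trans h)).trans (h3 h),
    fun h => (h4 h).trans (g4 (h2.trans h))⟩

theorem t_qq (d : D) : c.t (qq c.α c.π c.tc d) = c.t d := by
  obtain ⟨h1, h2, -⟩ := c.qq_facts d
  unfold t; rw [h1, h2]

abbrev D' := {d : D // ¬ c.tc d}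
noncomputable def a' : Perm c.D' := c.smooth.α'
noncomputable def s' : Perm c.D' := c.smooth.σ'
theorem a'_val (x : c.D') : (c.a' x).1 = qq c.α c.π c.tc (c.α x.1) := rfl
theorem s'_val (x : c.D') : (c.s' x).1 = c.σ x.1 := rfl
theorem t_a' (x : c.D') : c.t (c.a' x).1 = c.t (c.α x.1) := by rw [a'_val, t_qq]
theorem ed_a' (x : c.D') : c.ed (c.a' x).1 = c.ed x.1 := by
  rw [a'_val, (c.qq_facts _).1, c.edα]
theorem dr_a' (x : c.D') : c.dr (c.a' x).1 = !c.dr x.1 := by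
  rw [a'_val, (c.qq_facts _).2.1, c.drα]
theorem ps_a'T (x : c.D') (h : c.dr x.1 = true) : c.ps x.1 + 1 ≤ c.ps (c.a' x).1 := by
  rw [a'_val]
  have := (c.qq_facts (c.α x.1)).2.2.2 (by rw [c.drα, h]; rfl)
  rw [c.psT _ h] at this; exact this
theorem ps_a'F (x : c.D') (h : c.dr x.1 = false) : c.ps (c.a' x).1 ≤ c.ps x.1 - 1 := by
  rw [a'_val]
  have := (c.qq_facts (c.α x.1)).2.2.1 (by rw [c.drα, h]; rfl)
  rw [c.psF _ h] at this; exact this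
theorem ps_a'_ne (x : c.D') : c.ps (c.a' x).1 ≠ c.ps x.1 := by
  cases h : c.dr x.1
  · have := c.ps_a'F x h; have := c.dvF _ h; omega
  · have := c.ps_a'T x h; omega
theorem a'_of_vertex (x : c.D') (h : ¬ c.In (c.α x.1)) : (c.a' x).1 = c.α x.1 := by
  rw [a'_val]; exact c.smooth.qq_of_not (fun h' => h h'.1)

theorem tα_t (d : D) : c.t (c.α d) = if c.dr d then c.b (c.ed d) else c.a (c.ed d) := c.tα d

theorem ed_of_t {d d' : D} (h1 : c.t d = c.t d') (h2 : c.t (c.α d) = c.t (c.α d')) : c.ed d = c.ed d' := by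
  rw [tα, tα] at h2; unfold t at h1
  cases h : c.dr d <;> cases h' : c.dr d' <;> simp only [h, h'] at h1 h2
  · exact c.simp1 _ _ h2 h1
  · exact c.simp2 _ _ h2 h1
  · exact c.simp2 _ _ h1 h2
  · exact c.simp1 _ _ h1 h2
theorem ed_of_t' {d d' : D} (h1 : c.t d = c.t (c.α d')) (h2 : c.t (c.α d) = c.t d') : c.ed d = c.ed d' := by
  have := c.ed_of_t (d := d) (d' := c.α d') h1 (by rw [c.αα]; exact h2)
  rw [this, c.edα]

theorem kd_In {d : D} (h : c.kd d ≠ 0) : c.In d := by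
  by_contra h'; exact h ((c.kd0 d).2 h')
theorem kd1 {d : D} : c.kd d = 1 ↔ c.In d ∧ c.m (c.ip (c.ed d) (c.ps d)) = 2 := by
  constructor
  · intro h
    have hi := c.kd_In (d := d) (by omega)
    refine ⟨hi, ?_⟩
    rw [kd, c.lab_inr _ hi, kdL] at h
    by_contra h'; rw [if_neg h'] at h; omega
  · rintro ⟨h, h'⟩
    rw [kd, c.lab_inr _ h, kdL, if_pos h']
theorem kd2 {d : D} : c.kd d = 2 ↔ c.In d ∧ c.m (c.ip (c.ed d) (c.ps d)) = 3 := by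
  constructor
  · intro h
    have hi := c.kd_In (d := d) (by omega)
    refine ⟨hi, ?_⟩
    rw [kd, c.lab_inr _ hi, kdL] at h
    rcases c.m23 (c.ed d) (c.ps d) hi.1 hi.2 with h' | h'
    · have h' : c.m (c.ip (c.ed d) (c.ps d)) = 2 := h'
      rw [if_pos h'] at h; omega
    · exact h'
  · rintro ⟨h, h'⟩
    rw [kd, c.lab_inr _ h, kdL, if_neg (by omega)]

theorem m_pos {d : D} (h : c.In d) : 2 ≤ c.m (c.ip (c.ed d) (c.ps d)) := by
  rcases c.m23 (c.ed d) (c.ps d) h.1 h.2 with h' | h'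
  · exact h'.ge
  · unfold m; omega

theorem σne {d : D} (h : c.In d) : c.σ d ≠ d := by
  intro h'
  have hc := c.cycF d
  have := (hc.pow_apply_eq_pow_apply (c.mem_F.2 rfl : d ∈ c.F d) (m := 0) (n := 1)).1 (by simpa using h'.symm)
  have h2 := c.cardF h
  have h3 := c.m_pos h
  have h4 := (Nat.modEq_iff_dvd' (by omega)).1 this
  have := Nat.le_of_dvd (by omega) h4
  omega

theorem σ_ed {d : D} (h : c.kd d = 1) (ht : ¬ c.tc d) : c.ed (c.σ d) ≠ c.ed d := by
  obtain ⟨h1, h2⟩ := c.kd1.1 h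
  intro he
  rcases c.same_ed h1 (c.labσ d) he with h3 | h3
  · exact c.σne h1 h3
  · exact ht ⟨h1, h2, d, rfl, h3⟩

theorem σ4 {d : D} (h : c.kd d = 1) : c.σ (c.σ (c.σ (c.σ d))) = d := by
  obtain ⟨h1, h2⟩ := c.kd1.1 h
  have hc := (c.cycF d).pow_card_apply (c.mem_F.2 rfl : d ∈ c.F d)
  rw [c.cardF h1, h2] at hc
  exact hc

theorem σ2 {d : D} (h : c.kd d = 1) (ht : ¬ c.tc d) : c.σ (c.σ d) = c.π d := by
  obtain ⟨h1, h2⟩ := c.kd1.1 h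
  obtain ⟨n, hn, hdn⟩ := (c.cycF d).exists_pow_eq (c.mem_F.2 rfl : d ∈ c.F d)
    (c.mem_F.2 (c.labπ h1) : c.π d ∈ c.F d)
  rw [c.cardF h1, h2] at hn
  have h4 := c.σ4 h
  interval_cases n
  · exact absurd hdn.symm (c.πne h1)
  · exact absurd ⟨h1, h2, d, rfl, hdn⟩ ht
  · exact hdn
  · exfalso
    apply ht
    refine ⟨h1, h2, c.π d, c.labπ h1, ?_⟩
    rw [c.ππ h1]
    have : c.σ (c.σ (c.σ d)) = c.π d := hdn
    rw [← this, h4]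

theorem kdσ (d : D) : c.kd (c.σ d) = c.kd d := by rw [kd, kd, c.labσ]

theorem In_a'_two (x : c.D') (h1 : c.In x.1) (h2 : c.In (c.a' x).1) : ¬ c.In (c.α (c.π x.1)) := by
  have h3 := c.x2 (c.ed x.1)
  have q := h2.2
  rw [c.ed_a'] at q
  have q1 := h2.1
  have q2 := h1.2
  have q3 := h1.1
  rintro ⟨h4, h5⟩
  rw [c.edα, c.edπ h1] at h5
  cases h : c.dr x.1
  · have := c.ps_a'F x h
    rw [c.psT _ (by rw [c.drπ h1, h]; rfl), c.psπ h1] at h5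
    omega
  · have := c.ps_a'T x h
    rw [c.psF _ (by rw [c.drπ h1, h]; rfl), c.psπ h1] at h4
    omega

noncomputable def pm : PM V c.D' where
  α := c.a'
  σ := c.s'
  t x := c.t x.1
  kd x := c.kd x.1
  col := c.col
  W := c.W
  αα x := c.smooth.alpha_alpha x
  hcol x := by rw [c.t_a']; exact c.tne x.1
  kd_le x := by
    unfold kd kdL
    split
    · omega
    · split_ifs <;> omega
  kdσ x := by rw [c.s'_val, c.kdσ]
  tσ x h := by
    have h1 := (c.kd0 _).1 h
    have h2 : ¬ c.In (c.σ x.1) := fun h' => h1 ((c.In_iff (c.labσ _)).1 h')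
    have := c.labσ x.1
    rw [c.lab_inl _ h1, c.lab_inl _ h2] at this
    exact Sum.inl.inj this
  sc x y hx hy h := by
    have hx := (c.kd0 _).1 hx
    have hy := (c.kd0 _).1 hy
    have := c.sc x.1 y.1 (by rw [c.lab_inl _ hx, c.lab_inl _ hy, h])
    have hp : ∀ d, ¬ c.tc (c.σ d) ↔ ¬ c.tc d := fun d => not_congr (c.smooth.tσ d)
    exact (@sameCycle_subtypePerm D c.σ (fun d => ¬ c.tc d) hp x y).2 this
  simple x y hx hy h h' := by
    have hx := (c.kd0 _).1 hx
    have hy := (c.kd0 _).1 hy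
    rw [c.t_a', c.t_a'] at h'
    have he := c.ed_of_t h h'
    have hd : c.dr x.1 = c.dr y.1 := by
      have := c.col_ne (c.ed y.1)
      unfold t at h
      rw [he] at h
      cases h1 : c.dr x.1 <;> cases h2 : c.dr y.1 <;> simp_all
    apply Subtype.ext
    apply c.dext _ _ he _ hd
    rcases c.cases_d x.1 with h1 | h1 | h1
    · exact absurd h1.1 hx
    · rcases c.cases_d y.1 with h2 | h2 | h2
      · exact absurd h2.1 hy
      · omega
      · rw [h1.1, h2.1] at hd; cases hd
    · rcases c.cases_d y.1 with h2 | h2 | h2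
      · exact absurd h2.1 hy
      · rw [h1.1, h2.1] at hd; cases hd
      · rw [h1.2.1, h2.2.1, he]
  X4 x h := Subtype.ext (c.σ4 h)
  X2 x h := by
    rw [c.s'_val, c.s'_val, c.σ2 h x.2, c.t_a', c.tπ (c.kd1.1 h).1]
  X2' x h := by
    rw [c.t_a', c.s'_val, c.s'_val, c.σ2 h x.2, c.tαπ (c.kd1.1 h).1]
  nadj x h := by
    rw [c.t_a', c.t_a', c.s'_val]
    exact c.diff_ed (c.kd1.1 h).1 (c.labσ _) (c.σ_ed h x.2)
  two x h h' := by
    have h1 := (c.kd1.1 h).1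
    have h2 := (c.kd1.1 h').1
    have h3 := c.In_a'_two x h1 h2
    have h4 : (c.s' (c.s' x)).1 = c.π x.1 := by rw [c.s'_val, c.s'_val, c.σ2 h x.2]
    rw [c.a'_of_vertex _ (by rw [h4]; exact h3), h4, c.kd0]
    exact h3
  one x h h' := by
    have h1 := (c.kd1.1 h).1
    have h2 := (c.kd1.1 h').1
    have i1 : c.In (c.σ x.1) := (c.In_iff (c.labσ _)).2 h1
    have i2 : c.In (c.σ (c.a' x).1) := (c.In_iff (c.labσ _)).2 h2
    have e1 := c.σ_ed h x.2
    have e2 := c.σ_ed h' (c.a' x).2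
    have l1 := c.labσ x.1
    have l2 := c.labσ (c.a' x).1
    rw [c.lab_inr _ h1, c.lab_inr _ i1] at l1
    rw [c.lab_inr _ h2, c.lab_inr _ i2, c.ed_a'] at l2
    rw [c.t_a', c.t_a', c.s'_val, c.s'_val]
    have key : c.ed (c.σ x.1) = c.ed (c.σ (c.a' x).1) → False := by
      intro he
      have j2 := h2.2
      rw [c.ed_a'] at j2
      have k2 := i2.2
      rw [← he] at k2 l2
      exact c.ps_a'_ne x (c.once (c.ed x.1) (c.ed (c.σ x.1)) _ _ _ _ e1.symm h1.1 h1.2 i1.1 i1.2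
        (Sum.inr.inj l1).symm h2.1 j2 i2.1 k2 (Sum.inr.inj l2).symm).symm
    exact ⟨fun hh => key (c.ed_of_t hh.1 hh.2), fun hh => key (c.ed_of_t' hh.1 hh.2)⟩
  Yh x h := by
    obtain ⟨h1, h2⟩ := c.kd2.1 h
    have h3 := c.Y1 (c.ed x.1) (c.ps x.1) h1.1 h1.2 (by
      have : c.m (c.ip (c.ed x.1) (c.ps x.1)) ≠ 2 := by omega
      exact this)
    have h4 : ¬ c.In (c.a' x).1 := by
      rintro ⟨h4, h5⟩
      rw [c.ed_a'] at h5
      have := c.ps_a'_ne x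
      have := h1.1
      have := h1.2
      omega
    exact (c.kd0 _).2 h4
  Yn x h := by
    obtain ⟨h1, h2⟩ := c.kd2.1 h
    rw [c.t_a', c.t_a', c.s'_val]
    by_cases he : c.ed (c.σ x.1) = c.ed x.1
    · rcases c.same_ed h1 (c.labσ _) he with h3 | h3
      · exact absurd h3 (c.σne h1)
      · rw [h3, c.tαπ h1]
        intro h4
        exact c.tne x.1 (by rw [h4])
    · exact (c.diff_ed h1 (c.labσ _) he).2.2.2.symm
  tW x h := by
    unfold t
    split_ifs
    · exact c.aW _
    · exact c.bW _
  deg2 x h h' := by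
    have h1 := (c.kd0 _).1 h
    obtain ⟨d', h2, h3⟩ := c.deg x.1 _ (c.lab_inl _ h1)
    obtain ⟨n, hn⟩ := c.sc x.1 d' h3.symm
    have h4 : c.σ x.1 = x.1 := congrArg Subtype.val h'
    rw [Equiv.Perm.zpow_apply_eq_self_of_apply_eq_self h4] at hn
    exact h2 hn.symm

theorem pm_kd (x : c.D') : c.pm.kd x = c.kd x.1 := rfl
theorem pm_t (x : c.D') : c.pm.t x = c.t x.1 := rfl
theorem pm_W : c.pm.W = c.W := rfl

theorem exV (e : E) (b : Bool) : ∃ d, c.ed d = e ∧ c.dr d = b ∧ ¬ c.In d := by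
  cases b
  · obtain ⟨d, h1, h2, h3⟩ := c.dexF e (c.x e + 1) (by omega) le_rfl
    refine ⟨d, h1, h3, fun h => ?_⟩
    have := h.2
    rw [h1, h2] at this; omega
  · obtain ⟨d, h1, h2, h3⟩ := c.dexT e 0 (by omega)
    refine ⟨d, h1, h3, fun h => ?_⟩
    have := h.1
    omega

theorem psV {d d' : D} (hd : c.dr d = c.dr d') (he : c.ed d = c.ed d') (h : ¬ c.In d) (h' : ¬ c.In d') :
    d = d' := by
  apply c.dext _ _ he _ hd
  rcases c.cases_d d with h1 | h1 | h1
  · exact absurd h1.1 h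
  · rcases c.cases_d d' with h2 | h2 | h2
    · exact absurd h2.1 h'
    · omega
    · rw [h1.1, h2.1] at hd; cases hd
  · rcases c.cases_d d' with h2 | h2 | h2
    · exact absurd h2.1 h'
    · rw [h1.1, h2.1] at hd; cases hd
    · rw [h1.2.1, h2.2.1, he]

theorem count0 : (univ.filter fun x : c.D' => c.pm.kd x = 0).card = 2 * Fintype.card E := by
  have : (univ.filter fun x : c.D' => c.pm.kd x = 0).card = (univ : Finset (E × Bool)).card := by
    apply Finset.card_bij (fun x _ => (c.ed x.1, c.dr x.1))
    · intro x _; exact mem_univ _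
    · intro x hx y hy h
      rw [mem_filter, pm_kd, kd0] at hx hy
      rw [Prod.mk.injEq] at h
      exact Subtype.ext (c.psV h.2 h.1 hx.2 hy.2)
    · rintro ⟨e, b⟩ _
      obtain ⟨d, h1, h2, h3⟩ := c.exV e b
      refine ⟨⟨d, fun h => h3 h.1⟩, ?_, Prod.ext h1 h2⟩
      rw [mem_filter, pm_kd, kd0]
      exact ⟨mem_univ _, h3⟩
  rw [this, card_univ, Fintype.card_prod, Fintype.card_bool, mul_comm]

theorem countv (v : V) : (univ.filter fun e => c.a e = v ∨ c.b e = v).card ≤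
    (univ.filter fun x : c.D' => c.pm.kd x = 0 ∧ c.pm.t x = v).card := by
  have : ∀ e, ∃ x : c.D', (c.a e = v ∨ c.b e = v) → c.pm.kd x = 0 ∧ c.pm.t x = v ∧ c.ed x.1 = e := by
    intro e
    obtain ⟨d, h1, h2, h3⟩ := c.exV e true
    obtain ⟨d', h1', h2', h3'⟩ := c.exV e false
    by_cases h : c.a e = v
    · refine ⟨⟨d, fun h => h3 h.1⟩, fun _ => ⟨(c.kd0 _).2 h3, ?_, h1⟩⟩
      change c.t d = v
      unfold t; rw [h2, h1]; exact h
    · refine ⟨⟨d', fun h => h3' h.1⟩, fun hh => ⟨(c.kd0 _).2 h3', ?_, h1'⟩⟩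
      change c.t d' = v
      unfold t; rw [h2', h1']
      rcases hh with hh | hh
      · exact absurd hh h
      · exact hh
  choose f hf using this
  apply Finset.card_le_card_of_injOn f
  · intro e he
    rw [Finset.mem_coe, mem_filter] at he ⊢
    exact ⟨mem_univ _, (hf e he.2).1, (hf e he.2).2.1⟩
  · intro e he e' he' h
    rw [Finset.mem_coe, mem_filter] at he he'
    rw [← (hf e he.2).2.2, ← (hf e' he'.2).2.2, h]

/-- weights -/
noncomputable def wt (d : D) : ℕ := if c.kd d = 1 then 3 else if c.kd d = 2 then 2 else 0

noncomputable def LL : Finset (V ⊕ IP) := c.W.image Sum.inl ∪ (univ.filter fun d => ¬ c.tc d ∧ c.In d).image c.lab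

theorem lab_LL (x : c.D') : c.lab x.1 ∈ c.LL := by
  unfold LL
  rw [mem_union]
  by_cases h : c.In x.1
  · exact Or.inr (mem_image_of_mem _ (by simp [h, x.2]))
  · left
    rw [c.lab_inl _ h]
    apply mem_image_of_mem
    unfold t
    split_ifs
    · exact c.aW _
    · exact c.bW _

theorem card_LL : 12 * c.LL.card ≤ 12 * c.W.card +
    ∑ d ∈ univ.filter (fun d => ¬ c.tc d ∧ c.In d), c.wt d := by
  have h1 : c.LL.card ≤ c.W.card + ((univ.filter fun d => ¬ c.tc d ∧ c.In d).image c.lab).card :=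
    (card_union_le _ _).trans (by gcongr; exact card_image_le)
  have h2 : 12 * ((univ.filter fun d => ¬ c.tc d ∧ c.In d).image c.lab).card ≤
      ∑ d ∈ univ.filter (fun d => ¬ c.tc d ∧ c.In d), c.wt d := by
    rw [← Finset.sum_fiberwise_of_maps_to (g := c.lab)
      (t := (univ.filter fun d => ¬ c.tc d ∧ c.In d).image c.lab) (fun x hx => mem_image_of_mem _ hx)]
    rw [mul_comm, ← smul_eq_mul]
    apply Finset.card_nsmul_le_sum
    intro l hl
    obtain ⟨d, hd, rfl⟩ := mem_image.1 hl
    rw [mem_filter] at hd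
    obtain ⟨-, hd1, hd2⟩ := hd
    have e1 : (univ.filter (fun d => ¬ c.tc d ∧ c.In d)).filter (fun d' => c.lab d' = c.lab d) = c.F d := by
      ext d'
      rw [mem_F]
      simp only [mem_filter, mem_univ, true_and, and_iff_right_iff_imp]
      intro h
      exact ⟨fun h' => hd1 ((c.tc_congr h).1 h'), (c.In_iff h).2 hd2⟩
    rw [e1]
    have e2 : ∀ d' ∈ c.F d, c.wt d' = c.wt d := by
      intro d' hd'
      rw [mem_F] at hd'
      unfold wt kd
      rw [hd']
    rw [Finset.sum_congr rfl e2, Finset.sum_const, smul_eq_mul, c.cardF hd2]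
    rcases c.m23 (c.ed d) (c.ps d) hd2.1 hd2.2 with h | h
    · have h : c.m (c.ip (c.ed d) (c.ps d)) = 2 := h
      have h' := c.kd1.2 ⟨hd2, h⟩
      rw [h, wt, if_pos h']
    · have h : c.m (c.ip (c.ed d) (c.ps d)) = 3 := h
      have h' := c.kd2.2 ⟨hd2, h⟩
      rw [h, wt, if_neg (by omega), if_pos h']
  omega

theorem sum_wt : ∑ d ∈ univ.filter (fun d => ¬ c.tc d ∧ c.In d), c.wt d =
    3 * (univ.filter fun x : c.D' => c.pm.kd x = 1).card + 2 * (univ.filter fun x : c.D' => c.pm.kd x = 2).card := by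
  have h1 : ∑ d ∈ univ.filter (fun d => ¬ c.tc d ∧ c.In d), c.wt d =
      ∑ d ∈ univ.filter (fun d => ¬ c.tc d), c.wt d := by
    apply Finset.sum_subset
    · intro d hd
      simp only [mem_filter, mem_univ, true_and] at hd ⊢
      exact hd.1
    · intro d hd hd'
      simp only [mem_filter, mem_univ, true_and] at hd hd'
      have : c.kd d = 0 := (c.kd0 d).2 (fun h => hd' ⟨hd, h⟩)
      simp [wt, this]
  have h2 : ∑ d ∈ univ.filter (fun d => ¬ c.tc d), c.wt d = ∑ x : c.D', c.wt x.1 := by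
    apply Finset.sum_subtype
    intro x; simp
  have h3 : ∀ x : c.D', c.wt x.1 = 3 * (if c.pm.kd x = 1 then 1 else 0) + 2 * (if c.pm.kd x = 2 then 1 else 0) := by
    intro x
    rw [pm_kd, wt]
    split_ifs <;> omega
  rw [h1, h2, Finset.sum_congr rfl (fun x _ => h3 x), Finset.sum_add_distrib, ← Finset.mul_sum,
    ← Finset.mul_sum, Finset.card_filter, Finset.card_filter]

theorem euler [Nonempty E] : c.pm.Euler := by
  have e0 : Nonempty c.D' := by
    obtain ⟨d, h1, h2, h3⟩ := c.exV (Classical.arbitrary E) true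
    exact ⟨⟨d, fun h => h3 h.1⟩⟩
  have hcert := c.smooth.cert (Λ' := c.LL) c.lab (fun x => ⟨c.lab x.1, c.lab_LL x⟩) (by
      intro l
      by_cases h : ∃ d, c.lab d = l ∧ c.tc d
      · obtain ⟨d, h1, h2⟩ := h
        left
        intro d' h'
        exact (c.tc_congr (h1.trans h'.symm)).1 h2
      · right
        intro d hd ht
        exact h ⟨d, hd, ht⟩) (by
      intro x y
      rw [Subtype.mk.injEq]) (fun d h => c.labπ h.1) (fun d h => c.πne h.1) (by convert c.cert)
  have h := euler_of_cert (Λ := c.LL) _ _ _ (fun x : c.D' => c.dr x.1) c.smooth.alpha_alpha (fun x => c.dr_a' x)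
    (by convert hcert)
  rw [Fintype.card_coe] at h
  have h2 := c.card_LL
  rw [c.sum_wt] at h2
  unfold PM.Euler
  have h3 : c.pm.φ = c.smooth.σ'⁻¹ * c.smooth.α' := rfl
  rw [h3, c.pm_W]
  omega

theorem bound0 [Nonempty E] (h : ∀ e, c.x e = 0) : 2 * (Fintype.card E : ℤ) ≤ 4 * c.W.card - 8 := by
  have h0 : ∀ x : c.D', c.pm.kd x = 0 := by
    intro x
    rw [pm_kd, kd0]
    rintro ⟨h1, h2⟩
    rw [h] at h2; omega
  have h1 := c.pm.planar_bound c.euler h0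
  have h2 := c.count0
  rw [Finset.filter_true_of_mem (fun x _ => h0 x), card_univ] at h2
  rw [h2] at h1
  rw [c.pm_W] at h1
  push_cast at h1
  exact h1

theorem bound1 [Nonempty E] (h : ∀ e, c.x e ≤ 1) (hm : ∀ e i, 0 < i → i ≤ c.x e → c.m (c.ip e i) = 2)
    (hdeg : ∀ v ∈ c.W, 4 ≤ (univ.filter fun e => c.a e = v ∨ c.b e = v).card) :
    2 * (Fintype.card E : ℤ) ≤ 6 * c.W.card - 16 := by
  have H : c.pm.OneP := by
    constructor
    · intro x hx
      have h1 := c.kd2.1 hx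
      have := h1.2
      rw [hm _ _ h1.1.1 h1.1.2] at this; omega
    · intro x hx
      have h1 := (c.kd1.1 hx).1
      refine (c.kd0 _).2 ?_
      rintro ⟨h4, h5⟩
      change 0 < c.ps (c.a' x).1 at h4
      change c.ps (c.a' x).1 ≤ c.x (c.ed (c.a' x).1) at h5
      rw [c.ed_a'] at h5
      have := c.ps_a'_ne x
      have := h1.1
      have := h1.2
      have := h (c.ed x.1)
      omega
  have h1 := H.bound c.euler (fun v hv => (hdeg v hv).trans (c.countv v))
  have h2 := c.count0
  rw [h2, c.pm_W] at h1
  push_cast at h1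
  exact h1

theorem bound2 [Nonempty E] : 8 * (Fintype.card E : ℤ) ≤ 28 * c.W.card - 56 := by
  have h1 := c.pm.bound2 c.euler
  have h2 := c.count0
  rw [h2, c.pm_W] at h1
  push_cast at h1
  linarith

end CD
end BCN

namespace BCN
open Equiv Equiv.Perm Finset

open Classical in
theorem cert_transfer {D Λ Λ' : Type} [Fintype D] (α φ : Perm D) (lab : D → Λ) (lab' : D → Λ')
    (h : ∀ d d', lab d = lab d' ↔ lab' d = lab' d') (hc : Cert α φ lab') : Cert α φ lab := by
  intro C hC hs
  refine hc C hC (fun l => ?_)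
  by_cases hl : ∃ d, lab' d = l
  · obtain ⟨d, rfl⟩ := hl
    rw [← hs (lab d)]
    congr 1
    ext d'
    simp only [mem_filter, mem_univ, true_and]
    exact (h d' d).symm
  · rw [Finset.filter_false_of_mem (fun d _ hd => hl ⟨d, hd⟩), Finset.sum_empty]

open Classical in
/-- a drawing with oriented edges and explicit crossing times -/
structure OD (V E : Type) [Fintype E] where
  vert : V → ℝ × ℝ
  vert_inj : Function.Injective vert
  W : Finset V
  col : V → Bool
  a : E → V
  b : E → V
  aW : ∀ e, a e ∈ W
  bW : ∀ e, b e ∈ W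
  col_ne : ∀ e, col (a e) ≠ col (b e)
  simp1 : ∀ e f, a e = a f → b e = b f → e = f
  simp2 : ∀ e f, a e = b f → b e = a f → e = f
  arc : E → ℝ → ℝ × ℝ
  arc_cont : ∀ e, ContinuousOn (arc e) (Set.Icc 0 1)
  arc_inj : ∀ e, Set.InjOn (arc e) (Set.Icc 0 1)
  arc0 : ∀ e, arc e 0 = vert (a e)
  arc1 : ∀ e, arc e 1 = vert (b e)
  iv : ∀ e, ∀ u ∈ Set.Ioo (0:ℝ) 1, ∀ w, arc e u ≠ vert w
  x : E → ℕ
  τ : E → ℕ → ℝ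
  τ0 : ∀ e, τ e 0 = 0
  τ1 : ∀ e, τ e (x e + 1) = 1
  τlt : ∀ e i, i ≤ x e → τ e i < τ e (i + 1)
  hit : ∀ e f, ∀ u ∈ Set.Ioo (0:ℝ) 1, ∀ u' ∈ Set.Icc (0:ℝ) 1, e ≠ f → arc e u = arc f u' →
    ∃ i, 0 < i ∧ i ≤ x e ∧ τ e i = u
  nonadj : ∀ e f i j, e ≠ f → 0 < i → i ≤ x e → 0 < j → j ≤ x f → arc e (τ e i) = arc f (τ f j) →
    a e ≠ a f ∧ a e ≠ b f ∧ b e ≠ a f ∧ b e ≠ b f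
  once : ∀ e f i j i' j', e ≠ f → 0 < i → i ≤ x e → 0 < j → j ≤ x f → arc e (τ e i) = arc f (τ f j) →
    0 < i' → i' ≤ x e → 0 < j' → j' ≤ x f → arc e (τ e i') = arc f (τ f j') → i = i'
  m23 : ∀ e i, 0 < i → i ≤ x e →
    (univ.filter fun e' => ∃ j, 0 < j ∧ j ≤ x e' ∧ arc e' (τ e' j) = arc e (τ e i)).card = 2 ∨
    (univ.filter fun e' => ∃ j, 0 < j ∧ j ≤ x e' ∧ arc e' (τ e' j) = arc e (τ e i)).card = 3
  x2 : ∀ e, x e ≤ 2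
  Y1 : ∀ e i, 0 < i → i ≤ x e →
    (univ.filter fun e' => ∃ j, 0 < j ∧ j ≤ x e' ∧ arc e' (τ e' j) = arc e (τ e i)).card ≠ 2 → x e = 1
  dega : ∀ e, ∃ f, f ≠ e ∧ (a f = a e ∨ b f = a e)
  degb : ∀ e, ∃ f, f ≠ e ∧ (a f = b e ∨ b f = b e)

namespace OD
open Classical
variable {V E : Type} [Fintype E] (o : OD V E)

theorem τmono (e : E) (i j : ℕ) (hij : i < j) (hj : j ≤ o.x e + 1) : o.τ e i < o.τ e j := by
  induction j, hij using Nat.le_induction with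
  | base => exact o.τlt e i (by omega)
  | succ j hj' ih => exact (ih (by omega)).trans (o.τlt e j (by omega))
theorem τmono' (e : E) (i j : ℕ) (hi : i ≤ o.x e + 1) (h : o.τ e i < o.τ e j) : i < j := by
  by_contra h'
  rcases Nat.lt_or_ge j i with h2 | h2
  · exact absurd (o.τmono e j i h2 hi) (not_lt.2 h.le)
  · have : i = j := by omega
    subst this; exact lt_irrefl _ h
theorem τinj (e : E) (i j : ℕ) (hi : i ≤ o.x e + 1) (hj : j ≤ o.x e + 1) (h : o.τ e i = o.τ e j) : i = j := by
  rcases lt_trichotomy i j with h1 | h1 | h1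
  · exact absurd h (o.τmono e i j h1 hj).ne
  · exact h1
  · exact absurd h (o.τmono e j i h1 hi).ne'
theorem τIoo (e : E) (i : ℕ) (h0 : 0 < i) (hi : i ≤ o.x e) : o.τ e i ∈ Set.Ioo (0:ℝ) 1 := by
  constructor
  · rw [← o.τ0 e]; exact o.τmono e 0 i h0 (by omega)
  · rw [← o.τ1 e]; exact o.τmono e i _ (by omega) le_rfl
theorem τIcc (e : E) (i : ℕ) (hi : i ≤ o.x e + 1) : o.τ e i ∈ Set.Icc (0:ℝ) 1 := by
  rcases Nat.eq_zero_or_pos i with rfl | h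
  · rw [o.τ0]; simp
  · rcases Nat.lt_or_ge i (o.x e + 1) with h1 | h1
    · exact Set.Ioo_subset_Icc_self (o.τIoo e i h (by omega))
    · have : i = o.x e + 1 := by omega
      rw [this, o.τ1]; simp

theorem not_hit (e f : E) (i : ℕ) (hi : i ≤ o.x e) (u u' : ℝ) (hu : u ∈ Set.Ioo (o.τ e i) (o.τ e (i + 1)))
    (hu' : u' ∈ Set.Icc (0:ℝ) 1) (hne : e ≠ f) : o.arc e u ≠ o.arc f u' := by
  intro h
  have h1 : u ∈ Set.Ioo (0:ℝ) 1 :=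
    ⟨(o.τIcc e i (by omega)).1.trans_lt hu.1, hu.2.trans_le (o.τIcc e (i + 1) (by omega)).2⟩
  obtain ⟨j, h2, h3, rfl⟩ := o.hit e f u h1 u' hu' hne h
  have := o.τmono' e _ _ (by omega) hu.1
  have := o.τmono' e _ _ (by omega) hu.2
  omega

abbrev Seg := Σ e : E, Fin (o.x e + 1)
abbrev D := o.Seg × Bool
def ed (d : o.D) : E := d.1.1
def ps (d : o.D) : ℕ := if d.2 then d.1.2 else d.1.2 + 1
def P (d : o.D) : ℝ × ℝ := o.arc (o.ed d) (o.τ (o.ed d) (o.ps d))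
theorem ps_le (d : o.D) : o.ps d ≤ o.x (o.ed d) + 1 := by
  obtain ⟨⟨e, i⟩, b⟩ := d
  cases b <;> simp [ps, ed]
  omega
theorem psIcc (d : o.D) : o.τ (o.ed d) (o.ps d) ∈ Set.Icc (0:ℝ) 1 := o.τIcc _ _ (o.ps_le d)

/-- parameter inside a segment -/
noncomputable def par (s : o.Seg) (t : ℝ) : ℝ := o.τ s.1 s.2 + t * (o.τ s.1 (s.2 + 1) - o.τ s.1 s.2)
theorem seg_lt (s : o.Seg) : o.τ s.1 s.2 < o.τ s.1 (s.2 + 1) := o.τlt _ _ (by have := s.2.2; omega)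
theorem parIoo (s : o.Seg) (t : ℝ) (ht : t ∈ Set.Ioo (0:ℝ) 1) :
    o.par s t ∈ Set.Ioo (o.τ s.1 s.2) (o.τ s.1 (s.2 + 1)) := by
  have h := o.seg_lt s
  unfold par
  constructor
  · nlinarith [ht.1]
  · nlinarith [ht.2]
theorem seg_le (s : o.Seg) : (s.2 : ℕ) ≤ o.x s.1 := by have := s.2.2; omega
theorem parIcc (s : o.Seg) (t : ℝ) (ht : t ∈ Set.Icc (0:ℝ) 1) : o.par s t ∈ Set.Icc (0:ℝ) 1 := by
  have h := o.seg_lt s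
  have h1 := (o.τIcc s.1 s.2 (by have := o.seg_le s; omega)).1
  have h2 := (o.τIcc s.1 (s.2 + 1) (by have := o.seg_le s; omega)).2
  unfold par
  constructor
  · nlinarith [ht.1]
  · nlinarith [ht.2]

theorem par0 (s : o.Seg) : o.par s 0 = o.τ s.1 s.2 := by simp [par]
theorem par1 (s : o.Seg) : o.par s 1 = o.τ s.1 (s.2 + 1) := by simp [par]

noncomputable def td : TD (Set.range o.P) o.Seg where
  pt := Subtype.val
  pt_inj := Subtype.val_injective
  γ s t := o.arc s.1 (o.par s t)
  cont s := by
    apply (o.arc_cont s.1).comp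
    · unfold par; fun_prop
    · intro t ht; exact o.parIcc s t ht
  p s := ⟨o.P (s, true), _, rfl⟩
  q s := ⟨o.P (s, false), _, rfl⟩
  pq s h := by
    have h := congrArg Subtype.val h
    have := o.arc_inj s.1 (o.psIcc (s, true)) (o.psIcc (s, false)) h
    exact (o.seg_lt s).ne this
  γ0 s := by rw [par0]; rfl
  γ1 s := by rw [par1]; rfl
  av s t ht l := by
    obtain ⟨_, d, rfl⟩ := l
    intro h
    change _ = o.P d at h
    have hp := o.parIoo s t ht
    by_cases he : s.1 = o.ed d
    · unfold P at h
      rw [← he] at h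
      have h1 := o.psIcc d
      have h0 := o.ps_le d
      rw [← he] at h1 h0
      have := o.arc_inj s.1 (o.parIcc s t (Set.Ioo_subset_Icc_self ht)) h1 h
      rw [this] at hp
      have := o.τmono' _ _ _ (by have := o.seg_le s; omega) hp.1
      have := o.τmono' _ _ _ (by omega) hp.2
      omega
    · exact o.not_hit s.1 (o.ed d) s.2 (o.seg_le s) _ _ hp (o.psIcc d) he h
  dis s s' t ht t' ht' h := by
    have hp := o.parIoo s t ht
    have hp' := o.parIoo s' t' ht'
    have hi' := o.parIcc s' t' (Set.Ioo_subset_Icc_self ht')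
    by_cases he : s.1 = s'.1
    · obtain ⟨e, i⟩ := s
      obtain ⟨e', j⟩ := s'
      dsimp only at he
      subst he
      have := o.arc_inj e (o.parIcc _ t (Set.Ioo_subset_Icc_self ht)) hi' h
      rw [← this] at hp'
      have h1 := o.τmono' e i (j + 1) (by omega) (hp.1.trans hp'.2)
      have h2 := o.τmono' e j (i + 1) (by omega) (hp'.1.trans hp.2)
      have : i = j := Fin.ext (by omega)
      rw [this]
    · exact absurd h (o.not_hit s.1 s'.1 s.2 (o.seg_le s) _ _ hp hi' he)

noncomputable def lab (d : o.D) : V ⊕ (ℝ × ℝ) :=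
  if o.ps d = 0 then Sum.inl (o.a (o.ed d)) else
  if o.ps d = o.x (o.ed d) + 1 then Sum.inl (o.b (o.ed d)) else Sum.inr (o.arc (o.ed d) (o.τ (o.ed d) (o.ps d)))

theorem lab_P (d : o.D) : Sum.elim o.vert id (o.lab d) = o.P d := by
  unfold lab P
  split_ifs with h1 h2
  · rw [h1, o.τ0, o.arc0]; rfl
  · rw [h2, o.τ1, o.arc1]; rfl
  · rfl

theorem lab_cases (d : o.D) : (∃ v, o.lab d = Sum.inl v) ∨ (o.lab d = Sum.inr (o.P d) ∧ ∀ w, o.P d ≠ o.vert w) := by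
  unfold lab
  split_ifs with h1 h2
  · exact Or.inl ⟨_, rfl⟩
  · exact Or.inl ⟨_, rfl⟩
  · refine Or.inr ⟨rfl, fun w => o.iv _ _ (o.τIoo _ _ (by omega) (by have := o.ps_le d; omega)) w⟩

theorem lab_iff (d d' : o.D) : o.lab d = o.lab d' ↔ o.P d = o.P d' := by
  constructor
  · intro h
    rw [← o.lab_P, ← o.lab_P, h]
  · intro h
    have g := o.lab_P d
    have g' := o.lab_P d'
    rcases o.lab_cases d with ⟨v, h1⟩ | ⟨h1, h2⟩ <;> rcases o.lab_cases d' with ⟨v', h1'⟩ | ⟨h1', h2'⟩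
    · rw [h1] at g; rw [h1'] at g'
      rw [h1, h1']
      congr 1
      exact o.vert_inj (g.trans (h.trans g'.symm))
    · rw [h1] at g
      exact absurd (h.symm.trans g.symm) (h2' v)
    · rw [h1'] at g'
      exact absurd (h.trans g'.symm) (h2 v')
    · rw [h1, h1', h]

theorem labP_td (d : o.D) : (labP o.td.p o.td.q d).1 = o.P d := by
  obtain ⟨s, b⟩ := d
  cases b <;> rfl

theorem lab_iff' (d d' : o.D) : o.lab d = o.lab d' ↔ labP o.td.p o.td.q d = labP o.td.p o.td.q d' := by
  rw [lab_iff, Subtype.ext_iff, labP_td, labP_td]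

theorem ex_dT (e : E) (i : ℕ) (hi : i ≤ o.x e) : ∃ d : o.D, o.ed d = e ∧ o.ps d = i ∧ d.2 = true :=
  ⟨(⟨e, ⟨i, by omega⟩⟩, true), rfl, rfl, rfl⟩
theorem ex_dF (e : E) (i : ℕ) (h : 0 < i) (hi : i ≤ o.x e + 1) : ∃ d : o.D, o.ed d = e ∧ o.ps d = i ∧ d.2 = false :=
  ⟨(⟨e, ⟨i - 1, by omega⟩⟩, false), rfl, by simp [ps]; omega, rfl⟩

theorem lab_a (d : o.D) (h : o.ps d = 0) : o.lab d = Sum.inl (o.a (o.ed d)) := by rw [lab, if_pos h]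
theorem lab_b (d : o.D) (h : o.ps d = o.x (o.ed d) + 1) : o.lab d = Sum.inl (o.b (o.ed d)) := by
  rw [lab, if_neg (by omega), if_pos h]

theorem ex_lab (f : E) (v : V) (h : o.a f = v ∨ o.b f = v) : ∃ d : o.D, o.ed d = f ∧ o.lab d = Sum.inl v := by
  rcases h with h | h
  · obtain ⟨d, h1, h2, h3⟩ := o.ex_dT f 0 (by omega)
    exact ⟨d, h1, by rw [o.lab_a d h2, h1, h]⟩
  · obtain ⟨d, h1, h2, h3⟩ := o.ex_dF f (o.x f + 1) (by omega) le_rfl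
    exact ⟨d, h1, by rw [o.lab_b d (by rw [h2, h1]), h1, h]⟩

noncomputable def cd : CD V E (ℝ × ℝ) o.D where
  W := o.W
  col := o.col
  a := o.a
  b := o.b
  aW := o.aW
  bW := o.bW
  col_ne := o.col_ne
  simp1 := o.simp1
  simp2 := o.simp2
  x := o.x
  ip e i := o.arc e (o.τ e i)
  ip_inj e i j hi0 hi hj0 hj h :=
    o.τinj e i j (by omega) (by omega) (o.arc_inj e (o.τIcc e i (by omega)) (o.τIcc e j (by omega)) h)
  nonadj := o.nonadj
  once := o.once
  m23 := o.m23
  x2 := o.x2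
  Y1 := o.Y1
  ed := o.ed
  ps := o.ps
  dr d := d.2
  dext := by
    rintro ⟨⟨e, i⟩, b⟩ ⟨⟨e', i'⟩, b'⟩ h1 h2 h3
    simp only [ed] at h1
    subst h1
    simp only at h3
    subst h3
    simp only [ps] at h2
    have : i = i' := Fin.ext (by cases b <;> simp at h2 <;> omega)
    rw [this]
  dexT := o.ex_dT
  dexF := o.ex_dF
  dvT := by
    rintro ⟨⟨e, i⟩, b⟩ h
    simp only at h
    subst h
    simp only [ps, ed]; simp; omega
  dvF := by
    rintro ⟨⟨e, i⟩, b⟩ h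
    simp only at h
    subst h
    simp only [ps, ed]; simp; omega
  α := flipP o.Seg
  edα _ := rfl
  drα _ := rfl
  psT := by
    rintro ⟨⟨e, i⟩, b⟩ h
    simp only at h
    subst h
    rfl
  psF := by
    rintro ⟨⟨e, i⟩, b⟩ h
    simp only at h
    subst h
    rfl
  lab := o.lab
  lab0 := o.lab_a
  lab1 := o.lab_b
  labi d h1 h2 := by rw [lab, if_neg (by omega), if_neg (by omega)]
  σ := o.td.cert.choose
  labσ d := (o.lab_iff' _ _).2 (o.td.cert.choose_spec.1 d)
  sc d d' h := o.td.cert.choose_spec.2.1 d d' ((o.lab_iff' _ _).1 h)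
  cert := by
    have := cert_transfer _ _ o.lab _ o.lab_iff' o.td.cert.choose_spec.2.2
    convert this
  deg d v h := by
    have : ∃ f, f ≠ o.ed d ∧ (o.a f = v ∨ o.b f = v) := by
      unfold lab at h
      split_ifs at h with h1 h2
      · rw [← Sum.inl.inj h]; exact o.dega _
      · rw [← Sum.inl.inj h]; exact o.degb _
    obtain ⟨f, h1, h2⟩ := this
    obtain ⟨d', h3, h4⟩ := o.ex_lab f v h2
    refine ⟨d', ?_, h4.trans h.symm⟩
    rintro rfl
    exact h1 h3.symm

end OD
end BCN

namespace BCN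
open Equiv Equiv.Perm Finset

theorem enum_times (T : Finset ℝ) (hT : ∀ t ∈ T, t ∈ Set.Ioo (0:ℝ) 1) : ∃ τ : ℕ → ℝ, τ 0 = 0 ∧
    τ (T.card + 1) = 1 ∧ (∀ i ≤ T.card, τ i < τ (i + 1)) ∧
    (∀ t, t ∈ T ↔ ∃ i, 0 < i ∧ i ≤ T.card ∧ τ i = t) := by
  let f := T.orderEmbOfFin rfl
  let τ : ℕ → ℝ := fun i => if i = 0 then 0 else if h : i - 1 < T.card then f ⟨i - 1, h⟩ else 1
  have hf : ∀ i, f i ∈ T := fun i => T.orderEmbOfFin_mem rfl i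
  have t0 : τ 0 = 0 := by simp [τ]
  have tm : ∀ i (h : i < T.card), τ (i + 1) = f ⟨i, h⟩ := by
    intro i h; simp [τ, h]
  have t1 : τ (T.card + 1) = 1 := by simp [τ]
  refine ⟨τ, t0, t1, ?_, ?_⟩
  · intro i hi
    rcases Nat.eq_zero_or_pos i with rfl | h
    · rw [t0]
      rcases Nat.eq_zero_or_pos T.card with h | h
      · rw [h] at t1; rw [t1]; norm_num
      · rw [tm 0 h]; exact (hT _ (hf _)).1
    · obtain ⟨j, rfl⟩ : ∃ j, i = j + 1 := ⟨i - 1, by omega⟩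
      rw [tm j (by omega)]
      rcases Nat.lt_or_ge (j + 1) T.card with h1 | h1
      · rw [tm (j + 1) h1]
        apply f.strictMono
        rw [Fin.mk_lt_mk]; omega
      · have : j + 1 = T.card := by omega
        rw [this, t1]
        exact (hT _ (hf _)).2
  · intro t
    constructor
    · intro ht
      have : t ∈ Set.range f := by
        rw [Finset.range_orderEmbOfFin]; exact ht
      obtain ⟨i, rfl⟩ := this
      exact ⟨i + 1, by omega, by have := i.2; omega, tm i i.2⟩
    · rintro ⟨i, h1, h2, rfl⟩
      obtain ⟨j, rfl⟩ : ∃ j, i = j + 1 := ⟨i - 1, by omega⟩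
      rw [tm j (by omega)]
      exact hf _

section
open Classical
variable {V : Type} {G : SimpleGraph V} (Dg : Drawing G)

theorem orient (e : G.edgeSet) : ∃ a b, e.1 = s(a, b) ∧ Dg.arc e 0 = Dg.vert a ∧ Dg.arc e 1 = Dg.vert b := by
  have hne : Dg.arc e 0 ≠ Dg.arc e 1 := by
    intro h
    have := Dg.arc_inj e (by simp) (by simp) h
    norm_num at this
  obtain ⟨u, v, huv⟩ : ∃ u v, e.1 = s(u, v) := by
    induction h : e.1 using Sym2.ind with
    | h u v => exact ⟨u, v, rfl⟩
  have h := Dg.arc_ends e u v huv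
  have h0 : Dg.arc e 0 ∈ ({Dg.vert u, Dg.vert v} : Set (ℝ × ℝ)) := by rw [← h]; simp
  have h1 : Dg.arc e 1 ∈ ({Dg.vert u, Dg.vert v} : Set (ℝ × ℝ)) := by rw [← h]; simp
  rcases h0 with h0 | h0 <;> rcases h1 with h1 | h1
  · exact absurd (h0.trans h1.symm) hne
  · exact ⟨u, v, huv, h0, h1⟩
  · exact ⟨v, u, by rw [huv, Sym2.eq_swap], h0, h1⟩
  · exact absurd (h0.trans h1.symm) hne

theorem int_nv (e : G.edgeSet) (u : ℝ) (hu : u ∈ Set.Ioo (0:ℝ) 1) (w : V) : Dg.arc e u ≠ Dg.vert w := by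
  intro h
  obtain ⟨a, b, h1, h2, h3⟩ := orient Dg e
  have hI := Set.Ioo_subset_Icc_self hu
  have := Dg.arc_vertex e u hI w h
  rw [h1, Sym2.mem_iff] at this
  rcases this with rfl | rfl
  · have := Dg.arc_inj e hI (by simp) (h.trans h2.symm)
    exact hu.1.ne' this
  · have := Dg.arc_inj e hI (by simp) (h.trans h3.symm)
    exact hu.2.ne this

theorem nv_int (e : G.edgeSet) (u : ℝ) (hu : u ∈ Set.Icc (0:ℝ) 1) (h : ∀ w, Dg.vert w ≠ Dg.arc e u) :
    u ∈ Set.Ioo (0:ℝ) 1 := by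
  obtain ⟨a, b, h1, h2, h3⟩ := orient Dg e
  constructor
  · refine lt_of_le_of_ne hu.1 ?_
    rintro rfl; exact h a h2.symm
  · refine lt_of_le_of_ne hu.2 ?_
    rintro rfl; exact h b h3.symm

/-- crossing times -/
def Tc (e : G.edgeSet) : Set ℝ := {t | t ∈ Set.Ioo (0:ℝ) 1 ∧ ∃ f, f ≠ e ∧ Dg.arc e t ∈ Dg.img f}

theorem crosses_of {e f : G.edgeSet} {t u : ℝ} (ht : t ∈ Set.Ioo (0:ℝ) 1) (hu : u ∈ Set.Icc (0:ℝ) 1)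
    (hne : e ≠ f) (h : Dg.arc e t = Dg.arc f u) : Dg.Crosses e f :=
  ⟨hne, Dg.arc e t, ⟨⟨t, Set.Ioo_subset_Icc_self ht, rfl⟩, ⟨u, hu, h.symm⟩⟩,
    fun w hw => int_nv Dg e t ht w hw.symm⟩

theorem nonadj_of {e f : G.edgeSet} (h : Dg.Crosses e f) :
    ¬ ∃ w : V, w ∈ (e : Sym2 V) ∧ w ∈ (f : Sym2 V) := by
  intro hw
  obtain ⟨hne, p, ⟨h1, h2⟩, h3⟩ := h
  obtain ⟨w, -, -, h4⟩ := Dg.adj_meet e f hne hw p h1 h2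
  exact h3 w h4.symm

theorem Tc_choice (e : G.edgeSet) : ∃ F : ℝ → G.edgeSet, ∀ t ∈ Tc Dg e, F t ≠ e ∧ Dg.arc e t ∈ Dg.img (F t) := by
  have : ∀ t, ∃ f, t ∈ Tc Dg e → f ≠ e ∧ Dg.arc e t ∈ Dg.img f := by
    intro t
    by_cases h : t ∈ Tc Dg e
    · obtain ⟨f, hf⟩ := h.2
      exact ⟨f, fun _ => hf⟩
    · exact ⟨e, fun h' => absurd h' h⟩
  choose F hF using this
  exact ⟨F, hF⟩

variable [Finite G.edgeSet]

theorem Tc_fin (e : G.edgeSet) : (Tc Dg e).Finite ∧ (Tc Dg e).ncard ≤ {f | Dg.Crosses e f}.ncard := by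
  obtain ⟨F, hF⟩ := Tc_choice Dg e
  have hcr : ∀ t ∈ Tc Dg e, Dg.Crosses e (F t) := by
    intro t ht
    obtain ⟨u, hu, h⟩ := (hF t ht).2
    exact crosses_of Dg ht.1 hu (hF t ht).1.symm h.symm
  have inj : Set.InjOn F (Tc Dg e) := by
    intro t ht t' ht' h
    have h1 := Dg.nonadj_meet e (F t) (nonadj_of Dg (hcr t ht))
    have h2 := h1 ⟨⟨t, Set.Ioo_subset_Icc_self ht.1, rfl⟩, (hF t ht).2⟩
      ⟨⟨t', Set.Ioo_subset_Icc_self ht'.1, rfl⟩, by rw [h]; exact (hF t' ht').2⟩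
    exact Dg.arc_inj e (Set.Ioo_subset_Icc_self ht.1) (Set.Ioo_subset_Icc_self ht'.1) h2
  constructor
  · exact Set.Finite.of_finite_image (Set.toFinite _) inj
  · exact Set.ncard_le_ncard_of_injOn F hcr inj (Set.toFinite _)

end
end BCN

namespace BCN
open Equiv Equiv.Perm Finset
open Classical in
theorem exists_od {V : Type} {G : SimpleGraph V} [Fintype G.edgeSet] (Dg : Drawing G) (k : ℕ) (hk : k ≤ 2)
    (hK : Dg.AtMostKCrossings k) (col : V → Bool) (hcol : ∀ u v, G.Adj u v → col u ≠ col v)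
    (W : Finset V) (hW : ∀ u v, G.Adj u v → u ∈ W)
    (hdeg : ∀ (e : G.edgeSet) (v : V), v ∈ e.1 → ∃ f : G.edgeSet, f ≠ e ∧ v ∈ f.1) :
    ∃ o : OD V G.edgeSet, o.W = W ∧ (∀ e, o.x e ≤ k) ∧ (∀ e, e.1 = s(o.a e, o.b e)) ∧
      ∀ e i, 0 < i → i ≤ o.x e →
      (univ.filter fun e' => ∃ j, 0 < j ∧ j ≤ o.x e' ∧ o.arc e' (o.τ e' j) = o.arc e (o.τ e i)).card ≤ k + 1 := by
  choose a b hab ha hb using orient Dg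
  have hτ : ∀ e, ∃ τ : ℕ → ℝ, τ 0 = 0 ∧ τ ((Tc Dg e).ncard + 1) = 1 ∧ (∀ i ≤ (Tc Dg e).ncard, τ i < τ (i + 1)) ∧
    (∀ t, t ∈ Tc Dg e ↔ ∃ i, 0 < i ∧ i ≤ (Tc Dg e).ncard ∧ τ i = t) := by
    intro e
    have hf := (Tc_fin Dg e).1
    obtain ⟨τ, h1, h2, h3, h4⟩ := enum_times hf.toFinset (fun t ht => (hf.mem_toFinset.1 ht).1)
    rw [← Set.ncard_eq_toFinset_card _ hf] at h2 h3 h4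
    exact ⟨τ, h1, h2, h3, fun t => by rw [← h4, hf.mem_toFinset]⟩
  choose τ τ0 τ1 τlt τT using hτ
  have hx : ∀ e, (Tc Dg e).ncard ≤ k := fun e => (Tc_fin Dg e).2.trans (hK e)
  have hadj : ∀ e : G.edgeSet, G.Adj (a e) (b e) := by
    intro e
    have := e.2
    rw [hab e] at this
    exact this
  have memT : ∀ e i, 0 < i → i ≤ (Tc Dg e).ncard → τ e i ∈ Tc Dg e := fun e i h h' => (τT e _).2 ⟨i, h, h', rfl⟩
  -- crossing of edges at common points
  have hcr : ∀ e f i j, e ≠ f → 0 < i → i ≤ (Tc Dg e).ncard → 0 < j → j ≤ (Tc Dg f).ncard →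
      Dg.arc e (τ e i) = Dg.arc f (τ f j) → Dg.Crosses e f := by
    intro e f i j hne h1 h2 h3 h4 h
    exact crosses_of Dg (memT e i h1 h2).1 (Set.Ioo_subset_Icc_self (memT f j h3 h4).1) hne h
  have honce : ∀ e f i j i' j', e ≠ f → 0 < i → i ≤ (Tc Dg e).ncard → 0 < j → j ≤ (Tc Dg f).ncard →
      Dg.arc e (τ e i) = Dg.arc f (τ f j) → 0 < i' → i' ≤ (Tc Dg e).ncard → 0 < j' → j' ≤ (Tc Dg f).ncard →
      Dg.arc e (τ e i') = Dg.arc f (τ f j') → τ e i = τ e i' := by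
    intro e f i j i' j' hne h1 h2 h3 h4 h h1' h2' h3' h4' h'
    have m1 := Set.Ioo_subset_Icc_self (memT e i h1 h2).1
    have m2 := Set.Ioo_subset_Icc_self (memT f j h3 h4).1
    have m1' := Set.Ioo_subset_Icc_self (memT e i' h1' h2').1
    have m2' := Set.Ioo_subset_Icc_self (memT f j' h3' h4').1
    have := Dg.nonadj_meet e f (nonadj_of Dg (hcr e f i j hne h1 h2 h3 h4 h)) ⟨⟨_, m1, rfl⟩, ⟨_, m2, h.symm⟩⟩
      ⟨⟨_, m1', rfl⟩, ⟨_, m2', h'.symm⟩⟩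
    exact Dg.arc_inj e m1 m1' this
  have τinj : ∀ e i j, i ≤ (Tc Dg e).ncard → j ≤ (Tc Dg e).ncard → τ e i = τ e j → i = j := by
    intro e
    have mono : ∀ i j, i < j → j ≤ (Tc Dg e).ncard → τ e i < τ e j := by
      intro i j hij
      induction j, hij using Nat.le_induction with
      | base => intro h; exact τlt e i (by omega)
      | succ j hj' ih => intro h; exact (ih (by omega)).trans (τlt e j (by omega))
    intro i j hi hj h
    rcases lt_trichotomy i j with h1 | h1 | h1
    · exact absurd h (mono i j h1 hj).ne
    · exact h1
    · exact absurd h (mono j i h1 hi).ne'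
  have hhit : ∀ e f, ∀ u ∈ Set.Ioo (0:ℝ) 1, ∀ u' ∈ Set.Icc (0:ℝ) 1, e ≠ f → Dg.arc e u = Dg.arc f u' →
      ∃ i, 0 < i ∧ i ≤ (Tc Dg e).ncard ∧ τ e i = u := by
    intro e f u hu u' hu' hne h
    exact (τT e u).1 ⟨hu, f, hne.symm, ⟨u', hu', h.symm⟩⟩
  -- another edge through each crossing point
  have hother : ∀ e i, 0 < i → i ≤ (Tc Dg e).ncard → ∃ f j, f ≠ e ∧ 0 < j ∧ j ≤ (Tc Dg f).ncard ∧
      Dg.arc f (τ f j) = Dg.arc e (τ e i) := by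
    intro e i h1 h2
    obtain ⟨hI, f, hne, u, hu, h⟩ := memT e i h1 h2
    have hu' : u ∈ Set.Ioo (0:ℝ) 1 := nv_int Dg f u hu (fun w hw => int_nv Dg e _ hI w (h.symm.trans hw.symm))
    obtain ⟨j, h3, h4, h5⟩ := hhit f e u hu' _ (Set.Ioo_subset_Icc_self hI) hne h
    exact ⟨f, j, hne, h3, h4, by rw [h5, h]⟩
  let M : G.edgeSet → ℕ → Finset G.edgeSet := fun e i => univ.filter fun e' => ∃ j, 0 < j ∧ j ≤ (Tc Dg e').ncard ∧
    Dg.arc e' (τ e' j) = Dg.arc e (τ e i)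
  have memM : ∀ e i e', e' ∈ M e i ↔ ∃ j, 0 < j ∧ j ≤ (Tc Dg e').ncard ∧
    Dg.arc e' (τ e' j) = Dg.arc e (τ e i) := by intro e i e'; simp [M]
  let K : G.edgeSet → Finset G.edgeSet := fun e => univ.filter fun f => Dg.Crosses e f
  have hKc : ∀ e, (K e).card ≤ k := by
    intro e
    have := hK e
    rw [Set.ncard_eq_toFinset_card' ] at this
    refine le_trans (le_of_eq ?_) this
    congr 1
    ext f; simp [K]
  have hMK : ∀ e i, 0 < i → i ≤ (Tc Dg e).ncard → (M e i).erase e ⊆ K e := by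
    intro e i h1 h2 f hf
    rw [mem_erase, memM] at hf
    obtain ⟨hne, j, h3, h4, h5⟩ := hf
    simp only [K, mem_filter, mem_univ, true_and]
    exact hcr e f i j hne.symm h1 h2 h3 h4 h5.symm
  have hMe : ∀ e i, 0 < i → i ≤ (Tc Dg e).ncard → e ∈ M e i := fun e i h1 h2 => (memM e i e).2 ⟨i, h1, h2, rfl⟩
  have hMc : ∀ e i, 0 < i → i ≤ (Tc Dg e).ncard → (M e i).card ≤ k + 1 := by
    intro e i h1 h2
    have := card_le_card (hMK e i h1 h2)
    rw [card_erase_of_mem (hMe e i h1 h2)] at this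
    have := hKc e
    omega
  have hM2 : ∀ e i, 0 < i → i ≤ (Tc Dg e).ncard → 2 ≤ (M e i).card := by
    intro e i h1 h2
    obtain ⟨f, j, hne, h3, h4, h5⟩ := hother e i h1 h2
    exact Finset.one_lt_card.2 ⟨e, hMe e i h1 h2, f, (memM e i f).2 ⟨j, h3, h4, h5⟩, hne.symm⟩
  have hadjne : ∀ e f, Dg.Crosses e f → a e ≠ a f ∧ a e ≠ b f ∧ b e ≠ a f ∧ b e ≠ b f := by
    intro e f h
    have := nonadj_of Dg h
    rw [hab e, hab f] at this
    refine ⟨fun h => this ⟨a e, by simp, by simp [h]⟩, fun h => this ⟨a e, by simp, by simp [h]⟩,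
      fun h => this ⟨b e, by simp, by simp [h]⟩, fun h => this ⟨b e, by simp, by simp [h]⟩⟩
  refine ⟨{
    vert := Dg.vert
    vert_inj := Dg.vert_inj
    W := W
    col := col
    a := a
    b := b
    aW := fun e => hW _ _ (hadj e)
    bW := fun e => hW _ _ (hadj e).symm
    col_ne := fun e => hcol _ _ (hadj e)
    simp1 := fun e f h1 h2 => Subtype.ext (by rw [hab e, hab f, h1, h2])
    simp2 := fun e f h1 h2 => Subtype.ext (by rw [hab e, hab f, h1, h2, Sym2.eq_swap])
    arc := Dg.arc
    arc_cont := Dg.arc_cont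
    arc_inj := Dg.arc_inj
    arc0 := ha
    arc1 := hb
    iv := fun e u hu w => int_nv Dg e u hu w
    x := fun e => (Tc Dg e).ncard
    τ := τ
    τ0 := τ0
    τ1 := τ1
    τlt := τlt
    hit := hhit
    nonadj := fun e f i j hne h1 h2 h3 h4 h => hadjne e f (hcr e f i j hne h1 h2 h3 h4 h)
    once := fun e f i j i' j' hne h1 h2 h3 h4 h h1' h2' h3' h4' h' =>
      τinj e i i' h2 h2' (honce e f i j i' j' hne h1 h2 h3 h4 h h1' h2' h3' h4' h')
    m23 := fun e i h1 h2 => by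
      have q1 := hMc e i h1 h2
      have q2 := hM2 e i h1 h2
      change (M e i).card = 2 ∨ (M e i).card = 3
      omega
    x2 := fun e => (hx e).trans hk
    Y1 := fun e i h1 h2 h3 => by
      change (M e i).card ≠ 2 at h3
      by_contra hne
      have q2 := hM2 e i h1 h2
      obtain ⟨i', h1', h2', hii⟩ : ∃ i', 0 < i' ∧ i' ≤ (Tc Dg e).ncard ∧ i' ≠ i := by
        by_cases hi : i = 1
        · exact ⟨2, by omega, by omega, by omega⟩
        · exact ⟨1, by omega, by omega, by omega⟩
      obtain ⟨f, j, hfe, h4, h5, h6⟩ := hother e i' h1' h2'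
      have hfK : f ∈ K e := by
        simp only [K, mem_filter, mem_univ, true_and]
        exact hcr e f i' j hfe.symm h1' h2' h4 h5 h6.symm
      have hfM : f ∉ (M e i).erase e := by
        intro hf
        rw [mem_erase, memM] at hf
        obtain ⟨-, j', h7, h8, h9⟩ := hf
        exact hii (τinj e i' i h2' h2 (honce e f i' j i j' hfe.symm h1' h2' h4 h5 h6.symm h1 h2 h7 h8 h9.symm))
      have := card_le_card (Finset.insert_subset hfK (hMK e i h1 h2))
      rw [card_insert_of_notMem hfM, card_erase_of_mem (hMe e i h1 h2)] at this
      have := hKc e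
      omega
    dega := fun e => by
      obtain ⟨f, h1, h2⟩ := hdeg e (a e) (by rw [hab e]; simp)
      rw [hab f, Sym2.mem_iff] at h2
      exact ⟨f, h1, h2.imp Eq.symm Eq.symm⟩
    degb := fun e => by
      obtain ⟨f, h1, h2⟩ := hdeg e (b e) (by rw [hab e]; simp)
      rw [hab f, Sym2.mem_iff] at h2
      exact ⟨f, h1, h2.imp Eq.symm Eq.symm⟩ }, rfl, hx, hab, ?_⟩
  intro e i h1 h2
  exact hMc e i h1 h2

end BCN

namespace BCN
open Equiv Equiv.Perm Finset

/-- restriction of a drawing to a subgraph -/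
def Drawing.mono {V : Type} {G G' : SimpleGraph V} (h : G' ≤ G) (Dg : Drawing G) : Drawing G' where
  vert := Dg.vert
  vert_inj := Dg.vert_inj
  arc e := Dg.arc ⟨e.1, SimpleGraph.edgeSet_mono h e.2⟩
  arc_cont e := Dg.arc_cont _
  arc_inj e := Dg.arc_inj _
  arc_ends e u v huv := Dg.arc_ends _ u v huv
  arc_vertex e t ht w hw := Dg.arc_vertex _ t ht w hw
  adj_meet e f hne hw p hp hp' := Dg.adj_meet _ _ (fun h' => hne (Subtype.ext (Subtype.mk.inj h'))) hw p hp hp'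
  nonadj_meet e f h := Dg.nonadj_meet _ _ h

theorem mono_crosses {V : Type} {G G' : SimpleGraph V} (h : G' ≤ G) (Dg : Drawing G) (e f : G'.edgeSet) :
    (Drawing.mono h Dg).Crosses e f ↔
      Dg.Crosses ⟨e.1, SimpleGraph.edgeSet_mono h e.2⟩ ⟨f.1, SimpleGraph.edgeSet_mono h f.2⟩ := by
  unfold Drawing.Crosses
  have : e ≠ f ↔ (⟨e.1, SimpleGraph.edgeSet_mono h e.2⟩ : G.edgeSet) ≠ ⟨f.1, SimpleGraph.edgeSet_mono h f.2⟩ := by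
    simp [Subtype.ext_iff]
  rw [← this]
  exact Iff.rfl

theorem mono_atMost {V : Type} [Finite V] {G G' : SimpleGraph V} (h : G' ≤ G) (Dg : Drawing G) (k : ℕ)
    (hK : Dg.AtMostKCrossings k) : (Drawing.mono h Dg).AtMostKCrossings k := by
  intro e
  refine le_trans ?_ (hK ⟨e.1, SimpleGraph.edgeSet_mono h e.2⟩)
  apply Set.ncard_le_ncard_of_injOn (fun f => (⟨f.1, SimpleGraph.edgeSet_mono h f.2⟩ : G.edgeSet))
  · intro f hf
    exact (mono_crosses h Dg e f).1 hf
  · intro f _ f' _ hff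
    exact Subtype.ext (Subtype.mk.inj hff)

section
variable {V : Type} [Finite V]

theorem two_edges {G : SimpleGraph V} (W : Finset V) (hW : ∀ u v, G.Adj u v → u ∈ W)
    (hd : ∀ v ∈ W, 2 ≤ (G.incidenceSet v).ncard) (e : G.edgeSet) (v : V) (hv : v ∈ e.1) :
    ∃ f : G.edgeSet, f ≠ e ∧ v ∈ f.1 := by
  have hvW : v ∈ W := by
    obtain ⟨w, hw⟩ := Sym2.mem_iff_exists.1 hv
    have := e.2
    rw [hw] at this
    exact hW v w this
  have h := hd v hvW
  have h1 : 1 < (G.incidenceSet v).ncard := h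
  obtain ⟨f, hf, hne⟩ := Set.exists_ne_of_one_lt_ncard h1 e.1
  exact ⟨⟨f, hf.1⟩, fun h => hne (congrArg Subtype.val h), hf.2⟩

theorem core0 {G : SimpleGraph V} (Dg : Drawing G) (hK : Dg.AtMostKCrossings 0) (hb : IsBipartite G)
    (W : Finset V) (hW : ∀ u v, G.Adj u v → u ∈ W) (hd : ∀ v ∈ W, 3 ≤ (G.incidenceSet v).ncard)
    (hne : W.Nonempty) : 2 * (G.edgeSet.ncard : ℤ) ≤ 4 * W.card - 8 := by
  classical
  have : Fintype G.edgeSet := Fintype.ofFinite _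
  obtain ⟨col, hcol⟩ := hb
  obtain ⟨o, h1, h2, h3, h4⟩ := exists_od Dg 0 (by omega) hK col hcol W hW
    (two_edges W hW fun v hv => by have := hd v hv; omega)
  have : Nonempty G.edgeSet := by
    obtain ⟨v, hv⟩ := hne
    have := hd v hv
    obtain ⟨f, hf⟩ := Set.nonempty_of_ncard_ne_zero (s := G.incidenceSet v) (by omega)
    exact ⟨⟨f, hf.1⟩⟩
  have h5 := o.cd.bound0 (fun e => Nat.le_zero.1 (h2 e))
  have h6 : o.cd.W = W := h1
  rw [h6, ← Nat.card_eq_fintype_card] at h5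
  exact h5

theorem core1 {G : SimpleGraph V} (Dg : Drawing G) (hK : Dg.AtMostKCrossings 1) (hb : IsBipartite G)
    (W : Finset V) (hW : ∀ u v, G.Adj u v → u ∈ W) (hd : ∀ v ∈ W, 4 ≤ (G.incidenceSet v).ncard)
    (hne : W.Nonempty) : 2 * (G.edgeSet.ncard : ℤ) ≤ 6 * W.card - 16 := by
  classical
  have : Fintype G.edgeSet := Fintype.ofFinite _
  obtain ⟨col, hcol⟩ := hb
  obtain ⟨o, h1, h2, h3, h4⟩ := exists_od Dg 1 (by omega) hK col hcol W hW
    (two_edges W hW fun v hv => by have := hd v hv; omega)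
  have : Nonempty G.edgeSet := by
    obtain ⟨v, hv⟩ := hne
    have := hd v hv
    obtain ⟨f, hf⟩ := Set.nonempty_of_ncard_ne_zero (s := G.incidenceSet v) (by omega)
    exact ⟨⟨f, hf.1⟩⟩
  have h6 : o.cd.W = W := h1
  have h5 := o.cd.bound1 h2 (by
      intro e i hi hi'
      have q1 := h4 e i hi hi'
      have q2 := o.m23 e i hi hi'
      have q3 : o.cd.m (o.cd.ip e i) = (univ.filter fun e' => ∃ j, 0 < j ∧ j ≤ o.x e' ∧ o.arc e' (o.τ e' j) = o.arc e (o.τ e i)).card := by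
        rfl
      rw [q3]
      omega) (by
      intro v hv
      rw [h6] at hv
      refine (hd v hv).trans ?_
      rw [← Set.ncard_coe_finset]
      have : G.incidenceSet v = Subtype.val '' (((univ.filter fun e => o.cd.a e = v ∨ o.cd.b e = v) : Finset G.edgeSet) : Set G.edgeSet) := by
        ext f
        constructor
        · intro hf
          refine ⟨⟨f, hf.1⟩, ?_, rfl⟩
          have : v ∈ (⟨f, hf.1⟩ : G.edgeSet).1 := hf.2
          rw [h3 ⟨f, hf.1⟩, Sym2.mem_iff] at this
          simp only [coe_filter, mem_univ, true_and, Set.mem_ofPred_eq]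
          exact this.imp Eq.symm Eq.symm
        · rintro ⟨e, he, rfl⟩
          simp only [coe_filter, mem_univ, true_and, Set.mem_ofPred_eq] at he
          refine ⟨e.2, ?_⟩
          rw [h3 e, Sym2.mem_iff]
          exact he.imp Eq.symm Eq.symm
      rw [this]
      exact Set.ncard_image_le (Set.toFinite _))
  rw [h6, ← Nat.card_eq_fintype_card] at h5
  exact h5

theorem core2 {G : SimpleGraph V} (Dg : Drawing G) (hK : Dg.AtMostKCrossings 2) (hb : IsBipartite G)
    (W : Finset V) (hW : ∀ u v, G.Adj u v → u ∈ W) (hd : ∀ v ∈ W, 4 ≤ (G.incidenceSet v).ncard)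
    (hne : W.Nonempty) : 2 * (G.edgeSet.ncard : ℤ) ≤ 7 * W.card - 14 := by
  classical
  have : Fintype G.edgeSet := Fintype.ofFinite _
  obtain ⟨col, hcol⟩ := hb
  obtain ⟨o, h1, h2, h3, h4⟩ := exists_od Dg 2 (by omega) hK col hcol W hW
    (two_edges W hW fun v hv => by have := hd v hv; omega)
  have : Nonempty G.edgeSet := by
    obtain ⟨v, hv⟩ := hne
    have := hd v hv
    obtain ⟨f, hf⟩ := Set.nonempty_of_ncard_ne_zero (s := G.incidenceSet v) (by omega)
    exact ⟨⟨f, hf.1⟩⟩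
  have h5 := o.cd.bound2
  have h6 : o.cd.W = W := h1
  rw [h6, ← Nat.card_eq_fintype_card] at h5
  have h7 : (Nat.card G.edgeSet : ℤ) = G.edgeSet.ncard := rfl
  omega

/-- induction over vertices -/
theorem dens (k δ n0 : ℕ) (A B : ℤ) (hA : 2 * (δ : ℤ) ≤ A) (hn0 : 0 < n0)
    (base : ∀ (G : SimpleGraph V) (W : Finset V), IsBipartite G → (∀ u v, G.Adj u v → u ∈ W) → W.card = n0 →
      2 * (G.edgeSet.ncard : ℤ) ≤ A * W.card - B)
    (core : ∀ (G : SimpleGraph V) (Dg : Drawing G), Dg.AtMostKCrossings k → IsBipartite G →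
      ∀ W : Finset V, (∀ u v, G.Adj u v → u ∈ W) → (∀ v ∈ W, δ + 1 ≤ (G.incidenceSet v).ncard) → W.Nonempty →
      2 * (G.edgeSet.ncard : ℤ) ≤ A * W.card - B)
    (j : ℕ) : ∀ (G : SimpleGraph V) (Dg : Drawing G), Dg.AtMostKCrossings k → IsBipartite G →
      ∀ W : Finset V, (∀ u v, G.Adj u v → u ∈ W) → W.card = n0 + j →
      2 * (G.edgeSet.ncard : ℤ) ≤ A * W.card - B := by
  classical
  induction j with
  | zero => intro G Dg hK hb W hW hc; exact base G W hb hW hc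
  | succ j ih =>
    intro G Dg hK hb W hW hc
    by_cases hd : ∀ v ∈ W, δ + 1 ≤ (G.incidenceSet v).ncard
    · exact core G Dg hK hb W hW hd (card_pos.1 (by omega))
    · push Not at hd
      obtain ⟨v, hv, hlt⟩ := hd
      have hle : G.deleteIncidenceSet v ≤ G := G.deleteIncidenceSet_le v
      obtain ⟨col, hcol⟩ := hb
      have := ih (G.deleteIncidenceSet v) (Drawing.mono hle Dg) (mono_atMost hle Dg k hK)
        ⟨col, fun u w h => hcol u w (hle h)⟩ (W.erase v) (by
          intro u w h
          rw [mem_erase]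
          rw [SimpleGraph.deleteIncidenceSet_adj] at h
          exact ⟨h.2.1, hW u w h.1⟩) (by rw [card_erase_of_mem hv]; omega)
      rw [SimpleGraph.edgeSet_deleteIncidenceSet, card_erase_of_mem hv] at this
      have h2 := Set.ncard_sdiff_add_ncard_of_subset (G.incidenceSet_subset v) (Set.toFinite _)
      have h3 : ((W.card - 1 : ℕ) : ℤ) = (W.card : ℤ) - 1 := by push_cast [Nat.cast_sub (show 1 ≤ W.card by omega)]; ring
      rw [h3, mul_sub] at this
      zify at h2 hlt
      linarith

theorem bip_edges (G : SimpleGraph V) (W : Finset V) (hb : IsBipartite G) (hW : ∀ u v, G.Adj u v → u ∈ W) :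
    ∃ p q : ℕ, p + q = W.card ∧ G.edgeSet.ncard ≤ p * q := by
  classical
  obtain ⟨col, hcol⟩ := hb
  refine ⟨(W.filter fun v => col v = true).card, (W.filter fun v => ¬ col v = true).card,
    Finset.card_filter_add_card_filter_not _, ?_⟩
  rw [← card_product, ← Set.ncard_coe_finset]
  have : G.edgeSet ⊆ (fun x : V × V => s(x.1, x.2)) '' (((W.filter fun v => col v = true) ×ˢ (W.filter fun v => ¬ col v = true) : Finset (V × V)) : Set (V × V)) := by
    intro e he
    induction e using Sym2.ind with
    | h u v =>
      have h : G.Adj u v := he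
      have hc := hcol u v h
      have hu := hW u v h
      have hv := hW v u h.symm
      cases hcu : col u
      · have hcv : col v = true := by
          rw [hcu] at hc
          cases h : col v
          · exact absurd h.symm hc
          · rfl
        refine ⟨(v, u), ?_, Sym2.eq_swap⟩
        simp [hu, hv, hcu, hcv]
      · have hcv : col v = false := by
          rw [hcu] at hc
          cases h : col v
          · rfl
          · exact absurd h.symm hc
        refine ⟨(u, v), ?_, rfl⟩
        simp [hu, hv, hcu, hcv]
  exact (Set.ncard_le_ncard this (Set.toFinite _)).trans (Set.ncard_image_le (Set.toFinite _))

theorem bip3 (G : SimpleGraph V) (W : Finset V) (hb : IsBipartite G) (hW : ∀ u v, G.Adj u v → u ∈ W)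
    (h : W.card = 3) : G.edgeSet.ncard ≤ 2 := by
  obtain ⟨p, q, h1, h2⟩ := bip_edges G W hb hW
  have hp : p ≤ 3 := by omega
  interval_cases p
  · omega
  · omega
  · omega
  · have : q = 0 := by omega
    subst this; omega
theorem bip4 (G : SimpleGraph V) (W : Finset V) (hb : IsBipartite G) (hW : ∀ u v, G.Adj u v → u ∈ W)
    (h : W.card = 4) : G.edgeSet.ncard ≤ 4 := by
  obtain ⟨p, q, h1, h2⟩ := bip_edges G W hb hW
  have hp : p ≤ 4 := by omega
  interval_cases p <;> omega

theorem dens0 (n : ℕ) (hn : 3 ≤ n) (G : SimpleGraph (Fin n)) (Dg : Drawing G) (hK : Dg.AtMostKCrossings 0)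
    (hb : IsBipartite G) : 2 * (G.edgeSet.ncard : ℤ) ≤ 4 * n - 8 := by
  have := dens (V := Fin n) 0 2 3 4 8 (by norm_num) (by norm_num)
    (fun G W hb hW hc => by have := bip3 G W hb hW hc; omega)
    (fun G Dg hK hb W hW hd hne => core0 Dg hK hb W hW hd hne) (n - 3) G Dg hK hb univ (fun _ _ _ => mem_univ _)
    (by simp; omega)
  simpa using this
theorem dens1 (n : ℕ) (hn : 4 ≤ n) (G : SimpleGraph (Fin n)) (Dg : Drawing G) (hK : Dg.AtMostKCrossings 1)
    (hb : IsBipartite G) : 2 * (G.edgeSet.ncard : ℤ) ≤ 6 * n - 16 := by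
  have := dens (V := Fin n) 1 3 4 6 16 (by norm_num) (by norm_num)
    (fun G W hb hW hc => by have := bip4 G W hb hW hc; omega)
    (fun G Dg hK hb W hW hd hne => core1 Dg hK hb W hW hd hne) (n - 4) G Dg hK hb univ (fun _ _ _ => mem_univ _)
    (by simp; omega)
  simpa using this
theorem dens2 (n : ℕ) (hn : 3 ≤ n) (G : SimpleGraph (Fin n)) (Dg : Drawing G) (hK : Dg.AtMostKCrossings 2)
    (hb : IsBipartite G) : 2 * (G.edgeSet.ncard : ℤ) ≤ 7 * n - 14 := by
  have := dens (V := Fin n) 2 3 3 7 14 (by norm_num) (by norm_num)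
    (fun G W hb hW hc => by have := bip3 G W hb hW hc; omega)
    (fun G Dg hK hb W hW hd hne => core2 Dg hK hb W hW hd hne) (n - 3) G Dg hK hb univ (fun _ _ _ => mem_univ _)
    (by simp; omega)
  simpa using this
end
end BCN

namespace BCN
open Equiv Equiv.Perm Finset

section
variable {V : Type} [Finite V]

/-- number of ordered crossing pairs -/
noncomputable def NN {G : SimpleGraph V} (Dg : Drawing G) : ℕ :=
  {p : G.edgeSet × G.edgeSet | Dg.Crosses p.1 p.2}.ncard

theorem crosses_symm {G : SimpleGraph V} (Dg : Drawing G) {e f : G.edgeSet} (h : Dg.Crosses e f) : Dg.Crosses f e := by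
  obtain ⟨h1, p, h2, h3⟩ := h
  exact ⟨h1.symm, p, h2.symm, h3⟩

theorem NN_even {G : SimpleGraph V} (Dg : Drawing G) : Even (NN Dg) := by
  classical
  have : Fintype G.edgeSet := Fintype.ofFinite _
  let H : SimpleGraph G.edgeSet := { Adj := Dg.Crosses, symm := ⟨fun e f h => crosses_symm Dg h⟩, loopless := ⟨fun e h => h.1 rfl⟩ }
  have h := H.sum_degrees_eq_twice_card_edges
  have h2 : NN Dg = ∑ e, H.degree e := by
    unfold NN
    rw [Set.ncard_eq_toFinset_card']
    have : ({p : G.edgeSet × G.edgeSet | Dg.Crosses p.1 p.2} : Set _).toFinset =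
        (univ : Finset G.edgeSet).biUnion (fun e => ({e} : Finset G.edgeSet) ×ˢ H.neighborFinset e) := by
      ext ⟨e, f⟩
      simp [H]
    rw [this, card_biUnion]
    · apply Finset.sum_congr rfl
      intro e _
      rw [card_product, card_singleton, one_mul, SimpleGraph.card_neighborFinset_eq_degree]
    · intro e _ f _ hne
      rw [Function.onFun, Finset.disjoint_left]
      rintro ⟨x, y⟩ h1 h2
      simp only [mem_product, mem_singleton] at h1 h2
      exact hne (h1.1.symm.trans h2.1)
  rw [h2, h]
  exact even_two_mul _

theorem NN_delete {G : SimpleGraph V} (Dg : Drawing G) (e : G.edgeSet) :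
    ∃ Dg' : Drawing (G.deleteEdges {e.1}), NN Dg' + 2 * {f | Dg.Crosses e f}.ncard ≤ NN Dg := by
  have hle : G.deleteEdges {e.1} ≤ G := G.deleteEdges_le _
  refine ⟨Drawing.mono hle Dg, ?_⟩
  let ι : (G.deleteEdges {e.1}).edgeSet → G.edgeSet := fun f => ⟨f.1, SimpleGraph.edgeSet_mono hle f.2⟩
  have ιne : ∀ f, ι f ≠ e := by
    intro f hf
    have h1 := (Set.ext_iff.1 (SimpleGraph.edgeSet_deleteEdges (G := G) {e.1}) f.1).1 f.2
    exact h1.2 (congrArg Subtype.val hf)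
  have ιinj : Function.Injective ι := fun f f' h => Subtype.ext (Subtype.mk.inj h)
  let A : Set (G.edgeSet × G.edgeSet) := Prod.map ι ι '' {p | (Drawing.mono hle Dg).Crosses p.1 p.2}
  let B : Set (G.edgeSet × G.edgeSet) := (fun f => (e, f)) '' {f | Dg.Crosses e f}
  let C : Set (G.edgeSet × G.edgeSet) := (fun f => (f, e)) '' {f | Dg.Crosses e f}
  have hA : A.ncard = NN (Drawing.mono hle Dg) := Set.ncard_image_of_injective _ (ιinj.prodMap ιinj)
  have hB : B.ncard = {f | Dg.Crosses e f}.ncard :=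
    Set.ncard_image_of_injective _ (fun f f' h => (Prod.mk.inj h).2)
  have hC : C.ncard = {f | Dg.Crosses e f}.ncard :=
    Set.ncard_image_of_injective _ (fun f f' h => (Prod.mk.inj h).1)
  have d1 : Disjoint A B := by
    rw [Set.disjoint_left]
    rintro _ ⟨p, _, rfl⟩ ⟨f, _, h⟩
    exact ιne p.1 (Prod.mk.inj h).1.symm
  have d2 : Disjoint (A ∪ B) C := by
    rw [Set.disjoint_left]
    rintro _ (⟨p, _, rfl⟩ | ⟨f', hf', rfl⟩) ⟨f, _, h⟩
    · exact ιne p.2 (Prod.mk.inj h).2.symm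
    · have : Dg.Crosses e f' := hf'
      exact this.1 (Prod.mk.inj h).2
  have hsub : A ∪ B ∪ C ⊆ {p : G.edgeSet × G.edgeSet | Dg.Crosses p.1 p.2} := by
    rintro _ ((⟨p, hp, rfl⟩ | ⟨f, hf, rfl⟩) | ⟨f, hf, rfl⟩)
    · exact (mono_crosses hle Dg p.1 p.2).1 hp
    · exact hf
    · exact crosses_symm Dg hf
  have h := Set.ncard_le_ncard hsub (Set.toFinite _)
  rw [Set.ncard_union_eq d2 (Set.toFinite _) (Set.toFinite _), Set.ncard_union_eq d1 (Set.toFinite _) (Set.toFinite _),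
    hA, hB, hC] at h
  unfold NN at h ⊢
  omega

/-- induction over edges -/
theorem claim (k : ℕ) (B : ℤ) (f : ℕ → ℤ) (hf : ∀ m, f (m + 1) ≤ f m + 2 * (k + 1))
    (dens : ∀ (G : SimpleGraph V) (Dg : Drawing G), Dg.AtMostKCrossings k → IsBipartite G →
      2 * (G.edgeSet.ncard : ℤ) ≤ B)
    (low : ∀ (G : SimpleGraph V) (Dg : Drawing G), IsBipartite G → 2 * (G.edgeSet.ncard : ℤ) ≤ B →
      f G.edgeSet.ncard ≤ NN Dg) (m : ℕ) :
    ∀ (G : SimpleGraph V) (Dg : Drawing G), IsBipartite G → G.edgeSet.ncard = m → f m ≤ NN Dg := by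
  induction m with
  | zero =>
    intro G Dg hb hm
    by_cases h : 2 * (G.edgeSet.ncard : ℤ) ≤ B
    · rw [← hm]; exact low G Dg hb h
    · exfalso
      apply h
      apply dens G Dg _ hb
      intro e
      rw [Set.ncard_eq_zero (Set.toFinite _)] at hm
      exact ((Set.ext_iff.1 hm e.1).1 e.2).elim
  | succ m ih =>
    intro G Dg hb hm
    by_cases h : 2 * (G.edgeSet.ncard : ℤ) ≤ B
    · rw [← hm]; exact low G Dg hb h
    · have : ¬ Dg.AtMostKCrossings k := fun hK => h (dens G Dg hK hb)
      unfold Drawing.AtMostKCrossings at this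
      push Not at this
      obtain ⟨e, he⟩ := this
      obtain ⟨Dg', h'⟩ := NN_delete Dg e
      obtain ⟨col, hcol⟩ := hb
      have := ih _ Dg' ⟨col, fun u w h => hcol u w (G.deleteEdges_le _ h)⟩ (by
        rw [SimpleGraph.edgeSet_deleteEdges, Set.ncard_sdiff_singleton_of_mem e.2, hm]; rfl)
      have := hf m
      zify at h' he
      linarith
end

theorem claim1 (n : ℕ) (hn : 3 ≤ n) (G : SimpleGraph (Fin n)) (Dg : Drawing G) (hb : IsBipartite G) :
    2 * ((G.edgeSet.ncard : ℤ) - (2 * n - 4)) ≤ NN Dg :=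
  claim (V := Fin n) 0 (4 * n - 8) (fun m => 2 * ((m : ℤ) - (2 * n - 4))) (fun m => by push_cast; linarith)
    (fun G Dg hK hb => dens0 n hn G Dg hK hb) (fun G Dg hb h => by
      have : (0 : ℤ) ≤ NN Dg := by positivity
      linarith) _ G Dg hb rfl

theorem claim2 (n : ℕ) (hn : 4 ≤ n) (G : SimpleGraph (Fin n)) (Dg : Drawing G) (hb : IsBipartite G) :
    2 * (2 * (G.edgeSet.ncard : ℤ) - 5 * n + 12) ≤ NN Dg :=
  claim (V := Fin n) 1 (6 * n - 16) (fun m => 2 * (2 * (m : ℤ) - 5 * n + 12)) (fun m => by push_cast; linarith)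
    (fun G Dg hK hb => dens1 n hn G Dg hK hb) (fun G Dg hb h => by
      have := claim1 n (by omega) G Dg hb
      linarith) _ G Dg hb rfl

theorem claim3 (n : ℕ) (hn : 3 ≤ n) (G : SimpleGraph (Fin n)) (Dg : Drawing G) (hb : IsBipartite G) :
    6 * (G.edgeSet.ncard : ℤ) - 17 * n + 38 ≤ NN Dg := by
  rcases Nat.lt_or_ge n 4 with h | h
  · have h3 : n = 3 := by omega
    have := bip3 G univ hb (fun _ _ _ => mem_univ _) (by simp [h3])
    omega
  · exact claim (V := Fin n) 2 (7 * n - 14) (fun m => 6 * (m : ℤ) - 17 * n + 38) (fun m => by push_cast; linarith)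
      (fun G Dg hK hb => dens2 n hn G Dg hK hb) (fun G Dg hb h => by
      have := claim2 n (by omega) G Dg hb
      linarith) _ G Dg hb rfl

/-- straight-line drawing with vertices on a parabola -/
theorem exists_drawing (n : ℕ) (G : SimpleGraph (Fin n)) : Nonempty (Drawing G) := by
  have hor : ∀ e : G.edgeSet, ∃ a b, e.1 = s(a, b) ∧ a ≠ b := by
    rintro ⟨e, he⟩
    induction e using Sym2.ind with
    | h u v =>
      have h : G.Adj u v := he
      exact ⟨u, v, rfl, h.ne⟩
  choose a b hab hne using hor
  let X : Fin n → ℝ := fun i => ((i : ℕ) : ℝ)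
  have Xinj : ∀ i j, X i = X j → i = j := by
    intro i j h
    exact Fin.ext (Nat.cast_injective h)
  let vert : Fin n → ℝ × ℝ := fun i => (X i, X i ^ 2)
  have vinj : Function.Injective vert := fun i j h => Xinj _ _ (Prod.mk.inj h).1
  let arc : G.edgeSet → ℝ → ℝ × ℝ := fun e t =>
    (X (a e) + t * (X (b e) - X (a e)), X (a e) ^ 2 + t * (X (b e) ^ 2 - X (a e) ^ 2))
  have line : ∀ e t, (arc e t).2 = (X (a e) + X (b e)) * (arc e t).1 - X (a e) * X (b e) := by
    intro e t; simp only [arc]; ring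
  have Xne : ∀ e, X (b e) - X (a e) ≠ 0 := by
    intro e h
    exact hne e (Xinj _ _ (by linarith))
  have meet : ∀ (e f : G.edgeSet) (p q : ℝ × ℝ), e ≠ f →
      p ∈ arc e '' Set.Icc (0:ℝ) 1 → p ∈ arc f '' Set.Icc (0:ℝ) 1 →
      (X (a e) + X (b e)) * p.1 - X (a e) * X (b e) = (X (a f) + X (b f)) * p.1 - X (a f) * X (b f) := by
    rintro e f p q hne ⟨t, ht, rfl⟩ ⟨u, hu, h⟩
    rw [← line, ← h, ← line]
  refine ⟨{
    vert := vert
    vert_inj := vinj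
    arc := arc
    arc_cont := fun e => by
      apply Continuous.continuousOn
      simp only [arc]; fun_prop
    arc_inj := fun e t _ u _ h => by
      have h1 := (Prod.mk.inj h).1
      have h2 : (t - u) * (X (b e) - X (a e)) = 0 := by linarith
      rcases mul_eq_zero.1 h2 with h3 | h3
      · linarith
      · exact absurd h3 (Xne e)
    arc_ends := fun e u v huv => by
      have h0 : arc e 0 = vert (a e) := by simp [arc, vert]
      have h1 : arc e 1 = vert (b e) := by simp [arc, vert]
      rw [h0, h1]
      rw [hab e, Sym2.eq_iff] at huv
      rcases huv with ⟨rfl, rfl⟩ | ⟨rfl, rfl⟩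
      · rfl
      · exact Set.pair_comm _ _
    arc_vertex := fun e t ht w h => by
      have h1 := line e t
      rw [h] at h1
      have h2 : (X w - X (a e)) * (X w - X (b e)) = 0 := by
        simp only [vert] at h1
        linarith
      rw [hab e, Sym2.mem_iff]
      rcases mul_eq_zero.1 h2 with h3 | h3
      · left; exact Xinj _ _ (by linarith)
      · right; exact Xinj _ _ (by linarith)
    adj_meet := fun e f hef hw p hp hp' => by
      obtain ⟨w, h1, h2⟩ := hw
      refine ⟨w, h1, h2, ?_⟩
      have hm := meet e f p p hef hp hp'
      obtain ⟨t, ht, rfl⟩ := hp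
      have hl := line e t
      have key : ∀ c d, s(a e, b e) = s(w, c) → s(a f, b f) = s(w, d) → (arc e t).1 = X w := by
        intro c d h3 h4
        have hcd : c ≠ d := by
          rintro rfl
          exact hef (Subtype.ext (by rw [hab e, hab f, h3, h4]))
        have s1 : X (a e) + X (b e) = X w + X c ∧ X (a e) * X (b e) = X w * X c := by
          rw [Sym2.eq_iff] at h3
          rcases h3 with ⟨h5, h6⟩ | ⟨h5, h6⟩
          · rw [h5, h6]; exact ⟨rfl, rfl⟩
          · rw [h5, h6]; exact ⟨by ring, by ring⟩
        have s2 : X (a f) + X (b f) = X w + X d ∧ X (a f) * X (b f) = X w * X d := by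
          rw [Sym2.eq_iff] at h4
          rcases h4 with ⟨h5, h6⟩ | ⟨h5, h6⟩
          · rw [h5, h6]; exact ⟨rfl, rfl⟩
          · rw [h5, h6]; exact ⟨by ring, by ring⟩
        rw [s1.1, s1.2, s2.1, s2.2] at hm
        have h7 : (X c - X d) * ((arc e t).1 - X w) = 0 := by linarith
        rcases mul_eq_zero.1 h7 with h8 | h8
        · exact absurd (Xinj _ _ (by linarith)) hcd
        · linarith
      obtain ⟨c, hc⟩ := Sym2.mem_iff_exists.1 h1
      obtain ⟨d, hd⟩ := Sym2.mem_iff_exists.1 h2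
      have hx := key c d (by rw [← hab e, hc]) (by rw [← hab f, hd])
      refine Prod.ext hx ?_
      rw [hl, hx]
      rw [hab e, Sym2.mem_iff] at h1
      simp only [vert]
      rcases h1 with rfl | rfl <;> ring
    nonadj_meet := fun e f hw p hp q hq => by
      have hef : e ≠ f := by
        rintro rfl
        exact hw ⟨a e, by rw [hab e]; simp, by rw [hab e]; simp⟩
      have hm := meet e f p p hef hp.1 hp.2
      have hm' := meet e f q q hef hq.1 hq.2
      have lp : p.2 = (X (a e) + X (b e)) * p.1 - X (a e) * X (b e) := by
        obtain ⟨t, ht, rfl⟩ := hp.1; exact line e t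
      have lq : q.2 = (X (a e) + X (b e)) * q.1 - X (a e) * X (b e) := by
        obtain ⟨t, ht, rfl⟩ := hq.1; exact line e t
      have hpq : p.1 = q.1 := by
        by_contra hpq
        have h1 : (X (a e) + X (b e) - (X (a f) + X (b f))) * (p.1 - q.1) = 0 := by linarith
        rcases mul_eq_zero.1 h1 with h2 | h2
        · have h3 : X (a e) * X (b e) = X (a f) * X (b f) := by
            have : X (a e) + X (b e) = X (a f) + X (b f) := by linarith
            rw [this] at hm; linarith
          have h4 : (X (a e) - X (a f)) * (X (a e) - X (b f)) = 0 := by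
            have : X (b e) = X (a f) + X (b f) - X (a e) := by linarith
            rw [this] at h3
            linarith
          apply hw
          refine ⟨a e, by rw [hab e]; simp, ?_⟩
          rw [hab f, Sym2.mem_iff]
          rcases mul_eq_zero.1 h4 with h5 | h5
          · left; exact Xinj _ _ (by linarith)
          · right; exact Xinj _ _ (by linarith)
        · exact hpq (by linarith)
      exact Prod.ext hpq (by rw [lp, lq, hpq]) }⟩

theorem final (n : ℕ) (hn : 3 ≤ n) (G : SimpleGraph (Fin n)) (hbip : IsBipartite G) :
    3 * (G.edgeSet.ncard : ℝ) - 17 / 2 * n + 19 ≤ (crossingNumber G : ℝ) := by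
  obtain ⟨D0⟩ := exists_drawing n G
  have hmem := Nat.sInf_mem (s := Set.range fun D : Drawing G => D.crossingCount) ⟨_, D0, rfl⟩
  obtain ⟨Dg, hD⟩ := hmem
  have h1 : crossingNumber G = NN Dg / 2 := hD.symm
  have h2 := claim3 n hn G Dg hbip
  obtain ⟨r, hr⟩ := NN_even Dg
  have h3 : crossingNumber G = r := by omega
  rw [h3]
  rw [hr] at h2
  push_cast at h2
  have h4 : (6 * (G.edgeSet.ncard : ℝ) - 17 * n + 38) ≤ r + r := by exact_mod_cast h2
  linarith

end BCN

open Set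

/-- Let `G` be a simple bipartite graph with `n ≥ 3` vertices and `m`
edges. Then `cr(G) ≥ 3 m - (17/2) n + 19`. -/
theorem bipartite_crossing_number_lower_bound (n : ℕ) (hn : 3 ≤ n)
    (G : SimpleGraph (Fin n)) (hbip : IsBipartite G) :
    3 * (G.edgeSet.ncard : ℝ) - 17 / 2 * n + 19 ≤ (crossingNumber G : ℝ) := by
  exact BCN.final n hn G hbip
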